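/- There exists a family of open sets {Ω̃_ε}_{ε>0} in ℝ^N, each of measure ω_N, such that λ_1(Ω̃_ε) < λ_1(Θ), λ_1(Ω̃_ε) → λ_1(Θ) as ε → 0, and (λ_2(Ω̃_ε) - λ_2(Θ))/(λ_1(Θ) - λ_1(Ω̃_ε)) → 0 as ε → 0. Consequently, the lower boundary curve C of the attainable set E = {(λ_1(Ω), λ_2(Ω)) : |Ω| = ω_N} reaches the point P = (λ_1(Θ), λ_2(Θ)) with horizontal tangent. -/

import Mathlib

open MeasureTheory Metric Set Filter Pointwise

noncomputable section

/-- Test functions for the Dirichlet problem on `Ω`: smooth, compactly supported,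
with support inside `Ω`. These are dense in `H¹₀(Ω)`. -/
def testFun (N : ℕ) (Ω : Set (EuclideanSpace ℝ (Fin N))) :
    Set (EuclideanSpace ℝ (Fin N) → ℝ) :=
  {u | ContDiff ℝ (⊤ : ℕ∞) u ∧ HasCompactSupport u ∧ tsupport u ⊆ Ω}

/-- The Rayleigh quotient `‖∇u‖²_{L²} / ‖u‖²_{L²}`. -/
def rayleigh (N : ℕ) (u : EuclideanSpace ℝ (Fin N) → ℝ) : ℝ :=
  (∫ x, ‖fderiv ℝ u x‖ ^ 2) / (∫ x, (u x) ^ 2)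

/-- The `k`-th Dirichlet-Laplacian eigenvalue (k = 1, 2, ...) of an open set `Ω ⊆ ℝ^N`,
via the Courant–Fischer min-max characterization over `k`-dimensional subspaces of
test functions. -/
def dirichletEV (N : ℕ) (k : ℕ) (Ω : Set (EuclideanSpace ℝ (Fin N))) : ℝ :=
  sInf {t : ℝ | ∃ V : Submodule ℝ (EuclideanSpace ℝ (Fin N) → ℝ),
    Module.finrank ℝ V = k ∧ (V : Set _) ⊆ testFun N Ω ∪ {0} ∧
    ∀ u ∈ V, u ≠ 0 → rayleigh N u ≤ t}

/-- `ω_N`, the volume of the unit ball in `ℝ^N`, as a real number. -/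
def unitBallVol (N : ℕ) : ℝ :=
  (volume (ball (0 : EuclideanSpace ℝ (Fin N)) 1)).toReal

/-- A disjoint union `Θ` of two balls of volume `ω_N/2` (radius `2^{-1/N}`). -/
def twoBalls (N : ℕ) [NeZero N] : Set (EuclideanSpace ℝ (Fin N)) :=
  ball (EuclideanSpace.single 0 2) ((2 : ℝ) ^ (-(1 : ℝ) / N)) ∪
  ball (EuclideanSpace.single 0 (-2)) ((2 : ℝ) ^ (-(1 : ℝ) / N))

/-- Euclidean space of dimension `N`. -/
abbrev Sp (N : ℕ) := EuclideanSpace ℝ (Fin N)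

/-- The `i`-th partial derivative. -/
def pd {N : ℕ} (i : Fin N) (u : Sp N → ℝ) (x : Sp N) : ℝ :=
  fderiv ℝ u x (EuclideanSpace.single i 1)

/-- The open half-space where the first coordinate is positive. -/
def halfSp (N : ℕ) [NeZero N] : Set (Sp N) := {x | 0 < x 0}

theorem measurableSet_halfSp {N : ℕ} [NeZero N] : MeasurableSet (halfSp N) :=
  (isOpen_lt continuous_const (by fun_prop)).measurableSet

theorem isOpen_halfSp {N : ℕ} [NeZero N] : IsOpen (halfSp N) :=
  isOpen_lt continuous_const (by fun_prop)

theorem norm_sq_clm {N : ℕ} (T : Sp N →L[ℝ] ℝ) :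
    ‖T‖ ^ 2 = ∑ i, (T (EuclideanSpace.single i 1)) ^ 2 := by
  obtain ⟨v, rfl⟩ := (InnerProductSpace.toDual ℝ (Sp N)).surjective T
  rw [LinearIsometryEquiv.norm_map, EuclideanSpace.real_norm_sq_eq]
  simp [InnerProductSpace.toDual_apply_apply, EuclideanSpace.inner_single_right]

theorem norm_sq_fderiv {N : ℕ} (u : Sp N → ℝ) (x : Sp N) :
    ‖fderiv ℝ u x‖ ^ 2 = ∑ i, (pd i u x) ^ 2 := norm_sq_clm _

theorem continuous_pd {N : ℕ} {u : Sp N → ℝ} (hu : ContDiff ℝ 1 u) (i : Fin N) :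
    Continuous (pd i u) :=
  (hu.continuous_fderiv (by norm_num)).clm_apply continuous_const

theorem hasCompactSupport_pd {N : ℕ} {u : Sp N → ℝ} (hu : HasCompactSupport u) (i : Fin N) :
    HasCompactSupport (pd i u) := hu.fderiv_apply (𝕜 := ℝ) _

theorem integral_pd_eq_zero {N : ℕ} {u : Sp N → ℝ} (hu : ContDiff ℝ 1 u)
    (hc : HasCompactSupport u) (i : Fin N) : ∫ x, pd i u x = 0 := by
  have h1 : Integrable (pd i u) :=
    (continuous_pd hu i).integrable_of_hasCompactSupport (hasCompactSupport_pd hc i)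
  have h2 : Integrable u := hu.continuous.integrable_of_hasCompactSupport hc
  have h := integral_mul_fderiv_eq_neg_fderiv_mul_of_integrable (𝕜 := ℝ) (μ := volume)
    (f := fun _ : Sp N => (1 : ℝ)) (g := u) (v := EuclideanSpace.single i 1) (by simp)
    (by simp only [one_mul]; exact h1) (by simpa using h2)
    (fun x _ => by fun_prop) (fun x _ => (hu.differentiable (by norm_num)) x)
  simpa [pd] using h

theorem pd_mul {N : ℕ} {u v : Sp N → ℝ} {x : Sp N} (hu : DifferentiableAt ℝ u x)
    (hv : DifferentiableAt ℝ v x) (i : Fin N) :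
    pd i (fun y => u y * v y) x = u x * pd i v x + pd i u x * v x := by
  simp only [pd]
  rw [fderiv_fun_mul hu hv]
  simp [mul_comm]

theorem bounded_deriv_smoothTransition :
    ∃ M : ℝ, 0 ≤ M ∧ ∀ t, |deriv Real.smoothTransition t| ≤ M := by
  have hc : Continuous (deriv Real.smoothTransition) :=
    (Real.smoothTransition.contDiff (n := 1)).continuous_deriv (by norm_num)
  obtain ⟨M, hM⟩ := (isCompact_Icc (a := (0:ℝ)) (b := 1)).exists_bound_of_continuousOn
    hc.continuousOn
  refine ⟨M, (norm_nonneg _).trans (hM 0 (by simp)), fun t => ?_⟩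
  have hM0 : 0 ≤ M := (norm_nonneg _).trans (hM 0 (by simp))
  rcases lt_or_ge t 0 with h | h
  · have : Real.smoothTransition =ᶠ[nhds t] fun _ => 0 := by
      filter_upwards [Iio_mem_nhds h] with s hs
      exact Real.smoothTransition.zero_of_nonpos (le_of_lt hs)
    rw [this.deriv_eq]; simpa using hM0
  rcases lt_or_ge 1 t with h' | h'
  · have : Real.smoothTransition =ᶠ[nhds t] fun _ => 1 := by
      filter_upwards [Ioi_mem_nhds h'] with s hs
      exact Real.smoothTransition.one_of_one_le (le_of_lt hs)
    rw [this.deriv_eq]; simpa using hM0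
  · exact hM t ⟨h, h'⟩

theorem deriv_smoothTransition_eq_zero {t : ℝ} (h : t ≤ 0 ∨ 1 ≤ t) :
    deriv Real.smoothTransition t = 0 := by
  rcases h with h | h
  · refine IsLocalMin.deriv_eq_zero (Filter.Eventually.of_forall fun s => ?_)
    rw [Real.smoothTransition.zero_of_nonpos h]
    exact Real.smoothTransition.nonneg s
  · refine IsLocalMax.deriv_eq_zero (Filter.Eventually.of_forall fun s => ?_)
    rw [Real.smoothTransition.one_of_one_le h]
    exact Real.smoothTransition.le_one s

theorem deriv_smoothTransition_nonneg (t : ℝ) : 0 ≤ deriv Real.smoothTransition t :=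
  Real.smoothTransition.monotone.deriv_nonneg

/-- A smooth cutoff depending on the first coordinate only. -/
def axialCut {N : ℕ} [NeZero N] (k a : ℝ) (x : Sp N) : ℝ := Real.smoothTransition (k * (x 0) - a)

theorem contDiff_axialCut {N : ℕ} [NeZero N] (k a : ℝ) {n : ℕ∞} :
    ContDiff ℝ n (axialCut (N := N) k a) := by
  unfold axialCut
  exact Real.smoothTransition.contDiff.comp (by fun_prop)

theorem pd_coord {N : ℕ} [NeZero N] (i j : Fin N) (x : Sp N) :
    pd i (fun y : Sp N => y j) x = if i = j then 1 else 0 := by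
  have : HasFDerivAt (fun y : Sp N => y j) (EuclideanSpace.proj j : Sp N →L[ℝ] ℝ) x :=
    (EuclideanSpace.proj j : Sp N →L[ℝ] ℝ).hasFDerivAt
  rw [pd, this.fderiv]
  simp [eq_comm]

theorem pd_comp {N : ℕ} {g : ℝ → ℝ} {u : Sp N → ℝ} {x : Sp N} (hg : DifferentiableAt ℝ g (u x))
    (hu : DifferentiableAt ℝ u x) (i : Fin N) :
    pd i (fun y => g (u y)) x = deriv g (u x) * pd i u x := by
  have := (hg.hasDerivAt.comp_hasFDerivAt x hu.hasFDerivAt).fderiv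
  simp only [pd]
  have h2 : (fun y => g (u y)) = g ∘ u := rfl
  rw [h2, this]; simp

theorem pd_axialCut {N : ℕ} [NeZero N] (k a : ℝ) (i : Fin N) (x : Sp N) :
    pd i (axialCut k a) x =
      deriv Real.smoothTransition (k * (x 0) - a) * (if i = 0 then k else 0) := by
  have h : pd i (fun y : Sp N => k * y 0 - a) x = if i = 0 then k else 0 := by
    have h0 : HasFDerivAt (fun y : Sp N => k * y 0 - a)
        (k • (EuclideanSpace.proj 0 : Sp N →L[ℝ] ℝ)) x :=
      ((EuclideanSpace.proj 0 : Sp N →L[ℝ] ℝ).hasFDerivAt.const_mul k).sub_const a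
    rw [pd, h0.fderiv]
    simp [eq_comm]
  rw [← h]
  exact pd_comp ((Real.smoothTransition.contDiff (n := 1)).differentiable (by norm_num) _)
    (by fun_prop) i

/-- One-sided linear bound for a compactly supported function that is nonpositive on the
boundary of the half-space. -/
theorem le_mul_coord_of_nonpos {N : ℕ} [NeZero N] {ψ : Sp N → ℝ}
    (hψ : ∀ x : Sp N, 0 ≤ x 0 → ContDiffAt ℝ 1 ψ x) (hc : HasCompactSupport ψ)
    (h0 : ∀ x : Sp N, x 0 = 0 → ψ x ≤ 0) :
    ∃ M, 0 ≤ M ∧ ∀ x : Sp N, 0 ≤ x 0 → ψ x ≤ M * x 0 := by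
  have hK : IsCompact (tsupport ψ ∩ {x : Sp N | 0 ≤ x 0}) :=
    hc.isCompact.inter_right (isClosed_le continuous_const (by fun_prop))
  have hcont : ContinuousOn (pd 0 ψ) (tsupport ψ ∩ {x : Sp N | 0 ≤ x 0}) := by
    intro x hx
    have := ((hψ x hx.2).fderiv_right (m := 0) (by norm_num)).continuousAt
    exact (this.clm_apply continuousAt_const).continuousWithinAt
  obtain ⟨M, hM⟩ := hK.exists_bound_of_continuousOn hcont
  have hb : ∀ x : Sp N, 0 ≤ x 0 → ‖pd 0 ψ x‖ ≤ max M 0 := by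
    intro x hx
    by_cases hxs : x ∈ tsupport ψ
    · exact (hM x ⟨hxs, hx⟩).trans (le_max_left _ _)
    · have : pd 0 ψ x = 0 := by
        have h1 : fderiv ℝ ψ x = 0 := by
          by_contra hne
          exact hxs (support_fderiv_subset ℝ (Function.mem_support.2 hne))
        simp [pd, h1]
      simp [this]
  refine ⟨max M 0, le_max_right _ _, fun x hx => ?_⟩
  set y : Sp N := x - x 0 • EuclideanSpace.single 0 1 with hy
  have hy0 : y 0 = 0 := by simp [hy]
  have hder : ∀ s ∈ Icc (0:ℝ) (x 0), HasDerivWithinAt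
      (fun s => ψ (y + s • EuclideanSpace.single 0 1))
      (pd 0 ψ (y + s • EuclideanSpace.single 0 1)) (Icc 0 (x 0)) s := by
    intro s hs
    have hd : DifferentiableAt ℝ ψ (y + s • EuclideanSpace.single 0 1) :=
      (hψ _ (by simp [hy0, hs.1])).differentiableAt (by norm_num)
    have h2 : HasDerivAt (fun s : ℝ => y + s • (EuclideanSpace.single 0 1 : Sp N))
        (EuclideanSpace.single 0 1) s := by
      simpa using ((hasDerivAt_id s).smul_const (EuclideanSpace.single 0 1 : Sp N)).const_add y
    exact (hd.hasFDerivAt.comp_hasDerivAt s h2).hasDerivWithinAt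
  have h := (convex_Icc (0:ℝ) (x 0)).norm_image_sub_le_of_norm_hasDerivWithin_le hder
    (fun s hs => hb _ (by simp [hy0, hs.1])) (left_mem_Icc.2 hx) (right_mem_Icc.2 hx)
  have e1 : y + x 0 • EuclideanSpace.single 0 1 = x := by simp [hy]
  simp only [e1, zero_smul, add_zero, sub_zero, Real.norm_eq_abs, abs_of_nonneg hx] at h
  have := h0 y hy0
  linarith [le_abs_self (ψ x - ψ y)]

theorem contDiff_axialCut_mul {N : ℕ} [NeZero N] {ψ : Sp N → ℝ}
    (hψ : ∀ x : Sp N, 0 ≤ x 0 → ContDiffAt ℝ 1 ψ x) {k : ℝ} (hk : 0 ≤ k) :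
    ContDiff ℝ 1 (fun x => axialCut k 0 x * ψ x) := by
  rw [contDiff_iff_contDiffAt]
  intro x
  rcases lt_or_ge (x 0) 0 with h | h
  · have : (fun x => axialCut k 0 x * ψ x) =ᶠ[nhds x] fun _ => 0 := by
      have ho : IsOpen {x : Sp N | x 0 < 0} := isOpen_lt (by fun_prop) continuous_const
      filter_upwards [ho.mem_nhds h] with z hz
      have : axialCut k 0 z = 0 := by
        apply Real.smoothTransition.zero_of_nonpos
        have : k * z 0 ≤ 0 := mul_nonpos_of_nonneg_of_nonpos hk (le_of_lt hz)
        simpa using this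
      simp [this]
    exact contDiffAt_const.congr_of_eventuallyEq this
  · exact ((contDiff_axialCut (n := 1) k 0).contDiffAt).mul (hψ x h)

theorem setIntegral_pd_nonneg {N : ℕ} [NeZero N] {ψ : Sp N → ℝ}
    (hψ : ∀ x : Sp N, 0 ≤ x 0 → ContDiffAt ℝ 1 ψ x) (hc : HasCompactSupport ψ) (i : Fin N)
    (h0 : i = 0 → ∀ x : Sp N, x 0 = 0 → ψ x ≤ 0) :
    IntegrableOn (pd i ψ) (halfSp N) ∧ 0 ≤ ∫ x in halfSp N, pd i ψ x := by
  set K := tsupport ψ ∩ {x : Sp N | 0 ≤ x 0} with hKdef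
  have hK : IsCompact K :=
    hc.isCompact.inter_right (isClosed_le continuous_const (by fun_prop))
  have hcontAt : ∀ x : Sp N, 0 ≤ x 0 → ContinuousAt (pd i ψ) x := by
    intro x hx
    have := ((hψ x hx).fderiv_right (m := 0) (by norm_num)).continuousAt
    exact this.clm_apply continuousAt_const
  obtain ⟨B, hB⟩ := hK.exists_bound_of_continuousOn
    (fun x hx => (hcontAt x hx.2).continuousWithinAt)
  have hzero : ∀ x, x ∉ tsupport ψ → pd i ψ x = 0 := by
    intro x hxs
    have h1 : fderiv ℝ ψ x = 0 := by
      by_contra hne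
      exact hxs (support_fderiv_subset ℝ (Function.mem_support.2 hne))
    simp [pd, h1]
  have hbd : ∀ x : Sp N, 0 ≤ x 0 → ‖pd i ψ x‖ ≤ K.indicator (fun _ => B) x := by
    intro x hx
    by_cases hxs : x ∈ tsupport ψ
    · have : x ∈ K := ⟨hxs, hx⟩
      simpa [this] using hB x this
    · have : x ∉ K := fun h => hxs h.1
      simp [this, hzero x hxs]
  have hbi : Integrable (K.indicator (fun _ => B)) :=
    (integrable_indicator_iff hK.measurableSet).2 (integrableOn_const hK.measure_lt_top.ne)
  have hmeas : AEStronglyMeasurable (pd i ψ) (volume.restrict (halfSp N)) :=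
    ContinuousOn.aestronglyMeasurable
      (fun x hx => (hcontAt x (le_of_lt hx)).continuousWithinAt) measurableSet_halfSp
  have hint : IntegrableOn (pd i ψ) (halfSp N) := by
    refine Integrable.mono' hbi.integrableOn hmeas ?_
    filter_upwards [ae_restrict_mem measurableSet_halfSp] with x hx using hbd x (le_of_lt hx)
  refine ⟨hint, ?_⟩
  obtain ⟨M, hM0, hM⟩ := bounded_deriv_smoothTransition
  obtain ⟨C, hC0, hC⟩ : ∃ C, 0 ≤ C ∧ (i = 0 → ∀ x : Sp N, 0 ≤ x 0 → ψ x ≤ C * x 0) := by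
    by_cases hi : i = 0
    · obtain ⟨C, h, h'⟩ := le_mul_coord_of_nonpos hψ hc (h0 hi)
      exact ⟨C, h, fun _ => h'⟩
    · exact ⟨0, le_rfl, fun h => (hi h).elim⟩
  have hk : ∀ n : ℕ, (0:ℝ) < (n:ℝ) + 1 := fun n => by positivity
  set A : ℕ → Set (Sp N) := fun n => K ∩ {x | 0 < x 0 ∧ ((n:ℝ) + 1) * x 0 < 1} with hA
  have hAm : ∀ n, MeasurableSet (A n) := fun n => hK.measurableSet.inter
    ((isOpen_lt (f := fun _ => (0:ℝ)) (g := fun x : Sp N => x 0) continuous_const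
      (by fun_prop)).inter (isOpen_lt (f := fun x : Sp N => ((n:ℝ) + 1) * x 0) (g := fun _ => (1:ℝ))
        (by fun_prop) continuous_const)).measurableSet
  have hpt : ∀ n : ℕ, pd i (fun x => axialCut ((n:ℝ)+1) 0 x * ψ x) =
      fun x => (axialCut ((n:ℝ)+1) 0 x * pd i ψ x + pd i (axialCut ((n:ℝ)+1) 0) x * ψ x) := by
    intro n
    funext x
    rcases lt_or_ge (x 0) 0 with h | h
    · have h1 : (fun x => axialCut ((n:ℝ)+1) 0 x * ψ x) =ᶠ[nhds x] fun _ => 0 := by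
        have ho : IsOpen {x : Sp N | x 0 < 0} := isOpen_lt (by fun_prop) continuous_const
        filter_upwards [ho.mem_nhds h] with z hz
        have : axialCut ((n:ℝ)+1) 0 z = 0 := by
          apply Real.smoothTransition.zero_of_nonpos
          have : ((n:ℝ)+1) * z 0 ≤ 0 :=
            mul_nonpos_of_nonneg_of_nonpos (hk n).le (le_of_lt hz)
          simpa using this
        simp [this]
      have h2 : ((n:ℝ)+1) * x 0 ≤ 0 := mul_nonpos_of_nonneg_of_nonpos (hk n).le h.le
      have h3 : axialCut ((n:ℝ)+1) 0 x = 0 := by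
        apply Real.smoothTransition.zero_of_nonpos; simpa using h2
      rw [h3, pd_axialCut, deriv_smoothTransition_eq_zero (by left; simpa using h2)]
      simp [pd, h1.fderiv_eq]
    · exact (pd_mul ((contDiff_axialCut (n := 1) _ _).differentiable (by norm_num) x)
        ((hψ x h).differentiableAt (by norm_num)) i)
  have hfund : ∀ n : ℕ, 0 = ∫ x, (axialCut ((n:ℝ)+1) 0 x * pd i ψ x +
      pd i (axialCut ((n:ℝ)+1) 0) x * ψ x) := by
    intro n
    rw [← hpt n, integral_pd_eq_zero (contDiff_axialCut_mul hψ (hk n).le) hc.mul_left i]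
  have hle : ∀ n : ℕ, -(∫ x, (A n).indicator (fun _ => M * C) x) ≤
      ∫ x in halfSp N, axialCut ((n:ℝ)+1) 0 x * pd i ψ x := by
    intro n
    have e : ∫ x in halfSp N, axialCut ((n:ℝ)+1) 0 x * pd i ψ x =
        ∫ x, axialCut ((n:ℝ)+1) 0 x * pd i ψ x := by
      refine setIntegral_eq_integral_of_forall_compl_eq_zero fun x hx => ?_
      have : axialCut ((n:ℝ)+1) 0 x = 0 := by
        apply Real.smoothTransition.zero_of_nonpos
        have : ((n:ℝ)+1) * x 0 ≤ 0 :=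
          mul_nonpos_of_nonneg_of_nonpos (hk n).le (not_lt.1 hx)
        simpa using this
      simp [this]
    have hI1 : Integrable (fun x => axialCut ((n:ℝ)+1) 0 x * pd i ψ x) := by
      have : (fun x => axialCut ((n:ℝ)+1) 0 x * pd i ψ x) =
          (halfSp N).indicator (fun x => axialCut ((n:ℝ)+1) 0 x * pd i ψ x) := by
        funext x
        by_cases hx : x ∈ halfSp N
        · simp [hx]
        · have : axialCut ((n:ℝ)+1) 0 x = 0 := by
            apply Real.smoothTransition.zero_of_nonpos
            have : ((n:ℝ)+1) * x 0 ≤ 0 :=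
              mul_nonpos_of_nonneg_of_nonpos (hk n).le (not_lt.1 hx)
            simpa using this
          simp [hx, this]
      rw [this, integrable_indicator_iff measurableSet_halfSp]
      refine Integrable.bdd_mul (c := 1) hint ?_ ?_
      · exact (contDiff_axialCut (n := 1) _ _).continuous.aestronglyMeasurable
      · refine Filter.Eventually.of_forall fun x => ?_
        rw [Real.norm_eq_abs, axialCut, abs_of_nonneg (Real.smoothTransition.nonneg _)]
        exact Real.smoothTransition.le_one _
    have hcd := contDiff_axialCut_mul hψ (hk n).le
    have hIsum : Integrable (fun x => axialCut ((n:ℝ)+1) 0 x * pd i ψ x +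
        pd i (axialCut ((n:ℝ)+1) 0) x * ψ x) := by
      rw [← hpt n]
      exact (continuous_pd hcd i).integrable_of_hasCompactSupport
        (hasCompactSupport_pd hc.mul_left i)
    have hI2 : Integrable (fun x => pd i (axialCut ((n:ℝ)+1) 0) x * ψ x) := by
      refine (hIsum.sub hI1).congr (Filter.Eventually.of_forall fun x => ?_)
      simp
    have h := hfund n
    rw [integral_add hI1 hI2] at h
    rw [e]
    have hIA : Integrable ((A n).indicator (fun _ => M * C)) :=
      (integrable_indicator_iff (hAm n)).2
        (integrableOn_const (lt_of_le_of_lt (measure_mono inter_subset_left) hK.measure_lt_top).ne)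
    have : ∫ x, pd i (axialCut ((n:ℝ)+1) 0) x * ψ x ≤ ∫ x, (A n).indicator (fun _ => M * C) x := by
      refine integral_mono hI2 hIA fun x => ?_
      simp only
      rw [pd_axialCut]
      by_cases hi : i = 0
      · by_cases hx : x ∈ A n
        · rw [indicator_of_mem hx]
          obtain ⟨-, hx0, hx1⟩ := hx
          have a1 := hC hi x hx0.le
          have a2 := deriv_smoothTransition_nonneg (((n:ℝ)+1) * x 0 - 0)
          have a3 := (le_abs_self _).trans (hM (((n:ℝ)+1) * x 0 - 0))
          simp only [hi, if_true]
          set d := deriv Real.smoothTransition (((n:ℝ)+1) * x 0 - 0)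
          calc d * ((n:ℝ)+1) * ψ x ≤ d * ((n:ℝ)+1) * (C * x 0) := by
                gcongr
            _ = d * C * (((n:ℝ)+1) * x 0) := by ring
            _ ≤ d * C * 1 := by gcongr
            _ ≤ M * C := by rw [mul_one]; gcongr
        · rw [indicator_of_notMem hx]
          by_cases hxz : 0 < x 0 ∧ ((n:ℝ)+1) * x 0 < 1
          · have : x ∉ tsupport ψ := fun h => hx ⟨⟨h, hxz.1.le⟩, hxz⟩
            simp [image_eq_zero_of_notMem_tsupport this]
          · rw [deriv_smoothTransition_eq_zero]
            · simp
            · by_cases h' : 0 < x 0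
              · right; simpa using not_lt.1 fun hh => hxz ⟨h', hh⟩
              · left
                simpa using mul_nonpos_of_nonneg_of_nonpos (hk n).le (not_lt.1 h')
      · simp only [hi, if_false, mul_zero, zero_mul]
        exact indicator_nonneg (fun _ _ => by positivity) x
    linarith
  have hlimA : Tendsto (fun n => -(∫ x, (A n).indicator (fun _ => M * C) x)) atTop (nhds 0) := by
    have : Tendsto (fun n => (∫ x, (A n).indicator (fun _ => M * C) x)) atTop
        (nhds (∫ x : Sp N, (0:ℝ))) := by
      refine tendsto_integral_of_dominated_convergence (K.indicator fun _ => M * C)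
        (fun n => (aestronglyMeasurable_const.indicator (hAm n)))
        ((integrable_indicator_iff hK.measurableSet).2
          (integrableOn_const hK.measure_lt_top.ne)) ?_ ?_
      · intro n
        refine Filter.Eventually.of_forall fun x => ?_
        rw [norm_indicator_eq_indicator_norm, Real.norm_of_nonneg (by positivity)]
        exact indicator_le_indicator_of_subset inter_subset_left (fun _ => by positivity) x
      · refine Filter.Eventually.of_forall fun x => ?_
        refine tendsto_const_nhds.congr' ?_
        rcases le_or_gt (x 0) 0 with h | h
        · refine Filter.Eventually.of_forall fun n => ?_
          simp only
          rw [indicator_of_notMem]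
          exact fun hh => absurd hh.2.1 (not_lt.2 h)
        · obtain ⟨n0, hn0⟩ := exists_nat_gt (1 / x 0)
          filter_upwards [eventually_ge_atTop n0] with n hn
          rw [indicator_of_notMem]
          intro hh
          have h1 := hh.2.2
          rw [div_lt_iff₀ h] at hn0
          have : (n0:ℝ) ≤ n := by exact_mod_cast hn
          nlinarith
    simpa using this.neg
  have hlim : Tendsto (fun n : ℕ => ∫ x in halfSp N, axialCut ((n:ℝ)+1) 0 x * pd i ψ x) atTop
      (nhds (∫ x in halfSp N, pd i ψ x)) := by
    refine tendsto_integral_of_dominated_convergence (fun x => ‖pd i ψ x‖)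
      (fun n => ((contDiff_axialCut (n := 1) _ _).continuous.aestronglyMeasurable).mul hmeas)
      hint.norm ?_ ?_
    · intro n
      refine Filter.Eventually.of_forall fun x => ?_
      rw [norm_mul, axialCut, Real.norm_of_nonneg (Real.smoothTransition.nonneg _)]
      exact mul_le_of_le_one_left (norm_nonneg _) (Real.smoothTransition.le_one _)
    · filter_upwards [ae_restrict_mem measurableSet_halfSp] with x hx
      refine tendsto_const_nhds.congr' ?_
      obtain ⟨n0, hn0⟩ := exists_nat_gt (1 / x 0)
      filter_upwards [eventually_ge_atTop n0] with n hn
      have : axialCut ((n:ℝ)+1) 0 x = 1 := by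
        apply Real.smoothTransition.one_of_one_le
        rw [div_lt_iff₀ hx] at hn0
        have h1 : (n0:ℝ) ≤ n := by exact_mod_cast hn
        have h2 : (0:ℝ) < x 0 := hx
        nlinarith
      rw [this, one_mul]
  exact le_of_tendsto_of_tendsto hlimA hlim (Filter.Eventually.of_forall hle)

theorem pd_eq_zero_of_notMem {N : ℕ} {u : Sp N → ℝ} {x : Sp N} (h : x ∉ tsupport u) (i : Fin N) :
    pd i u x = 0 := by
  have h1 : fderiv ℝ u x = 0 := by
    by_contra hne
    exact h (support_fderiv_subset ℝ (Function.mem_support.2 hne))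
  simp [pd, h1]

theorem contDiffAt_pd {N : ℕ} {w : Sp N → ℝ} {x : Sp N} {m n : WithTop ℕ∞}
    (h : ContDiffAt ℝ n w x) (hmn : m + 1 ≤ n) (i : Fin N) : ContDiffAt ℝ m (pd i w) x :=
  (h.fderiv_right hmn).clm_apply contDiffAt_const

theorem integrable_sq {N : ℕ} {u : Sp N → ℝ} (hu : Continuous u) (hc : HasCompactSupport u) :
    Integrable (fun x => u x ^ 2) := by
  simp only [pow_two]
  exact (hu.mul hu).integrable_of_hasCompactSupport hc.mul_left

theorem integrable_norm_fderiv_sq {N : ℕ} {u : Sp N → ℝ} (hu : ContDiff ℝ 1 u)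
    (hc : HasCompactSupport u) : Integrable (fun x => ‖fderiv ℝ u x‖ ^ 2) := by
  simp only [norm_sq_fderiv]
  exact integrable_finsetSum _ fun i _ =>
    integrable_sq (continuous_pd hu i) (hasCompactSupport_pd hc i)

/-- Barta's inequality on the half-space, with the ground-state remainder. -/
theorem barta_halfSp {N : ℕ} [NeZero N] {u w : Sp N → ℝ} {Λ : ℝ} (hu : ContDiff ℝ 1 u)
    (hc : HasCompactSupport u)
    (hw : ∀ x ∈ tsupport u, 0 ≤ x 0 → ContDiffAt ℝ 2 w x)
    (hpos : ∀ x ∈ tsupport u, 0 ≤ x 0 → 0 < w x)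
    (hΔ : ∀ x ∈ tsupport u, 0 < x 0 → ∑ i, pd i (pd i w) x ≤ -(Λ * w x))
    (hb : ∀ x ∈ tsupport u, x 0 = 0 → u x = 0 ∨ pd 0 w x ≤ 0) :
    IntegrableOn (fun x => ∑ i, (pd i u x - u x * (pd i w x / w x)) ^ 2) (halfSp N) ∧
    Λ * (∫ x in halfSp N, u x ^ 2) +
      (∫ x in halfSp N, ∑ i, (pd i u x - u x * (pd i w x / w x)) ^ 2) ≤
      ∫ x in halfSp N, ‖fderiv ℝ u x‖ ^ 2 := by
  set X : Fin N → Sp N → ℝ := fun i x => u x * u x * (pd i w x / w x) with hX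
  have hXc : ∀ i, HasCompactSupport (X i) := fun i => (hc.mul_left).mul_right
  have hPc : ∀ i, ∀ x ∈ tsupport u, 0 ≤ x 0 → ContDiffAt ℝ 1 (fun x => pd i w x / w x) x :=
    fun i x hx h0 => (contDiffAt_pd (hw x hx h0) (by norm_num) i).div
      ((hw x hx h0).of_le (by norm_num)) (hpos x hx h0).ne'
  have hloc : ∀ x, x ∉ tsupport u → u =ᶠ[nhds x] 0 := fun x hx =>
    notMem_tsupport_iff_eventuallyEq.1 hx
  have hXd : ∀ i, ∀ x : Sp N, 0 ≤ x 0 → ContDiffAt ℝ 1 (X i) x := by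
    intro i x h0
    by_cases hx : x ∈ tsupport u
    · exact (hu.contDiffAt.mul hu.contDiffAt).mul (hPc i x hx h0)
    · have : X i =ᶠ[nhds x] fun _ => 0 := by
        filter_upwards [hloc x hx] with z hz
        simp [hX, hz]
      exact contDiffAt_const.congr_of_eventuallyEq this
  have hHS := fun i => setIntegral_pd_nonneg (hXd i) (hXc i) i (by
    rintro rfl x h0
    by_cases hx : x ∈ tsupport u
    · rcases hb x hx h0 with h | h
      · simp [hX, h]
      · have := hpos x hx h0.ge
        exact mul_nonpos_of_nonneg_of_nonpos (mul_self_nonneg _)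
          (div_nonpos_of_nonpos_of_nonneg h this.le)
    · simp [hX, image_eq_zero_of_notMem_tsupport hx])
  have hIu := (integrable_sq hu.continuous hc).integrableOn (s := halfSp N)
  have hIg := (integrable_norm_fderiv_sq hu hc).integrableOn (s := halfSp N)
  have hIX : IntegrableOn (fun x => ∑ i, pd i (X i) x) (halfSp N) :=
    integrable_finsetSum _ fun i _ => (hHS i).1
  have hkey : ∀ x ∈ halfSp N, ∑ i, (pd i u x - u x * (pd i w x / w x)) ^ 2 +
      (∑ i, pd i (X i) x + Λ * u x ^ 2) ≤ ‖fderiv ℝ u x‖ ^ 2 := by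
    intro x h0
    have h0' : 0 ≤ x 0 := le_of_lt h0
    rw [norm_sq_fderiv]
    by_cases hx : x ∈ tsupport u
    · have hwp := hpos x hx h0'
      have hwd := hw x hx h0'
      have hud : DifferentiableAt ℝ u x := hu.differentiable (by norm_num) x
      have e : ∀ i, pd i (X i) x = 2 * u x * pd i u x * (pd i w x / w x) +
          u x ^ 2 * (pd i (pd i w) x / w x - (pd i w x / w x) ^ 2) := by
        intro i
        have hPd : DifferentiableAt ℝ (pd i w) x :=
          (contDiffAt_pd hwd (m := 1) (by norm_num) i).differentiableAt (by norm_num)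
        have hwd1 : DifferentiableAt ℝ w x := hwd.differentiableAt (by norm_num)
        have hq : pd i (fun x => pd i w x / w x) x =
            pd i (pd i w) x / w x - (pd i w x / w x) ^ 2 := by
          have : pd i (pd i w) x = pd i (fun y => (pd i w y / w y) * w y) x := by
            have : pd i w =ᶠ[nhds x] fun y => (pd i w y / w y) * w y := by
              filter_upwards [hwd.continuousAt.eventually_ne hwp.ne'] with y hy
              field_simp
            simp only [pd, this.fderiv_eq]
          rw [this, pd_mul ((hPc i x hx h0').differentiableAt (by norm_num)) hwd1]
          field_simp
          ring
        have h1 := pd_mul (hud.mul hud) ((hPc i x hx h0').differentiableAt (by norm_num)) i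
        have h2 := pd_mul hud hud i
        simp only [hX]
        change pd i (fun y => (u y * u y) * (pd i w y / w y)) x = _
        have h3 : pd i (u * u) x = pd i (fun y => u y * u y) x := rfl
        rw [h3, h2, hq] at h1
        refine h1.trans ?_
        simp only [Pi.mul_apply]
        ring
      have hs : ∑ i, (pd i u x - u x * (pd i w x / w x)) ^ 2 + ∑ i, pd i (X i) x =
          ∑ i, (pd i u x) ^ 2 + u x ^ 2 * ((∑ i, pd i (pd i w) x) / w x) := by
        rw [← Finset.sum_add_distrib, Finset.sum_div, Finset.mul_sum, ← Finset.sum_add_distrib]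
        refine Finset.sum_congr rfl fun i _ => ?_
        rw [e i]; ring
      have h4 : (∑ i, pd i (pd i w) x) / w x ≤ -Λ := by
        rw [div_le_iff₀ hwp]; linarith [hΔ x hx h0]
      have h5 := mul_le_mul_of_nonneg_left h4 (sq_nonneg (u x))
      linarith
    · have hXz : ∀ i, pd i (X i) x = 0 := fun i =>
        pd_eq_zero_of_notMem (fun h => hx (closure_mono (fun z hz => by
          simp only [hX, Function.mem_support] at hz ⊢
          intro h; simp [h] at hz) h)) i
      simp [hXz, image_eq_zero_of_notMem_tsupport hx, pd_eq_zero_of_notMem hx]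
  have hmeas : AEStronglyMeasurable (fun x => ∑ i, (pd i u x - u x * (pd i w x / w x)) ^ 2)
      (volume.restrict (halfSp N)) := by
    refine ContinuousOn.aestronglyMeasurable (fun x h0 => ?_) measurableSet_halfSp
    have : ∀ i, ContinuousAt (fun x => u x * (pd i w x / w x)) x := by
      intro i
      by_cases hx : x ∈ tsupport u
      · exact hu.continuous.continuousAt.mul (hPc i x hx (le_of_lt h0)).continuousAt
      · have : (fun x => u x * (pd i w x / w x)) =ᶠ[nhds x] fun _ => 0 := by
          filter_upwards [hloc x hx] with z hz
          simp [hz]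
        exact continuousAt_const.congr this.symm
    refine ContinuousAt.continuousWithinAt ?_
    exact tendsto_finsetSum _ fun i _ =>
      (((continuous_pd hu i).continuousAt.sub (this i)).pow 2)
  have hIq : IntegrableOn (fun x => ∑ i, (pd i u x - u x * (pd i w x / w x)) ^ 2) (halfSp N) := by
    refine Integrable.mono' (hIg.sub (hIX.add (hIu.const_mul Λ))) hmeas ?_
    filter_upwards [ae_restrict_mem measurableSet_halfSp] with x hx
    rw [Real.norm_of_nonneg (Finset.sum_nonneg fun i _ => sq_nonneg _)]
    have := hkey x hx
    simp only [Pi.sub_apply, Pi.add_apply]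
    linarith
  refine ⟨hIq, ?_⟩
  have h := setIntegral_mono_on (hIq.add (hIX.add (hIu.const_mul Λ))) hIg measurableSet_halfSp hkey
  have h1 : ∫ x in halfSp N, (∑ i, (pd i u x - u x * (pd i w x / w x)) ^ 2 +
      (∑ i, pd i (X i) x + Λ * u x ^ 2)) =
      (∫ x in halfSp N, ∑ i, (pd i u x - u x * (pd i w x / w x)) ^ 2) +
      (∑ i, (∫ x in halfSp N, pd i (X i) x) + Λ * ∫ x in halfSp N, u x ^ 2) := by
    have hI2 : IntegrableOn (fun x => ∑ i, pd i (X i) x + Λ * u x ^ 2) (halfSp N) :=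
      hIX.add (hIu.const_mul Λ)
    rw [integral_add hIq hI2, integral_add hIX (hIu.const_mul Λ),
      integral_finsetSum _ fun i _ => (hHS i).1, integral_const_mul]
  have h2 : 0 ≤ ∑ i, (∫ x in halfSp N, pd i (X i) x) := Finset.sum_nonneg fun i _ => (hHS i).2
  have h3 : ∫ x in halfSp N, (∑ i, (pd i u x - u x * (pd i w x / w x)) ^ 2 +
      (∑ i, pd i (X i) x + Λ * u x ^ 2)) ≤ ∫ x in halfSp N, ‖fderiv ℝ u x‖ ^ 2 := h
  rw [h1] at h3
  linarith

theorem contDiff_of_mem_testFun {N : ℕ} {Ω : Set (Sp N)} {u : Sp N → ℝ} (hu : u ∈ testFun N Ω)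
    {n : ℕ∞} : ContDiff ℝ n u :=
  hu.1.of_le (by exact_mod_cast le_top)

theorem zero_mem_testFun {N : ℕ} {Ω : Set (Sp N)} : (0 : Sp N → ℝ) ∈ testFun N Ω :=
  ⟨contDiff_const, HasCompactSupport.zero, by
    rw [tsupport_eq_empty_iff.2 rfl]; exact empty_subset _⟩

theorem smul_mem_testFun {N : ℕ} {Ω : Set (Sp N)} {u : Sp N → ℝ} (hu : u ∈ testFun N Ω) (a : ℝ) :
    a • u ∈ testFun N Ω :=
  ⟨hu.1.const_smul a, hu.2.1.smul_left (f := fun _ => a),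
    (closure_mono (Function.support_const_smul_subset a u)).trans hu.2.2⟩

theorem add_mem_testFun {N : ℕ} {Ω : Set (Sp N)} {u v : Sp N → ℝ} (hu : u ∈ testFun N Ω)
    (hv : v ∈ testFun N Ω) : u + v ∈ testFun N Ω :=
  ⟨hu.1.add hv.1, hu.2.1.add hv.2.1,
    (tsupport_add u v).trans (union_subset hu.2.2 hv.2.2)⟩

theorem integral_sq_pos {N : ℕ} {Ω : Set (Sp N)} {u : Sp N → ℝ} (hu : u ∈ testFun N Ω)
    (h0 : u ≠ 0) : 0 < ∫ x, u x ^ 2 := by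
  have hc : Continuous u := hu.1.continuous
  rw [integral_pos_iff_support_of_nonneg (fun x => sq_nonneg _) (integrable_sq hc hu.2.1)]
  have : (Function.support fun x => u x ^ 2) = Function.support u := by
    ext x; simp
  rw [this]
  exact hc.isOpen_support.measure_pos _ (Function.support_nonempty_iff.2 h0)

theorem rayleigh_nonneg {N : ℕ} (u : Sp N → ℝ) : 0 ≤ rayleigh N u :=
  div_nonneg (integral_nonneg fun _ => sq_nonneg _) (integral_nonneg fun _ => sq_nonneg _)

theorem dirichletEV_le {N k : ℕ} (hk : k ≠ 0) {Ω : Set (Sp N)} {t : ℝ}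
    (V : Submodule ℝ (Sp N → ℝ)) (hV : Module.finrank ℝ V = k)
    (hVs : (V : Set (Sp N → ℝ)) ⊆ testFun N Ω)
    (h : ∀ u ∈ V, u ≠ 0 → (∫ x, ‖fderiv ℝ u x‖ ^ 2) ≤ t * ∫ x, u x ^ 2) :
    dirichletEV N k Ω ≤ t := by
  refine csInf_le ⟨0, ?_⟩ ⟨V, hV, hVs.trans subset_union_left, fun u hu h0 => ?_⟩
  · rintro s ⟨W, hW, -, hs⟩
    have : W ≠ ⊥ := by
      rintro rfl
      simp at hW
      exact hk hW.symm
    obtain ⟨u, hu, h0⟩ := W.exists_mem_ne_zero_of_ne_bot this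
    exact (rayleigh_nonneg u).trans (hs u hu h0)
  · rw [rayleigh, div_le_iff₀ (integral_sq_pos (hVs hu) h0)]
    exact h u hu h0

theorem dirichletEV_one_le {N : ℕ} {Ω : Set (Sp N)} {t : ℝ} {u : Sp N → ℝ}
    (hu : u ∈ testFun N Ω) (h0 : u ≠ 0)
    (h : (∫ x, ‖fderiv ℝ u x‖ ^ 2) ≤ t * ∫ x, u x ^ 2) : dirichletEV N 1 Ω ≤ t := by
  refine dirichletEV_le one_ne_zero (Submodule.span ℝ {u}) (finrank_span_singleton h0) ?_ ?_
  · intro v hv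
    obtain ⟨a, rfl⟩ := Submodule.mem_span_singleton.1 hv
    exact smul_mem_testFun hu a
  · intro v hv _
    obtain ⟨a, rfl⟩ := Submodule.mem_span_singleton.1 hv
    have e : ∀ x, ‖fderiv ℝ (a • u) x‖ ^ 2 = a ^ 2 * ‖fderiv ℝ u x‖ ^ 2 := fun x => by
      rw [fderiv_const_smul (hu.1.differentiable (by simp) x), norm_smul, mul_pow,
        Real.norm_eq_abs, sq_abs]
    simp only [e, Pi.smul_apply, smul_eq_mul, mul_pow, integral_const_mul]
    nlinarith [sq_nonneg a]

theorem le_dirichletEV_one {N : ℕ} {Ω : Set (Sp N)} {t : ℝ} {u₀ : Sp N → ℝ}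
    (hu₀ : u₀ ∈ testFun N Ω) (h0 : u₀ ≠ 0)
    (h : ∀ u ∈ testFun N Ω, t * (∫ x, u x ^ 2) ≤ ∫ x, ‖fderiv ℝ u x‖ ^ 2) :
    t ≤ dirichletEV N 1 Ω := by
  refine le_csInf ⟨rayleigh N u₀, Submodule.span ℝ {u₀}, finrank_span_singleton h0, ?_, ?_⟩ ?_
  · intro v hv
    obtain ⟨a, rfl⟩ := Submodule.mem_span_singleton.1 hv
    exact Or.inl (smul_mem_testFun hu₀ a)
  · intro v hv hv0
    obtain ⟨a, rfl⟩ := Submodule.mem_span_singleton.1 hv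
    have e : ∀ x, ‖fderiv ℝ (a • u₀) x‖ ^ 2 = a ^ 2 * ‖fderiv ℝ u₀ x‖ ^ 2 := fun x => by
      rw [fderiv_const_smul (hu₀.1.differentiable (by simp) x), norm_smul, mul_pow,
        Real.norm_eq_abs, sq_abs]
    have ha : a ≠ 0 := by rintro rfl; simp at hv0
    simp only [rayleigh, e, Pi.smul_apply, smul_eq_mul, mul_pow, integral_const_mul]
    rw [mul_div_mul_left _ _ (pow_ne_zero 2 ha)]
  · rintro s ⟨V, hV, hVs, hs⟩
    have : V ≠ ⊥ := by
      rintro rfl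
      simp at hV
    obtain ⟨u, hu, hune⟩ := V.exists_mem_ne_zero_of_ne_bot this
    have hut : u ∈ testFun N Ω := (hVs hu).resolve_right hune
    refine le_trans ?_ (hs u hu hune)
    rw [rayleigh, le_div_iff₀ (integral_sq_pos hut hune)]
    exact h u hut

theorem dirichlet_forms_of_disjoint {N : ℕ} {Ω : Set (Sp N)} {u v : Sp N → ℝ}
    (hu : u ∈ testFun N Ω) (hv : v ∈ testFun N Ω) (hd : Disjoint (tsupport u) (tsupport v))
    (a b : ℝ) :
    (∫ x, ‖fderiv ℝ (a • u + b • v) x‖ ^ 2) =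
      a ^ 2 * (∫ x, ‖fderiv ℝ u x‖ ^ 2) + b ^ 2 * (∫ x, ‖fderiv ℝ v x‖ ^ 2) ∧
    (∫ x, ((a • u + b • v) x) ^ 2) = a ^ 2 * (∫ x, u x ^ 2) + b ^ 2 * (∫ x, v x ^ 2) := by
  have hu1 : ContDiff ℝ 1 u := contDiff_of_mem_testFun hu (n := 1)
  have hv1 : ContDiff ℝ 1 v := contDiff_of_mem_testFun hv (n := 1)
  have hz : ∀ x, x ∉ tsupport u ∨ x ∉ tsupport v := fun x => by
    by_contra! h
    exact (disjoint_left.1 hd h.1) h.2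
  have hf : ∀ (f : Sp N → ℝ) x, x ∉ tsupport f → fderiv ℝ f x = 0 := fun f x h => by
    by_contra hne
    exact h (support_fderiv_subset ℝ (Function.mem_support.2 hne))
  have e : ∀ x, fderiv ℝ (a • u + b • v) x = a • fderiv ℝ u x + b • fderiv ℝ v x := fun x => by
    rw [fderiv_add ((hu1.differentiable (by simp) x).const_smul a)
      ((hv1.differentiable (by simp) x).const_smul b),
      fderiv_const_smul (hu1.differentiable (by simp) x),
      fderiv_const_smul (hv1.differentiable (by simp) x)]
  constructor
  · rw [← integral_const_mul, ← integral_const_mul,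
      ← integral_add ((integrable_norm_fderiv_sq hu1 hu.2.1).const_mul _)
        ((integrable_norm_fderiv_sq hv1 hv.2.1).const_mul _)]
    congr 1; funext x
    rw [e]
    rcases hz x with h | h <;> simp [hf _ _ h, norm_smul, mul_pow]
  · rw [← integral_const_mul, ← integral_const_mul,
      ← integral_add ((integrable_sq hu1.continuous hu.2.1).const_mul _)
        ((integrable_sq hv1.continuous hv.2.1).const_mul _)]
    congr 1; funext x
    rcases hz x with h | h <;> simp [image_eq_zero_of_notMem_tsupport h, mul_pow]

theorem linearIndependent_of_disjoint {N : ℕ} {u v : Sp N → ℝ} (hu0 : u ≠ 0) (hv0 : v ≠ 0)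
    (hd : Disjoint (tsupport u) (tsupport v)) : LinearIndependent ℝ ![u, v] := by
  rw [LinearIndependent.pair_iff]
  intro a b h
  obtain ⟨x, hx⟩ := Function.support_nonempty_iff.2 hu0
  obtain ⟨y, hy⟩ := Function.support_nonempty_iff.2 hv0
  have hx' : x ∉ tsupport v := fun h' => disjoint_left.1 hd (subset_tsupport _ hx) h'
  have hy' : y ∉ tsupport u := fun h' => disjoint_left.1 hd h' (subset_tsupport _ hy)
  have h1 := congrFun h x
  have h2 := congrFun h y
  simp [image_eq_zero_of_notMem_tsupport hx'] at h1
  simp [image_eq_zero_of_notMem_tsupport hy'] at h2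
  exact ⟨h1.resolve_right hx, h2.resolve_right hy⟩

theorem mem_span_pair_testFun {N : ℕ} {Ω : Set (Sp N)} {u v w : Sp N → ℝ}
    (hu : u ∈ testFun N Ω) (hv : v ∈ testFun N Ω)
    (hw : w ∈ Submodule.span ℝ (range ![u, v])) :
    w ∈ testFun N Ω ∧ ∃ a b : ℝ, w = a • u + b • v := by
  rw [Matrix.range_cons, Matrix.range_cons, Matrix.range_empty, union_empty] at hw
  obtain ⟨a, b, rfl⟩ := Submodule.mem_span_pair.1 hw
  exact ⟨add_mem_testFun (smul_mem_testFun hu a) (smul_mem_testFun hv b), a, b, rfl⟩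

theorem dirichletEV_two_le {N : ℕ} {Ω : Set (Sp N)} {t : ℝ} {u v : Sp N → ℝ}
    (hu : u ∈ testFun N Ω) (hu0 : u ≠ 0) (hv : v ∈ testFun N Ω) (hv0 : v ≠ 0)
    (hd : Disjoint (tsupport u) (tsupport v))
    (h1 : (∫ x, ‖fderiv ℝ u x‖ ^ 2) ≤ t * ∫ x, u x ^ 2)
    (h2 : (∫ x, ‖fderiv ℝ v x‖ ^ 2) ≤ t * ∫ x, v x ^ 2) : dirichletEV N 2 Ω ≤ t := by
  refine dirichletEV_le two_ne_zero (Submodule.span ℝ (range ![u, v])) ?_ ?_ ?_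
  · rw [finrank_span_eq_card (linearIndependent_of_disjoint hu0 hv0 hd)]; simp
  · exact fun w hw => (mem_span_pair_testFun hu hv hw).1
  · intro w hw _
    obtain ⟨-, a, b, rfl⟩ := mem_span_pair_testFun hu hv hw
    obtain ⟨e1, e2⟩ := dirichlet_forms_of_disjoint hu hv hd a b
    rw [e1, e2]
    nlinarith [mul_le_mul_of_nonneg_left h1 (sq_nonneg a),
      mul_le_mul_of_nonneg_left h2 (sq_nonneg b)]

theorem le_dirichletEV_two {N : ℕ} {Ω : Set (Sp N)} {t : ℝ} {u₀ v₀ : Sp N → ℝ}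
    (hu₀ : u₀ ∈ testFun N Ω) (hu0 : u₀ ≠ 0) (hv₀ : v₀ ∈ testFun N Ω) (hv0 : v₀ ≠ 0)
    (hd : Disjoint (tsupport u₀) (tsupport v₀)) (ℓ : (Sp N → ℝ) → ℝ)
    (hadd : ∀ u ∈ testFun N Ω, ∀ v ∈ testFun N Ω, ℓ (u + v) = ℓ u + ℓ v)
    (hsmul : ∀ (a : ℝ), ∀ u ∈ testFun N Ω, ℓ (a • u) = a * ℓ u)
    (h : ∀ u ∈ testFun N Ω, ℓ u = 0 → t * (∫ x, u x ^ 2) ≤ ∫ x, ‖fderiv ℝ u x‖ ^ 2) :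
    t ≤ dirichletEV N 2 Ω := by
  refine le_csInf ⟨max (rayleigh N u₀) (rayleigh N v₀), Submodule.span ℝ (range ![u₀, v₀]),
    ?_, fun w hw => Or.inl (mem_span_pair_testFun hu₀ hv₀ hw).1, ?_⟩ ?_
  · rw [finrank_span_eq_card (linearIndependent_of_disjoint hu0 hv0 hd)]; simp
  · intro w hw hw0
    obtain ⟨hwt, a, b, rfl⟩ := mem_span_pair_testFun hu₀ hv₀ hw
    obtain ⟨e1, e2⟩ := dirichlet_forms_of_disjoint hu₀ hv₀ hd a b
    have p1 := integral_sq_pos hu₀ hu0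
    have p2 := integral_sq_pos hv₀ hv0
    have h1 : (∫ x, ‖fderiv ℝ u₀ x‖ ^ 2) ≤
        max (rayleigh N u₀) (rayleigh N v₀) * ∫ x, u₀ x ^ 2 := by
      rw [← div_le_iff₀ p1]; exact le_max_left _ _
    have h2 : (∫ x, ‖fderiv ℝ v₀ x‖ ^ 2) ≤
        max (rayleigh N u₀) (rayleigh N v₀) * ∫ x, v₀ x ^ 2 := by
      rw [← div_le_iff₀ p2]; exact le_max_right _ _
    rw [rayleigh, div_le_iff₀ (integral_sq_pos hwt hw0), e1, e2]
    nlinarith [mul_le_mul_of_nonneg_left h1 (sq_nonneg a),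
      mul_le_mul_of_nonneg_left h2 (sq_nonneg b)]
  · rintro s ⟨V, hV, hVs, hs⟩
    have hVt : ∀ u ∈ V, u ∈ testFun N Ω := fun u hu => by
      rcases hVs hu with h | h
      · exact h
      · rw [mem_singleton_iff.1 h]; exact zero_mem_testFun
    let L : V →ₗ[ℝ] ℝ :=
      { toFun := fun u => ℓ u
        map_add' := fun u v => hadd u (hVt u u.2) v (hVt v v.2)
        map_smul' := fun a u => hsmul a u (hVt u u.2) }
    have : Module.Finite ℝ V := Module.finite_of_finrank_pos (by rw [hV]; norm_num)
    obtain ⟨⟨u, hu⟩, huk, hune⟩ := (LinearMap.ker L).exists_mem_ne_zero_of_ne_bot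
      (LinearMap.ker_ne_bot_of_finrank_lt (f := L) (by rw [hV]; simp))
    have hune' : u ≠ 0 := fun h => hune (Subtype.ext h)
    refine le_trans ?_ (hs u hu hune')
    rw [rayleigh, le_div_iff₀ (integral_sq_pos (hVt u hu) hune')]
    exact h u (hVt u hu) huk

theorem rayleigh_comp_smul {N : ℕ} (u : Sp N → ℝ) {s : ℝ} (hs : 0 < s) :
    rayleigh N (fun x => u (s • x)) = s ^ 2 * rayleigh N u := by
  have e : ∀ x, ‖fderiv ℝ (fun x => u (s • x)) x‖ ^ 2 = s ^ 2 * ‖fderiv ℝ u (s • x)‖ ^ 2 :=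
    fun x => by
      rw [fderiv_comp_smul, norm_smul, mul_pow, Real.norm_eq_abs, sq_abs]
  simp only [rayleigh, e, integral_const_mul]
  rw [Measure.integral_comp_smul volume (fun y => ‖fderiv ℝ u y‖ ^ 2),
    Measure.integral_comp_smul volume (fun y => u y ^ 2)]
  simp only [smul_eq_mul]
  have : |(s ^ Module.finrank ℝ (Sp N))⁻¹| ≠ 0 := by positivity
  rw [mul_left_comm, mul_div_mul_left _ _ this, mul_div_assoc]

theorem dirichletEV_smul_le {N k : ℕ} (Ω : Set (Sp N)) {s : ℝ} (hs : 0 < s) :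
    {t : ℝ | ∃ V : Submodule ℝ (Sp N → ℝ), Module.finrank ℝ V = k ∧
      (V : Set _) ⊆ testFun N (s • Ω) ∪ {0} ∧ ∀ u ∈ V, u ≠ 0 → rayleigh N u ≤ t} ⊆
    (s⁻¹ ^ 2) • {t : ℝ | ∃ V : Submodule ℝ (Sp N → ℝ), Module.finrank ℝ V = k ∧
      (V : Set _) ⊆ testFun N Ω ∪ {0} ∧ ∀ u ∈ V, u ≠ 0 → rayleigh N u ≤ t} := by
  rintro t ⟨V, hV, hVs, hVt⟩
  refine ⟨s ^ 2 * t, ?_, by simp only [smul_eq_mul]; field_simp⟩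
  let e : (Sp N → ℝ) ≃ₗ[ℝ] (Sp N → ℝ) :=
    LinearEquiv.funCongrLeft ℝ ℝ (Homeomorph.smulOfNeZero s hs.ne').toEquiv
  have he : ∀ u, e u = fun x => u (s • x) := fun u => rfl
  refine ⟨V.map e.toLinearMap, ?_, ?_, ?_⟩
  · rw [LinearEquiv.finrank_map_eq]; exact hV
  · rintro _ ⟨u, hu, rfl⟩
    rcases hVs hu with ⟨h1, h2, h3⟩ | h
    · left
      have h4 : tsupport (fun x => u (s • x)) ⊆ (fun x => s • x) ⁻¹' tsupport u :=
        closure_minimal (fun x hx => subset_tsupport _ hx)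
          ((isClosed_tsupport u).preimage (by fun_prop))
      refine ⟨h1.comp (g := u) (f := fun x => s • x) (contDiff_const_smul s),
        h2.comp_homeomorph (Homeomorph.smulOfNeZero s hs.ne'),
        fun x hx => ?_⟩
      obtain ⟨y, hy, hyx⟩ := h3 (h4 hx)
      have : y = x := smul_right_injective _ hs.ne' hyx
      exact this ▸ hy
    · right
      rw [mem_singleton_iff.1 h]; simp
  · rintro _ ⟨u, hu, rfl⟩ hne
    have hu0 : u ≠ 0 := by rintro rfl; simp at hne
    change rayleigh N (fun x => u (s • x)) ≤ _
    rw [rayleigh_comp_smul u hs]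
    exact mul_le_mul_of_nonneg_left (hVt u hu hu0) (sq_nonneg s)

theorem dirichletEV_smul {N k : ℕ} (Ω : Set (Sp N)) {s : ℝ} (hs : 0 < s) :
    dirichletEV N k (s • Ω) = s⁻¹ ^ 2 * dirichletEV N k Ω := by
  have h1 := dirichletEV_smul_le (k := k) Ω hs
  have h2 := dirichletEV_smul_le (k := k) (s • Ω) (inv_pos.2 hs)
  rw [smul_smul, inv_mul_cancel₀ hs.ne', one_smul, inv_inv] at h2
  have h3 := smul_set_mono (a := s⁻¹ ^ 2) h2
  rw [smul_smul, ← mul_pow, inv_mul_cancel₀ hs.ne', one_pow, one_smul] at h3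
  rw [dirichletEV, subset_antisymm h1 h3, Real.sInf_smul_of_nonneg (by positivity)]
  rfl

theorem hasDerivAt_powerSeries {a : ℕ → ℝ} (ha : ∀ k, |a k| ≤ 1 / (k.factorial : ℝ)) (s : ℝ) :
    HasDerivAt (fun s => ∑' k, a k * s ^ k) (∑' k, ((k + 1 : ℕ) : ℝ) * a (k + 1) * s ^ k) s := by
  set R := |s| + 1
  have hR : 0 < R := by positivity
  set v : ℕ → ℝ := fun k => (k : ℝ) * R ^ (k - 1) / (k.factorial : ℝ)
  have hv : Summable v := by
    rw [← summable_nat_add_iff 1]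
    refine (Real.summable_pow_div_factorial R).congr fun k => ?_
    simp only [v, Nat.factorial_succ, Nat.add_sub_cancel, Nat.cast_mul]
    have : (k.factorial : ℝ) ≠ 0 := by positivity
    have : ((k + 1 : ℕ) : ℝ) ≠ 0 := by positivity
    field_simp
  have hmem : s ∈ ball (0:ℝ) R := by simp [R]
  have h := hasDerivAt_tsum_of_isPreconnected (t := ball (0:ℝ) R) (u := v)
    (g := fun k s => a k * s ^ k) (g' := fun k s => a k * (k * s ^ (k - 1))) (y₀ := 0) (y := s)
    hv isOpen_ball (convex_ball _ _).isPreconnected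
    (fun k y _ => (hasDerivAt_pow k y).const_mul (a k))
    (fun k y hy => by
      have hy' : |y| ≤ R := by simpa using (mem_ball_zero_iff.1 hy).le
      rw [norm_mul, norm_mul, norm_pow, Real.norm_eq_abs, Real.norm_natCast, Real.norm_eq_abs]
      calc |a k| * (k * |y| ^ (k - 1)) ≤ 1 / (k.factorial : ℝ) * (k * R ^ (k - 1)) := by
            gcongr; exact ha k
        _ = v k := by simp only [v]; ring)
    (by simp [hR])
    (summable_of_ne_finset_zero (s := {0}) fun k hk => by
      simp at hk; simp [hk])
    hmem
  have hs : Summable fun k => a k * (k * s ^ (k - 1)) := by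
    refine Summable.of_norm_bounded hv fun k => ?_
    have hy' : |s| ≤ R := by simp [R]
    rw [norm_mul, norm_mul, norm_pow, Real.norm_eq_abs, Real.norm_natCast, Real.norm_eq_abs]
    calc |a k| * (k * |s| ^ (k - 1)) ≤ 1 / (k.factorial : ℝ) * (k * R ^ (k - 1)) := by
          gcongr; exact ha k
      _ = v k := by simp only [v]; ring
  have e : ∑' k, a k * (k * s ^ (k - 1)) = ∑' k, ((k + 1 : ℕ) : ℝ) * a (k + 1) * s ^ k := by
    rw [hs.tsum_eq_zero_add]
    simp only [Nat.cast_zero, zero_mul, mul_zero, zero_add, Nat.add_sub_cancel]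
    refine tsum_congr fun k => by ring
  rw [← e]
  exact h

theorem abs_shift_le {a : ℕ → ℝ} (ha : ∀ k, |a k| ≤ 1 / (k.factorial : ℝ)) (k : ℕ) :
    |((k + 1 : ℕ) : ℝ) * a (k + 1)| ≤ 1 / (k.factorial : ℝ) := by
  rw [abs_mul, Nat.abs_cast]
  refine (mul_le_mul_of_nonneg_left (ha (k + 1)) (by positivity)).trans_eq ?_
  rw [Nat.factorial_succ, Nat.cast_mul]
  have : (k.factorial : ℝ) ≠ 0 := by positivity
  have : ((k + 1 : ℕ) : ℝ) ≠ 0 := by positivity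
  field_simp

theorem contDiff_powerSeries (n : ℕ) : ∀ {a : ℕ → ℝ}, (∀ k, |a k| ≤ 1 / (k.factorial : ℝ)) →
    ContDiff ℝ n (fun s => ∑' k, a k * s ^ k) := by
  induction n with
  | zero =>
    intro a ha
    exact contDiff_zero.2 (continuous_iff_continuousAt.2
      fun s => (hasDerivAt_powerSeries ha s).continuousAt)
  | succ n ih =>
    intro a ha
    have := contDiff_succ_iff_deriv (𝕜 := ℝ) (n := n) (f := fun s => ∑' k, a k * s ^ k)
    push_cast
    rw [this]
    refine ⟨fun s => (hasDerivAt_powerSeries ha s).differentiableAt, by simp, ?_⟩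
    have e : deriv (fun s => ∑' k, a k * s ^ k) =
        fun s => ∑' k, ((k + 1 : ℕ) : ℝ) * a (k + 1) * s ^ k :=
      funext fun s => (hasDerivAt_powerSeries ha s).deriv
    rw [e]
    exact ih (a := fun k => ((k + 1 : ℕ) : ℝ) * a (k + 1)) (abs_shift_le ha)

theorem summable_powerSeries {a : ℕ → ℝ} (ha : ∀ k, |a k| ≤ 1 / (k.factorial : ℝ)) (s : ℝ) :
    Summable fun k => a k * s ^ k := by
  refine Summable.of_norm_bounded (Real.summable_pow_div_factorial |s|) fun k => ?_
  rw [norm_mul, norm_pow, Real.norm_eq_abs, Real.norm_eq_abs]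
  calc |a k| * |s| ^ k ≤ 1 / (k.factorial : ℝ) * |s| ^ k := by gcongr; exact ha k
    _ = _ := by ring

/-- Coefficients of the radial solution of `-Δφ = φ`, as a power series in `|x|²`. -/
def radialCoeff (N : ℕ) (k : ℕ) : ℝ := ∏ j ∈ Finset.range k, -(1 / ((j + 1) * (4 * j + 2 * N) : ℝ))

theorem abs_radialCoeff_le {N : ℕ} (hN : 1 ≤ N) (k : ℕ) :
    |radialCoeff N k| ≤ 1 / (k.factorial : ℝ) := by
  induction k with
  | zero => simp [radialCoeff]
  | succ k ih =>
    rw [radialCoeff, Finset.prod_range_succ, ← radialCoeff, abs_mul, abs_neg, Nat.factorial_succ]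
    have hN' : (1:ℝ) ≤ N := by exact_mod_cast hN
    have hk : (0:ℝ) ≤ k := Nat.cast_nonneg k
    have h1 : |1 / (((k:ℝ) + 1) * (4 * k + 2 * N))| ≤ 1 / ((k:ℝ) + 1) := by
      rw [abs_of_nonneg (by positivity)]
      gcongr
      nlinarith
    calc _ ≤ 1 / (k.factorial : ℝ) * (1 / ((k:ℝ) + 1)) := by gcongr
      _ = _ := by push_cast; rw [one_div_mul_one_div, mul_comm]

theorem radialCoeff_succ {N : ℕ} (hN : 1 ≤ N) (k : ℕ) :
    ((k:ℝ) + 1) * (4 * k + 2 * N) * radialCoeff N (k + 1) = - radialCoeff N k := by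
  rw [radialCoeff, Finset.prod_range_succ, ← radialCoeff]
  have : (0:ℝ) < N := by exact_mod_cast hN
  have : ((k:ℝ) + 1) * (4 * k + 2 * N) ≠ 0 := by positivity
  field_simp

/-- The radial solution of `-Δφ = φ`, as a function of `|x|²`. -/
def radialFun (N : ℕ) (s : ℝ) : ℝ := ∑' k, radialCoeff N k * s ^ k

theorem contDiff_radialFun {N : ℕ} (hN : 1 ≤ N) {n : ℕ∞} : ContDiff ℝ n (radialFun N) := by
  have : ContDiff ℝ (⊤ : ℕ∞) (radialFun N) :=
    contDiff_infty.2 fun n => contDiff_powerSeries n (abs_radialCoeff_le hN)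
  exact this.of_le (by exact_mod_cast le_top)

theorem radialFun_zero (N : ℕ) : radialFun N 0 = 1 := by
  rw [radialFun, tsum_eq_single 0 (fun k hk => by simp [hk])]
  simp [radialCoeff]

theorem radialFun_ode {N : ℕ} (hN : 1 ≤ N) (s : ℝ) :
    4 * s * deriv (deriv (radialFun N)) s + 2 * N * deriv (radialFun N) s = - radialFun N s := by
  have h0 := abs_radialCoeff_le hN
  have h1 := abs_shift_le h0
  have h2 := abs_shift_le h1
  have e1 : deriv (radialFun N) =
      fun s => ∑' k, ((k + 1 : ℕ) : ℝ) * radialCoeff N (k + 1) * s ^ k :=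
    funext fun s => (hasDerivAt_powerSeries h0 s).deriv
  have e2 := (hasDerivAt_powerSeries h1 s).deriv
  rw [e1, e2, radialFun, ← tsum_mul_left, ← tsum_mul_left, ← tsum_neg]
  have hs2 : Summable fun k : ℕ => 4 * s * (((k + 1 : ℕ) : ℝ) *
      (((k + 1 + 1 : ℕ) : ℝ) * radialCoeff N (k + 1 + 1)) * s ^ k) :=
    (summable_powerSeries h2 s).mul_left _
  have e3 : ∑' k : ℕ, 4 * s * (((k + 1 : ℕ) : ℝ) *
      (((k + 1 + 1 : ℕ) : ℝ) * radialCoeff N (k + 1 + 1)) * s ^ k) =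
      ∑' k : ℕ, 4 * (k : ℝ) * ((k + 1 : ℕ) : ℝ) * radialCoeff N (k + 1) * s ^ k := by
    have hs3 : Summable fun k : ℕ =>
        4 * (k : ℝ) * ((k + 1 : ℕ) : ℝ) * radialCoeff N (k + 1) * s ^ k := by
      rw [← summable_nat_add_iff 1]
      refine hs2.congr fun k => ?_
      push_cast; ring
    rw [hs3.tsum_eq_zero_add]
    simp only [Nat.cast_zero, mul_zero, zero_mul, zero_add]
    refine tsum_congr fun k => ?_
    push_cast; ring
  have hs3 : Summable fun k : ℕ =>
      4 * (k : ℝ) * ((k + 1 : ℕ) : ℝ) * radialCoeff N (k + 1) * s ^ k := by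
    rw [← summable_nat_add_iff 1]
    refine hs2.congr fun k => ?_
    push_cast; ring
  rw [e3, ← hs3.tsum_add ((summable_powerSeries h1 s).mul_left _)]
  refine tsum_congr fun k => ?_
  have := radialCoeff_succ hN k
  rw [← neg_mul, ← this]
  push_cast; ring

theorem hasFDerivAt_dist_sq {N : ℕ} (c x : Sp N) :
    HasFDerivAt (fun y : Sp N => ‖y - c‖ ^ 2) (2 • innerSL ℝ (x - c)) x := by
  have h := ((hasFDerivAt_id (𝕜 := ℝ) x).sub_const c).norm_sq
  simpa using h

theorem pd_radial {N : ℕ} {g : ℝ → ℝ} {k : ℝ} {c x : Sp N}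
    (hg : DifferentiableAt ℝ g (k * ‖x - c‖ ^ 2)) (i : Fin N) :
    pd i (fun y : Sp N => g (k * ‖y - c‖ ^ 2)) x =
      2 * k * (x i - c i) * deriv g (k * ‖x - c‖ ^ 2) := by
  have h1 := (hasFDerivAt_dist_sq c x).const_mul k
  rw [pd_comp (u := fun y : Sp N => k * ‖y - c‖ ^ 2) hg h1.differentiableAt]
  rw [pd, h1.fderiv]
  simp [EuclideanSpace.inner_single_right]
  ring

theorem contDiff_dist_sq {N : ℕ} (k : ℝ) (c : Sp N) {n : WithTop ℕ∞} :
    ContDiff ℝ n (fun y : Sp N => k * ‖y - c‖ ^ 2) :=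
  contDiff_const.mul ((contDiff_id.sub contDiff_const).norm_sq ℝ)

theorem laplacian_radial {N : ℕ} {g : ℝ → ℝ} {k : ℝ} {c x : Sp N}
    (hg : ContDiffAt ℝ 2 g (k * ‖x - c‖ ^ 2)) :
    ∑ i, pd i (pd i (fun y : Sp N => g (k * ‖y - c‖ ^ 2))) x =
      k * (4 * (k * ‖x - c‖ ^ 2) * deriv (deriv g) (k * ‖x - c‖ ^ 2) +
        2 * N * deriv g (k * ‖x - c‖ ^ 2)) := by
  set s := k * ‖x - c‖ ^ 2 with hs
  have hd : DifferentiableAt ℝ (deriv g) s := by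
    have := (hg.fderiv_right (m := 1) (by norm_num)).differentiableAt (by norm_num)
    have h2 : deriv g = fun y => fderiv ℝ g y 1 := by funext y; simp
    rw [h2]
    exact this.clm_apply (differentiableAt_const _)
  have hq : DifferentiableAt ℝ (fun y : Sp N => k * ‖y - c‖ ^ 2) x :=
    (contDiff_dist_sq (n := 1) k c).differentiable (by norm_num) x
  have hev : ∀ᶠ y in nhds x, ContDiffAt ℝ 1 g (k * ‖y - c‖ ^ 2) := by
    have h1 : ∀ᶠ t in nhds s, ContDiffAt ℝ 1 g t :=
      (hg.of_le (by norm_num)).eventually (by simp)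
    exact hq.continuousAt.eventually h1
  have e : ∀ i, pd i (pd i (fun y : Sp N => g (k * ‖y - c‖ ^ 2))) x =
      4 * k ^ 2 * (x i - c i) ^ 2 * deriv (deriv g) s + 2 * k * deriv g s := by
    intro i
    have h1 : pd i (fun y : Sp N => g (k * ‖y - c‖ ^ 2)) =ᶠ[nhds x]
        fun y => (2 * k * (y i - c i)) * deriv g (k * ‖y - c‖ ^ 2) := by
      filter_upwards [hev] with y hy
      exact pd_radial (hy.differentiableAt (by norm_num)) i
    have h2 : pd i (fun y : Sp N => 2 * k * (y i - c i)) x = 2 * k := by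
      have h0 : HasFDerivAt (fun y : Sp N => 2 * k * (y i - c i))
          ((2 * k) • (EuclideanSpace.proj i : Sp N →L[ℝ] ℝ)) x :=
        ((EuclideanSpace.proj i : Sp N →L[ℝ] ℝ).hasFDerivAt.sub_const _).const_mul _
      rw [pd, h0.fderiv]
      simp
    have h3 : pd i (pd i (fun y : Sp N => g (k * ‖y - c‖ ^ 2))) x =
        pd i (fun y => (2 * k * (y i - c i)) * deriv g (k * ‖y - c‖ ^ 2)) x := by
      rw [pd, h1.fderiv_eq]; rfl
    have hd' : DifferentiableAt ℝ (fun y : Sp N => deriv g (k * ‖y - c‖ ^ 2)) x :=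
      DifferentiableAt.comp (g := deriv g) x hd hq
    have hl : DifferentiableAt ℝ (fun y : Sp N => 2 * k * (y i - c i)) x := by fun_prop
    rw [h3, pd_mul hl hd' i, h2,
      pd_radial hd]
    rw [← hs]; ring
  simp only [e]
  rw [Finset.sum_add_distrib, ← Finset.sum_mul, ← Finset.mul_sum]
  have : ∑ i, (x i - c i) ^ 2 = ‖x - c‖ ^ 2 := by
    rw [EuclideanSpace.real_norm_sq_eq]; rfl
  rw [this]
  simp only [Finset.sum_const, Finset.card_univ, Fintype.card_fin, nsmul_eq_mul]
  rw [hs]; ring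

theorem laplacian_radialFun {N : ℕ} (hN : 1 ≤ N) (k : ℝ) (c x : Sp N) :
    ∑ i, pd i (pd i (fun y : Sp N => radialFun N (k * ‖y - c‖ ^ 2))) x =
      -(k * radialFun N (k * ‖x - c‖ ^ 2)) := by
  rw [laplacian_radial (contDiff_radialFun hN (n := 2)).contDiffAt, radialFun_ode hN]
  ring

theorem exists_radialFun_nonpos (N : ℕ) [NeZero N] : ∃ s, 0 ≤ s ∧ radialFun N s ≤ 0 := by
  by_contra! hcon
  have hN : 1 ≤ N := NeZero.one_le
  set c : Sp N := EuclideanSpace.single 0 2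
  let f : ContDiffBump c := ⟨1 / 2, 1, by norm_num, by norm_num⟩
  have hsupp : ∀ x ∈ tsupport f, 0 < x 0 := by
    intro x hx
    rw [f.tsupport_eq, mem_closedBall, dist_eq_norm] at hx
    have h1 : ‖(x - c) 0‖ ≤ 1 := (PiLp.norm_apply_le (x - c) 0).trans hx
    have h2 : (x - c) 0 = x 0 - 2 := by simp [c]
    rw [h2, Real.norm_eq_abs, abs_le] at h1
    linarith [h1.1]
  have hray : ∀ s : ℝ, 0 < s → 1 ≤ rayleigh N (fun x => f (s • x)) := by
    intro s hs
    have hu : ContDiff ℝ 1 (fun x => f (s • x)) :=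
      f.contDiff.comp (contDiff_const_smul s)
    have hc : HasCompactSupport (fun x => f (s • x)) :=
      f.hasCompactSupport.comp_homeomorph (Homeomorph.smulOfNeZero s hs.ne')
    have hts : ∀ x ∈ tsupport (fun x => f (s • x)), 0 < x 0 := by
      intro x hx
      have h4 : tsupport (fun x => f (s • x)) ⊆ (fun x => s • x) ⁻¹' tsupport f :=
        closure_minimal (fun x hx => subset_tsupport _ hx)
          ((isClosed_tsupport f).preimage (by fun_prop))
      have := hsupp _ (h4 hx)
      simpa [hs] using this
    have hw : ContDiff ℝ 2 (fun y : Sp N => radialFun N (1 * ‖y - 0‖ ^ 2)) :=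
      (contDiff_radialFun hN (n := 2)).comp (contDiff_dist_sq 1 0)
    have h := barta_halfSp (w := fun y : Sp N => radialFun N (1 * ‖y - 0‖ ^ 2)) (Λ := 1) hu hc
      (fun x _ _ => hw.contDiffAt) (fun x _ _ => hcon _ (by positivity))
      (fun x _ _ => (laplacian_radialFun hN 1 0 x).le)
      (fun x hx h0 => absurd h0 (hts x hx).ne')
    have hq : 0 ≤ ∫ x in halfSp N, ∑ i, (pd i (fun x => f (s • x)) x - f (s • x) *
        (pd i (fun y : Sp N => radialFun N (1 * ‖y - 0‖ ^ 2)) x /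
          radialFun N (1 * ‖x - 0‖ ^ 2))) ^ 2 :=
      integral_nonneg fun x => Finset.sum_nonneg fun i _ => sq_nonneg _
    have h1 : ∫ x in halfSp N, (f (s • x)) ^ 2 = ∫ x, (f (s • x)) ^ 2 :=
      setIntegral_eq_integral_of_forall_compl_eq_zero fun x hx => by
        rw [image_eq_zero_of_notMem_tsupport (f := fun x => f (s • x)) fun h => hx (hts x h)]
        simp
    have h2 : ∫ x in halfSp N, ‖fderiv ℝ (fun x => f (s • x)) x‖ ^ 2 =
        ∫ x, ‖fderiv ℝ (fun x => f (s • x)) x‖ ^ 2 :=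
      setIntegral_eq_integral_of_forall_compl_eq_zero fun x hx => by
        rw [norm_sq_fderiv]
        exact Finset.sum_eq_zero fun i _ => by
          rw [pd_eq_zero_of_notMem fun h => hx (hts x h)]; simp
    have hmem : (fun x => f (s • x)) ∈ testFun N univ :=
      ⟨f.contDiff.comp (contDiff_const_smul s), hc, subset_univ _⟩
    have hne : (fun x => f (s • x)) ≠ 0 := by
      intro h
      have := congrFun h (s⁻¹ • c)
      simp only [smul_smul, mul_inv_cancel₀ hs.ne', one_smul, Pi.zero_apply] at this
      rw [f.one_of_mem_closedBall (mem_closedBall_self f.rIn_pos.le)] at this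
      norm_num at this
    rw [rayleigh, le_div_iff₀ (integral_sq_pos hmem hne), ← h1, ← h2]
    linarith [h.2]
  set r := rayleigh N f
  have hr0 : 0 ≤ r := rayleigh_nonneg _
  have h := hray (1 / (1 + r)) (by positivity)
  rw [rayleigh_comp_smul (f : Sp N → ℝ) (by positivity : (0:ℝ) < 1 / (1 + r))] at h
  have h' : (1 / (1 + r)) ^ 2 * r < 1 := by
    rw [div_pow, one_pow, one_div_mul_eq_div, div_lt_one (by positivity)]
    nlinarith
  linarith

/-- The basic properties of the radial solution up to its first zero `s₀`. -/
theorem exists_first_zero (N : ℕ) [NeZero N] : ∃ s₀ > 0, radialFun N s₀ = 0 ∧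
    (∀ s, 0 ≤ s → s < s₀ → 0 < radialFun N s) ∧
    (∀ s, 0 ≤ s → s ≤ s₀ → deriv (radialFun N) s < 0) := by
  have hN : 1 ≤ N := NeZero.one_le
  have hNp : (0:ℝ) < N := by exact_mod_cast hN
  have hcont : Continuous (radialFun N) := (contDiff_radialFun hN (n := 0)).continuous
  obtain ⟨z, hz0, hz⟩ := exists_radialFun_nonpos N
  set Z := {s : ℝ | 0 ≤ s ∧ radialFun N s = 0}
  have hZc : IsClosed Z := (isClosed_le continuous_const continuous_id).inter
    (isClosed_eq hcont continuous_const)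
  have hZne : Z.Nonempty := by
    obtain ⟨y, hy, hy'⟩ := intermediate_value_Icc' hz0 hcont.continuousOn
      (show (0:ℝ) ∈ Icc (radialFun N z) (radialFun N 0) from ⟨hz, by rw [radialFun_zero]; norm_num⟩)
    exact ⟨y, hy.1, hy'⟩
  have hZb : BddBelow Z := ⟨0, fun s hs => hs.1⟩
  have hs0 := hZc.csInf_mem hZne hZb
  set s₀ := sInf Z
  have hs0pos : 0 < s₀ := lt_of_le_of_ne hs0.1 fun h => by
    have := hs0.2
    rw [← h, radialFun_zero] at this
    norm_num at this
  have hpos : ∀ s, 0 ≤ s → s < s₀ → 0 < radialFun N s := by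
    intro s h0 h1
    by_contra! hle
    obtain ⟨y, hy, hy'⟩ := intermediate_value_Icc' h0 hcont.continuousOn
      (show (0:ℝ) ∈ Icc (radialFun N s) (radialFun N 0) from
        ⟨hle, by rw [radialFun_zero]; norm_num⟩)
    have : s₀ ≤ y := csInf_le hZb ⟨hy.1, hy'⟩
    linarith [hy.2]
  refine ⟨s₀, hs0pos, hs0.2, hpos, fun s h0 h1 => ?_⟩
  rcases h0.eq_or_lt with rfl | hspos
  · have := radialFun_ode hN 0
    rw [radialFun_zero] at this
    by_contra! hge
    have : 0 ≤ 2 * (N:ℝ) * deriv (radialFun N) 0 := by positivity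
    linarith
  · set H : ℝ → ℝ := fun r => r ^ N * deriv (radialFun N) (r ^ 2)
    have hder : ∀ r, HasDerivAt H (-(1 / 2) * r ^ (N - 1) * radialFun N (r ^ 2)) r := by
      intro r
      have hd : DifferentiableAt ℝ (deriv (radialFun N)) (r ^ 2) := by
        have h2 : ContDiff ℝ (1 + 1) (radialFun N) := by
          exact_mod_cast contDiff_radialFun hN (n := 2)
        exact ((contDiff_succ_iff_deriv.1 h2).2.2).differentiable (by norm_num) _
      have h1 := (hasDerivAt_pow N r).mul
        (HasDerivAt.comp (h := fun r => r ^ 2) r hd.hasDerivAt (hasDerivAt_pow 2 r))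
      refine HasDerivAt.congr_deriv (f := H) h1 ?_
      have e := radialFun_ode hN (r ^ 2)
      have hp : r ^ N = r ^ (N - 1) * r := by rw [← pow_succ]; congr 1; omega
      simp only [Function.comp]
      rw [hp]
      have : radialFun N (r ^ 2) = -(4 * r ^ 2 * deriv (deriv (radialFun N)) (r ^ 2) +
        2 * N * deriv (radialFun N) (r ^ 2)) := by linarith
      rw [this]; push_cast; ring
    have hanti : StrictAntiOn H (Icc 0 (Real.sqrt s)) := by
      refine strictAntiOn_of_deriv_neg (convex_Icc _ _)
        (fun r _ => (hder r).continuousAt.continuousWithinAt) fun r hr => ?_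
      rw [interior_Icc] at hr
      rw [(hder r).deriv]
      have h2 : r ^ 2 < s := by
        have := Real.sq_sqrt h0
        nlinarith [hr.1, hr.2]
      have h3 := hpos (r ^ 2) (sq_nonneg _) (h2.trans_le h1)
      have h4 : 0 < r ^ (N - 1) := pow_pos hr.1 _
      nlinarith [mul_pos h4 h3]
    have hsq : 0 < Real.sqrt s := Real.sqrt_pos.2 hspos
    have := hanti (left_mem_Icc.2 hsq.le) (right_mem_Icc.2 hsq.le) hsq
    simp only [H, Real.sq_sqrt h0] at this
    rw [zero_pow (by omega), zero_mul] at this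
    by_contra! hge
    have : 0 ≤ Real.sqrt s ^ N * deriv (radialFun N) s := by positivity
    linarith

theorem integral_sub_add {α : Type*} {m : MeasurableSpace α} {μ : Measure α} {f g k : α → ℝ}
    (hf : Integrable f μ) (hg : Integrable g μ) (hk : Integrable k μ) :
    ∫ x, (f x - g x + k x) ∂μ = ∫ x, f x ∂μ - ∫ x, g x ∂μ + ∫ x, k x ∂μ :=
  (integral_add (f := fun x => f x - g x) (hf.sub hg) hk).trans (by rw [integral_sub hf hg])

theorem sq_sub_le_integral {f f' : ℝ → ℝ} (hf : ∀ s ∈ Icc (1 / 2 : ℝ) 1, HasDerivAt f (f' s) s)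
    (hc : ContinuousOn f' (Icc (1 / 2 : ℝ) 1)) :
    (f 1 - f (1 / 2)) ^ 2 ≤ 1 / 2 * ∫ s in (1 / 2 : ℝ)..1, f' s ^ 2 := by
  have hu : uIcc (1 / 2 : ℝ) 1 = Icc (1 / 2) 1 := uIcc_of_le (by norm_num)
  have hi : IntervalIntegrable f' volume (1 / 2) 1 :=
    ContinuousOn.intervalIntegrable (by rwa [hu])
  have hi2 : IntervalIntegrable (fun s => f' s ^ 2) volume (1 / 2) 1 :=
    ContinuousOn.intervalIntegrable (by rw [hu]; exact hc.pow 2)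
  have h1 : ∫ s in (1 / 2 : ℝ)..1, f' s = f 1 - f (1 / 2) :=
    intervalIntegral.integral_eq_sub_of_hasDerivAt (by rwa [hu]) hi
  set c := 2 * (f 1 - f (1 / 2)) with hcdef
  have h2 : 0 ≤ ∫ s in (1 / 2 : ℝ)..1, (f' s - c) ^ 2 :=
    intervalIntegral.integral_nonneg (by norm_num) fun s _ => sq_nonneg _
  have h3 : ∫ s in (1 / 2 : ℝ)..1, (f' s - c) ^ 2 =
      (∫ s in (1 / 2 : ℝ)..1, f' s ^ 2) - 2 * c * (f 1 - f (1 / 2)) + c ^ 2 / 2 := by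
    have e : ∀ s, (f' s - c) ^ 2 = f' s ^ 2 - 2 * c * f' s + c ^ 2 := fun s => by ring
    simp only [e]
    rw [intervalIntegral.integral_add (hi2.sub (hi.const_mul _)) (by simp),
      intervalIntegral.integral_sub hi2 (hi.const_mul _),
      intervalIntegral.integral_const_mul, h1]
    simp; ring
  rw [h3, hcdef] at h2
  nlinarith

theorem lintegral_comp_affine {N : ℕ} {G : Sp N → ENNReal} (hG : Measurable G) (a : Sp N) {s : ℝ}
    (hs : 1 / 2 ≤ s) : ∫⁻ y, G (a + s • y) ≤ 2 ^ N * ∫⁻ y, G y := by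
  have hs0 : s ≠ 0 := by linarith
  have h1 : ∫⁻ y, G (a + s • y) = ∫⁻ z, G (a + z) ∂(Measure.map (s • ·) volume) := by
    exact (lintegral_map (f := fun z => G (a + z)) (hG.comp (measurable_const_add a))
      (measurable_const_smul s)).symm
  rw [h1, Measure.map_addHaar_smul volume hs0, lintegral_smul_measure,
    lintegral_add_left_eq_self G a, smul_eq_mul]
  gcongr
  rw [finrank_euclideanSpace_fin, abs_inv, abs_pow, abs_of_nonneg (by linarith), ← inv_pow]
  rw [ENNReal.ofReal_pow (by positivity)]
  gcongr
  rw [show (2 : ENNReal) = ENNReal.ofReal 2 by simp]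
  apply ENNReal.ofReal_le_ofReal
  rw [inv_le_comm₀ (by linarith) (by norm_num)]
  linarith

theorem lintegral_midpoint_le {N : ℕ} {S : Set (Sp N)} (hSo : IsOpen S) (hconv : Convex ℝ S)
    {D K : ℝ} (hD : ∀ x ∈ S, ∀ y ∈ S, ‖y - x‖ ≤ D) {w h : Sp N → ℝ}
    (hw : ContinuousOn w S) (hh : ∀ x ∈ S, ContDiffAt ℝ 1 h x) (hK0 : 0 ≤ K)
    (hK : ∀ x ∈ S, ∀ y ∈ S, ∀ z ∈ segment ℝ x y, w x ^ 2 * w y ^ 2 ≤ K * w z ^ 2) :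
    ∫⁻ x in S, ∫⁻ y in S, ENNReal.ofReal (w x ^ 2 * w y ^ 2 *
      (h y - h (x + (1 / 2 : ℝ) • (y - x))) ^ 2) ≤
    ENNReal.ofReal (K * D ^ 2) * (2 ^ N * volume S *
      ∫⁻ x in S, ENNReal.ofReal (w x ^ 2 * ‖fderiv ℝ h x‖ ^ 2)) := by
  set g : Sp N → ENNReal := fun x => ENNReal.ofReal (w x ^ 2 * ‖fderiv ℝ h x‖ ^ 2) with hg
  have hfd : ContinuousOn (fderiv ℝ h) S := fun x hx =>
    (((hh x hx).fderiv_right (m := 0) (by norm_num)).continuousAt).continuousWithinAt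
  have hgc : ContinuousOn g S :=
    ENNReal.continuous_ofReal.comp_continuousOn ((hw.pow 2).mul (hfd.norm.pow 2))
  set G : Sp N → ENNReal := S.indicator g with hGdef
  have hGm : Measurable G := by
    classical
    have := hgc.measurable_piecewise (g := fun _ => (0 : ENNReal)) continuousOn_const
      hSo.measurableSet
    have e : S.piecewise g (fun _ => (0 : ENNReal)) = G := Set.piecewise_eq_indicator
    rwa [e] at this
  have hseg : ∀ x ∈ S, ∀ y ∈ S, ∀ s ∈ Icc (0:ℝ) 1, x + s • (y - x) ∈ segment ℝ x y :=
    fun x _ y _ s hs => by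
      rw [segment_eq_image']; exact ⟨s, hs, rfl⟩
  have hpt : ∀ x ∈ S, ∀ y ∈ S, ENNReal.ofReal (w x ^ 2 * w y ^ 2 *
      (h y - h (x + (1 / 2 : ℝ) • (y - x))) ^ 2) ≤
      ENNReal.ofReal (K * D ^ 2) * ∫⁻ s in Icc (1/2:ℝ) 1, G (x + s • (y - x)) := by
    intro x hx y hy
    have hin : ∀ s ∈ Icc (1/2:ℝ) 1, x + s • (y - x) ∈ S := fun s hs =>
      hconv.segment_subset hx hy (hseg x hx y hy s ⟨by linarith [hs.1], hs.2⟩)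
    have hγ : Continuous fun s : ℝ => x + s • (y - x) := by fun_prop
    have hfc : ContinuousOn (fun s : ℝ => fderiv ℝ h (x + s • (y - x))) (Icc (1/2:ℝ) 1) :=
      hfd.comp hγ.continuousOn hin
    have hder := sq_sub_le_integral (f := fun s => h (x + s • (y - x)))
      (f' := fun s => fderiv ℝ h (x + s • (y - x)) (y - x))
      (fun s hs => by
        have h2 : HasDerivAt (fun s : ℝ => x + s • (y - x)) (y - x) s := by
          simpa using ((hasDerivAt_id s).smul_const (y - x)).const_add x
        exact (((hh _ (hin s hs)).differentiableAt (by norm_num)).hasFDerivAt).comp_hasDerivAt s h2)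
      (hfc.clm_apply continuousOn_const)
    simp only [one_smul, add_sub_cancel] at hder
    have hwγ : ContinuousOn (fun s : ℝ => w (x + s • (y - x)) ^ 2 *
        ‖fderiv ℝ h (x + s • (y - x))‖ ^ 2) (Icc (1/2:ℝ) 1) :=
      ((hw.comp hγ.continuousOn hin).pow 2).mul (hfc.norm.pow 2)
    have hint : IntegrableOn (fun s : ℝ => w (x + s • (y - x)) ^ 2 *
        ‖fderiv ℝ h (x + s • (y - x))‖ ^ 2) (Icc (1/2:ℝ) 1) := hwγ.integrableOn_Icc
    have hG' : ∫⁻ s in Icc (1/2:ℝ) 1, G (x + s • (y - x)) =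
        ENNReal.ofReal (∫ s in Icc (1/2:ℝ) 1, w (x + s • (y - x)) ^ 2 *
        ‖fderiv ℝ h (x + s • (y - x))‖ ^ 2) := by
      rw [ofReal_integral_eq_lintegral_ofReal hint
        (Filter.Eventually.of_forall fun s => by positivity)]
      refine setLIntegral_congr_fun measurableSet_Icc fun s hs => ?_
      simp only [hGdef, indicator_of_mem (hin s hs), hg]
    rw [hG', ← ENNReal.ofReal_mul (by positivity)]
    apply ENNReal.ofReal_le_ofReal
    have hw0 : 0 ≤ w x ^ 2 * w y ^ 2 := by positivity
    have hD2 : ‖y - x‖ ^ 2 ≤ D ^ 2 := by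
      have := hD x hx y hy
      gcongr
    calc w x ^ 2 * w y ^ 2 * (h y - h (x + (1 / 2 : ℝ) • (y - x))) ^ 2
        ≤ w x ^ 2 * w y ^ 2 * (1 / 2 *
          ∫ s in (1/2:ℝ)..1, (fderiv ℝ h (x + s • (y - x)) (y - x)) ^ 2) := by gcongr
      _ ≤ w x ^ 2 * w y ^ 2 * (1 *
          ∫ s in (1/2:ℝ)..1, (fderiv ℝ h (x + s • (y - x)) (y - x)) ^ 2) := by
          gcongr
          · exact intervalIntegral.integral_nonneg (by norm_num) fun s _ => sq_nonneg _
          · norm_num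
      _ = ∫ s in Icc (1/2:ℝ) 1, w x ^ 2 * w y ^ 2 *
          (fderiv ℝ h (x + s • (y - x)) (y - x)) ^ 2 := by
          rw [one_mul, intervalIntegral.integral_of_le (by norm_num),
            ← integral_Icc_eq_integral_Ioc,
            integral_const_mul]
      _ ≤ ∫ s in Icc (1/2:ℝ) 1, K * D ^ 2 * (w (x + s • (y - x)) ^ 2 *
        ‖fderiv ℝ h (x + s • (y - x))‖ ^ 2) := by
          refine setIntegral_mono_on ?_ (hint.const_mul _) measurableSet_Icc fun s hs => ?_
          · exact (continuousOn_const.mul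
              ((hfc.clm_apply continuousOn_const).pow 2)).integrableOn_Icc
          · have h1 := hK x hx y hy _ (hseg x hx y hy s ⟨by linarith [hs.1], hs.2⟩)
            have h2 : (fderiv ℝ h (x + s • (y - x)) (y - x)) ^ 2 ≤
                ‖fderiv ℝ h (x + s • (y - x))‖ ^ 2 * D ^ 2 := by
              rw [← sq_abs, ← Real.norm_eq_abs]
              refine (pow_le_pow_left₀ (norm_nonneg _)
                ((fderiv ℝ h (x + s • (y - x))).le_opNorm (y - x)) 2).trans ?_
              rw [mul_pow]
              gcongr
            calc _ ≤ (K * w (x + s • (y - x)) ^ 2) *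
                (‖fderiv ℝ h (x + s • (y - x))‖ ^ 2 * D ^ 2) := by gcongr
              _ = _ := by ring
      _ = _ := by rw [integral_const_mul]
  have hm3 : Measurable fun p : (Sp N × Sp N) × ℝ => G (p.1.1 + p.2 • (p.1.2 - p.1.1)) :=
    hGm.comp (by fun_prop)
  calc ∫⁻ x in S, ∫⁻ y in S, ENNReal.ofReal (w x ^ 2 * w y ^ 2 *
      (h y - h (x + (1 / 2 : ℝ) • (y - x))) ^ 2)
      ≤ ∫⁻ x in S, ∫⁻ y in S, ENNReal.ofReal (K * D ^ 2) *
        ∫⁻ s in Icc (1/2:ℝ) 1, G (x + s • (y - x)) :=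
        setLIntegral_mono' hSo.measurableSet fun x hx =>
          setLIntegral_mono' hSo.measurableSet fun y hy => hpt x hx y hy
    _ = ENNReal.ofReal (K * D ^ 2) * ∫⁻ x in S, ∫⁻ y in S,
        ∫⁻ s in Icc (1/2:ℝ) 1, G (x + s • (y - x)) := by
        rw [← lintegral_const_mul' _ _ ENNReal.ofReal_ne_top]
        congr 1; funext x
        rw [← lintegral_const_mul' _ _ ENNReal.ofReal_ne_top]
    _ ≤ _ := by
        gcongr
        calc ∫⁻ x in S, ∫⁻ y in S, ∫⁻ s in Icc (1/2:ℝ) 1, G (x + s • (y - x))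
            = ∫⁻ x in S, ∫⁻ s in Icc (1/2:ℝ) 1, ∫⁻ y in S, G (x + s • (y - x)) := by
              congr 1; funext x
              exact lintegral_lintegral_swap (Measurable.aemeasurable
                (hm3.comp (f := fun q : Sp N × ℝ => ((x, q.1), q.2)) (by fun_prop)))
          _ ≤ ∫⁻ x in S, ∫⁻ s in Icc (1/2:ℝ) 1, 2 ^ N * ∫⁻ y, G y := by
              refine lintegral_mono fun x => setLIntegral_mono' measurableSet_Icc fun s hs => ?_
              refine (setLIntegral_le_lintegral _ _).trans ?_
              refine le_trans (le_of_eq ?_) (lintegral_comp_affine hGm ((1 - s) • x) hs.1)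
              congr 1; funext y; congr 1
              module
          _ ≤ ∫⁻ x in S, 2 ^ N * ∫⁻ y, G y := by
              refine lintegral_mono fun x => ?_
              rw [setLIntegral_const, Real.volume_Icc]
              refine mul_le_of_le_one_right' ?_
              rw [← ENNReal.ofReal_one]
              exact ENNReal.ofReal_le_ofReal (by norm_num)
          _ = _ := by
              rw [setLIntegral_const, hGdef, lintegral_indicator hSo.measurableSet]
              ring

/-- Weighted Poincaré inequality on a convex set. -/
theorem weighted_poincare {N : ℕ} {S : Set (Sp N)} (hSo : IsOpen S) (hconv : Convex ℝ S)
    (hSv : volume S ≠ ⊤)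
    {D K : ℝ} (hD : ∀ x ∈ S, ∀ y ∈ S, ‖y - x‖ ≤ D) {w h : Sp N → ℝ}
    (hw : ContinuousOn w S) (hh : ∀ x ∈ S, ContDiffAt ℝ 1 h x) (hK0 : 0 ≤ K)
    (hK : ∀ x ∈ S, ∀ y ∈ S, ∀ z ∈ segment ℝ x y, w x ^ 2 * w y ^ 2 ≤ K * w z ^ 2)
    (i0 : IntegrableOn (fun x => w x ^ 2) S)
    (i1 : IntegrableOn (fun x => w x ^ 2 * h x) S)
    (i2 : IntegrableOn (fun x => w x ^ 2 * h x ^ 2) S)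
    (i3 : IntegrableOn (fun x => w x ^ 2 * ‖fderiv ℝ h x‖ ^ 2) S) :
    (∫ x in S, w x ^ 2) * (∫ x in S, w x ^ 2 * h x ^ 2) - (∫ x in S, w x ^ 2 * h x) ^ 2 ≤
      2 * (K * D ^ 2) * (2 ^ N * (volume S).toReal) *
        ∫ x in S, w x ^ 2 * ‖fderiv ℝ h x‖ ^ 2 := by
  set A := ∫ x in S, w x ^ 2
  set B := ∫ x in S, w x ^ 2 * h x ^ 2
  set C := ∫ x in S, w x ^ 2 * h x
  have hhc : ContinuousOn h S := fun x hx => (hh x hx).continuousAt.continuousWithinAt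
  have hmem : ∀ x ∈ S, ∀ y ∈ S, x + (1 / 2 : ℝ) • (y - x) ∈ S := fun x hx y hy =>
    hconv.segment_subset hx hy (by
      rw [segment_eq_image']; exact ⟨1 / 2, ⟨by norm_num, by norm_num⟩, rfl⟩)
  set J := ∫⁻ x in S, ∫⁻ y in S, ENNReal.ofReal (w x ^ 2 * w y ^ 2 *
      (h y - h (x + (1 / 2 : ℝ) • (y - x))) ^ 2)
  have hsym : J = ∫⁻ x in S, ∫⁻ y in S, ENNReal.ofReal (w x ^ 2 * w y ^ 2 *
      (h x - h (x + (1 / 2 : ℝ) • (y - x))) ^ 2) := by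
    have hcont : ContinuousOn (fun p : Sp N × Sp N => ENNReal.ofReal (w p.1 ^ 2 * w p.2 ^ 2 *
        (h p.2 - h (p.1 + (1 / 2 : ℝ) • (p.2 - p.1))) ^ 2)) (S ×ˢ S) := by
      refine ENNReal.continuous_ofReal.comp_continuousOn ?_
      have f1 : ContinuousOn (fun p : Sp N × Sp N => w p.1) (S ×ˢ S) :=
        hw.comp continuousOn_fst fun p hp => hp.1
      have f2 : ContinuousOn (fun p : Sp N × Sp N => w p.2) (S ×ˢ S) :=
        hw.comp continuousOn_snd fun p hp => hp.2
      have f3 : ContinuousOn (fun p : Sp N × Sp N => h p.2) (S ×ˢ S) :=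
        hhc.comp continuousOn_snd fun p hp => hp.2
      have f4 : ContinuousOn (fun p : Sp N × Sp N => h (p.1 + (1 / 2 : ℝ) • (p.2 - p.1)))
          (S ×ˢ S) :=
        hhc.comp (Continuous.continuousOn (by fun_prop)) fun p hp => hmem _ hp.1 _ hp.2
      exact ((f1.pow 2).mul (f2.pow 2)).mul ((f3.sub f4).pow 2)
    have hae : AEMeasurable (Function.uncurry fun x y : Sp N => ENNReal.ofReal (w x ^ 2 * w y ^ 2 *
        (h y - h (x + (1 / 2 : ℝ) • (y - x))) ^ 2))
        ((volume.restrict S).prod (volume.restrict S)) := by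
      rw [Measure.prod_restrict]
      exact hcont.aemeasurable (hSo.measurableSet.prod hSo.measurableSet)
    rw [show J = _ from lintegral_lintegral_swap hae]
    congr 1; funext x; congr 1; funext y; congr 1
    have : y + (1 / 2 : ℝ) • (x - y) = x + (1 / 2 : ℝ) • (y - x) := by module
    rw [this]; ring
  have hreal : ENNReal.ofReal (2 * (A * B - C ^ 2)) =
      ∫⁻ x in S, ∫⁻ y in S, ENNReal.ofReal (w x ^ 2 * w y ^ 2 * (h x - h y) ^ 2) := by
    have e : ∀ x y, w x ^ 2 * w y ^ 2 * (h x - h y) ^ 2 =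
        w x ^ 2 * (w y ^ 2 * h y ^ 2) - 2 * (w x ^ 2 * h x) * (w y ^ 2 * h y) +
          (w x ^ 2 * h x ^ 2) * w y ^ 2 := fun x y => by ring
    have hI : ∀ x, IntegrableOn (fun y => w x ^ 2 * w y ^ 2 * (h x - h y) ^ 2) S := fun x => by
      simp only [e]
      exact ((i2.const_mul _).sub (i1.const_mul _)).add (i0.const_mul _)
    have hin : ∀ x, ∫ y in S, w x ^ 2 * w y ^ 2 * (h x - h y) ^ 2 =
        w x ^ 2 * B - 2 * (w x ^ 2 * h x) * C + (w x ^ 2 * h x ^ 2) * A := fun x => by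
      simp only [e]
      rw [integral_sub_add (i2.const_mul _) (i1.const_mul _) (i0.const_mul _),
        integral_const_mul, integral_const_mul, integral_const_mul]
    have hl : ∀ x, ∫⁻ y in S, ENNReal.ofReal (w x ^ 2 * w y ^ 2 * (h x - h y) ^ 2) =
        ENNReal.ofReal (∫ y in S, w x ^ 2 * w y ^ 2 * (h x - h y) ^ 2) := fun x =>
      (ofReal_integral_eq_lintegral_ofReal (hI x)
        (Filter.Eventually.of_forall fun y => by positivity)).symm
    simp only [hl]
    have j2 : IntegrableOn (fun x => 2 * (w x ^ 2 * h x) * C) S :=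
      (i1.const_mul 2).mul_const C
    rw [← ofReal_integral_eq_lintegral_ofReal]
    · congr 1
      simp only [hin]
      rw [integral_sub_add (i0.mul_const _) j2 (i2.mul_const _), integral_mul_const,
          integral_mul_const,
        integral_mul_const, integral_const_mul]
      ring
    · simp only [hin]
      exact ((i0.mul_const _).sub j2).add (i2.mul_const _)
    · exact Filter.Eventually.of_forall fun x => integral_nonneg fun y => by positivity
  have hJ : ∫⁻ x in S, ∫⁻ y in S, ENNReal.ofReal (w x ^ 2 * w y ^ 2 * (h x - h y) ^ 2) ≤
      4 * J := by
    have hmeas : ∀ x ∈ S, AEMeasurable (fun y => 2 * ENNReal.ofReal (w x ^ 2 * w y ^ 2 *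
        (h y - h (x + (1 / 2 : ℝ) • (y - x))) ^ 2)) (volume.restrict S) := by
      intro x hx
      refine AEMeasurable.const_mul (ContinuousOn.aemeasurable
        (ENNReal.continuous_ofReal.comp_continuousOn ?_) hSo.measurableSet) _
      have f4 : ContinuousOn (fun y : Sp N => h (x + (1 / 2 : ℝ) • (y - x))) S :=
        hhc.comp (Continuous.continuousOn (by fun_prop)) fun y hy => hmem _ hx _ hy
      exact (continuousOn_const.mul (hw.pow 2)).mul ((hhc.sub f4).pow 2)
    have hmeas2 : AEMeasurable (fun x => ∫⁻ y in S, 2 * ENNReal.ofReal (w x ^ 2 * w y ^ 2 *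
        (h y - h (x + (1 / 2 : ℝ) • (y - x))) ^ 2)) (volume.restrict S) := by
      refine AEMeasurable.lintegral_prod_right' (f := fun p : Sp N × Sp N =>
        2 * ENNReal.ofReal (w p.1 ^ 2 * w p.2 ^ 2 *
        (h p.2 - h (p.1 + (1 / 2 : ℝ) • (p.2 - p.1))) ^ 2)) ?_
      rw [Measure.prod_restrict]
      refine AEMeasurable.const_mul (ContinuousOn.aemeasurable
        (ENNReal.continuous_ofReal.comp_continuousOn ?_)
        (hSo.measurableSet.prod hSo.measurableSet)) _
      have f1 : ContinuousOn (fun p : Sp N × Sp N => w p.1) (S ×ˢ S) :=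
        hw.comp continuousOn_fst fun p hp => hp.1
      have f2 : ContinuousOn (fun p : Sp N × Sp N => w p.2) (S ×ˢ S) :=
        hw.comp continuousOn_snd fun p hp => hp.2
      have f3 : ContinuousOn (fun p : Sp N × Sp N => h p.2) (S ×ˢ S) :=
        hhc.comp continuousOn_snd fun p hp => hp.2
      have f4 : ContinuousOn (fun p : Sp N × Sp N => h (p.1 + (1 / 2 : ℝ) • (p.2 - p.1)))
          (S ×ˢ S) :=
        hhc.comp (Continuous.continuousOn (by fun_prop)) fun p hp => hmem _ hp.1 _ hp.2
      exact ((f1.pow 2).mul (f2.pow 2)).mul ((f3.sub f4).pow 2)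
    calc _ ≤ ∫⁻ x in S, ((∫⁻ y in S, 2 * ENNReal.ofReal (w x ^ 2 * w y ^ 2 *
          (h y - h (x + (1 / 2 : ℝ) • (y - x))) ^ 2)) +
          ∫⁻ y in S, 2 * ENNReal.ofReal (w x ^ 2 * w y ^ 2 *
          (h x - h (x + (1 / 2 : ℝ) • (y - x))) ^ 2)) := by
          refine setLIntegral_mono' hSo.measurableSet fun x hx => ?_
          rw [← lintegral_add_left' (hmeas x hx)]
          refine lintegral_mono fun y => ?_
          simp only
          have h2 : ∀ r, 2 * ENNReal.ofReal r = ENNReal.ofReal (2 * r) := fun r => by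
            rw [ENNReal.ofReal_mul (by norm_num)]; simp
          rw [h2, h2, ← ENNReal.ofReal_add (by positivity)
            (by positivity)]
          apply ENNReal.ofReal_le_ofReal
          set m := h (x + (1 / 2 : ℝ) • (y - x))
          have : (h x - h y) ^ 2 ≤ 2 * (h y - m) ^ 2 + 2 * (h x - m) ^ 2 := by
            nlinarith [sq_nonneg (h x - m + (h y - m))]
          have hw0 : 0 ≤ w x ^ 2 * w y ^ 2 := by positivity
          nlinarith [mul_le_mul_of_nonneg_left this hw0]
      _ = 2 * J + 2 * J := by
          rw [lintegral_add_left' hmeas2]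
          congr 1
          · simp only [J]
            rw [← lintegral_const_mul' _ _ (by simp)]
            congr 1; funext x
            rw [← lintegral_const_mul' _ _ (by simp)]
          · rw [hsym, ← lintegral_const_mul' _ _ (by simp)]
            congr 1; funext x
            rw [← lintegral_const_mul' _ _ (by simp)]
      _ = 4 * J := by ring
  have hfin := lintegral_midpoint_le hSo hconv hD hw hh hK0 hK
  rw [← ofReal_integral_eq_lintegral_ofReal i3
    (Filter.Eventually.of_forall fun x => by positivity)] at hfin
  have h5 : ENNReal.ofReal (2 * (A * B - C ^ 2)) ≤ ENNReal.ofReal (4 * ((K * D ^ 2) *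
      (2 ^ N * (volume S).toReal * ∫ x in S, w x ^ 2 * ‖fderiv ℝ h x‖ ^ 2))) := by
    rw [hreal]
    refine hJ.trans ((mul_le_mul_right hfin 4).trans_eq ?_)
    have hKD : 0 ≤ K * D ^ 2 := by positivity
    rw [ENNReal.ofReal_mul (p := 4) (by norm_num), ENNReal.ofReal_mul (p := K * D ^ 2) hKD,
      ENNReal.ofReal_mul (p := 2 ^ N * (volume S).toReal) (by positivity),
      ENNReal.ofReal_mul (p := 2 ^ N) (by positivity),
      ENNReal.ofReal_toReal hSv, ENNReal.ofReal_pow (by norm_num)]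
    simp
  have h6 := (ENNReal.ofReal_le_ofReal_iff (by
    have : 0 ≤ ∫ x in S, w x ^ 2 * ‖fderiv ℝ h x‖ ^ 2 :=
      integral_nonneg fun x => by positivity
    positivity)).1 h5
  linarith

/-- The reflection across the hyperplane `{x₀ = 0}`. -/
def refl0 (N : ℕ) [NeZero N] : Sp N ≃ₗᵢ[ℝ] Sp N :=
  LinearIsometryEquiv.piLpCongrRight 2 fun i : Fin N =>
    if i = 0 then LinearIsometryEquiv.neg ℝ else LinearIsometryEquiv.refl ℝ ℝ

theorem refl0_apply {N : ℕ} [NeZero N] (x : Sp N) (i : Fin N) :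
    refl0 N x i = if i = 0 then -x i else x i := by
  simp only [refl0, LinearIsometryEquiv.piLpCongrRight_apply]
  split_ifs <;> simp

theorem refl0_zero {N : ℕ} [NeZero N] (x : Sp N) : refl0 N x 0 = -x 0 := by
  simp [refl0_apply]

theorem refl0_refl0 {N : ℕ} [NeZero N] (x : Sp N) : refl0 N (refl0 N x) = x := by
  ext i; rw [refl0_apply, refl0_apply]; split_ifs <;> simp

theorem refl0_of_zero {N : ℕ} [NeZero N] {x : Sp N} (h : x 0 = 0) : refl0 N x = x := by
  ext i; rw [refl0_apply]; split_ifs with hi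
  · subst hi; simp [h]
  · rfl

theorem refl0_single {N : ℕ} [NeZero N] (d : ℝ) :
    refl0 N (EuclideanSpace.single 0 d) = EuclideanSpace.single 0 (-d) := by
  ext i; rw [refl0_apply]
  simp only [PiLp.single_apply]
  split_ifs <;> simp

theorem volume_hyperplane {N : ℕ} [NeZero N] : volume {x : Sp N | x 0 = 0} = 0 := by
  let p : Submodule ℝ (Sp N) :=
    LinearMap.ker (EuclideanSpace.proj (0 : Fin N) : Sp N →L[ℝ] ℝ).toLinearMap
  have hp : p ≠ ⊤ := by
    intro h
    have : EuclideanSpace.single (0 : Fin N) (1 : ℝ) ∈ p := by rw [h]; trivial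
    simp [p] at this
  have := Measure.addHaar_submodule (volume : Measure (Sp N)) p hp
  have he : {x : Sp N | x 0 = 0} = (p : Set (Sp N)) := by ext x; simp [p]
  rw [he, this]

theorem integral_eq_halfSp {N : ℕ} [NeZero N] {g : Sp N → ℝ} (hg : Integrable g) :
    ∫ x, g x = ∫ x in halfSp N, (g x + g (refl0 N x)) := by
  have hmp := (refl0 N).measurePreserving
  have hg' : Integrable (fun x => g (refl0 N x)) :=
    hmp.integrable_comp_of_integrable hg
  rw [integral_add hg.integrableOn hg'.integrableOn,
    ← integral_add_compl (measurableSet_halfSp (N := N)) hg]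
  congr 1
  have h1 : ∫ x in (refl0 N) ⁻¹' (halfSp N), g (refl0 N (refl0 N x)) =
      ∫ x in halfSp N, g (refl0 N x) :=
    hmp.setIntegral_preimage_emb (refl0 N).toHomeomorph.measurableEmbedding
      (fun x => g (refl0 N x)) _
  rw [← h1]
  simp only [refl0_refl0]
  refine setIntegral_congr_set ?_
  have h0 : ∀ᵐ x : Sp N, x 0 ≠ 0 := by
    rw [ae_iff]; simpa using volume_hyperplane
  filter_upwards [h0] with x hx
  apply propext
  change (x ∈ (halfSp N)ᶜ) ↔ (refl0 N x ∈ halfSp N)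
  simp only [halfSp, mem_compl_iff, mem_ofPred_eq, refl0_zero, not_lt]
  constructor
  · intro h; have := lt_of_le_of_ne h hx; linarith
  · intro h; linarith

theorem norm_sq_parallelogram {N : ℕ} (S T : Sp N →L[ℝ] ℝ) :
    ‖(2⁻¹ : ℝ) • (S + T)‖ ^ 2 + ‖(2⁻¹ : ℝ) • (S - T)‖ ^ 2 = (‖S‖ ^ 2 + ‖T‖ ^ 2) / 2 := by
  simp only [norm_sq_clm]
  rw [← Finset.sum_add_distrib, ← Finset.sum_add_distrib, Finset.sum_div]
  refine Finset.sum_congr rfl fun i _ => ?_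
  simp; ring

/-- Even part with respect to the reflection. -/
def evenPart {N : ℕ} [NeZero N] (u : Sp N → ℝ) (x : Sp N) : ℝ := (u x + u (refl0 N x)) / 2

/-- Odd part with respect to the reflection. -/
def oddPart {N : ℕ} [NeZero N] (u : Sp N → ℝ) (x : Sp N) : ℝ := (u x - u (refl0 N x)) / 2

section
variable {N : ℕ} [NeZero N] {u : Sp N → ℝ}

theorem contDiff_comp_refl0 {n : WithTop ℕ∞} (hu : ContDiff ℝ n u) :
    ContDiff ℝ n (fun x => u (refl0 N x)) := hu.comp (refl0 N).contDiff

theorem contDiff_evenPart {n : WithTop ℕ∞} (hu : ContDiff ℝ n u) : ContDiff ℝ n (evenPart u) :=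
  (hu.add (contDiff_comp_refl0 hu)).div_const 2

theorem contDiff_oddPart {n : WithTop ℕ∞} (hu : ContDiff ℝ n u) : ContDiff ℝ n (oddPart u) :=
  (hu.sub (contDiff_comp_refl0 hu)).div_const 2

theorem tsupport_comp_refl0 : tsupport (fun x => u (refl0 N x)) = (refl0 N) ⁻¹' tsupport u :=
  tsupport_comp_eq_preimage u (refl0 N).toHomeomorph

theorem hasCompactSupport_comp_refl0 (hu : HasCompactSupport u) :
    HasCompactSupport (fun x => u (refl0 N x)) :=
  hu.comp_homeomorph (refl0 N).toHomeomorph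

theorem tsupport_evenPart_subset :
    tsupport (evenPart u) ⊆ tsupport u ∪ (refl0 N) ⁻¹' tsupport u := by
  refine closure_minimal (fun x hx => ?_)
    ((isClosed_tsupport _).union ((isClosed_tsupport _).preimage (refl0 N).continuous))
  by_contra h
  rw [mem_union, not_or] at h
  exact hx (by simp [evenPart, image_eq_zero_of_notMem_tsupport h.1,
    image_eq_zero_of_notMem_tsupport (show refl0 N x ∉ tsupport u from h.2)])

theorem tsupport_oddPart_subset : tsupport (oddPart u) ⊆ tsupport u ∪ (refl0 N) ⁻¹' tsupport u := by
  refine closure_minimal (fun x hx => ?_)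
    ((isClosed_tsupport _).union ((isClosed_tsupport _).preimage (refl0 N).continuous))
  by_contra h
  rw [mem_union, not_or] at h
  exact hx (by simp [oddPart, image_eq_zero_of_notMem_tsupport h.1,
    image_eq_zero_of_notMem_tsupport (show refl0 N x ∉ tsupport u from h.2)])

theorem hasCompactSupport_evenPart (hu : HasCompactSupport u) : HasCompactSupport (evenPart u) :=
  ((show IsCompact (tsupport u) from hu).union
    ((refl0 N).toHomeomorph.isCompact_preimage.2 hu)).of_isClosed_subset
    (isClosed_tsupport _) tsupport_evenPart_subset

theorem hasCompactSupport_oddPart (hu : HasCompactSupport u) : HasCompactSupport (oddPart u) :=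
  ((show IsCompact (tsupport u) from hu).union
    ((refl0 N).toHomeomorph.isCompact_preimage.2 hu)).of_isClosed_subset
    (isClosed_tsupport _) tsupport_oddPart_subset

theorem norm_fderiv_comp_refl0 (x : Sp N) :
    ‖fderiv ℝ (fun y => u (refl0 N y)) x‖ = ‖fderiv ℝ u (refl0 N x)‖ := by
  have := (refl0 N).toContinuousLinearEquiv.comp_right_fderiv (f := u) (x := x)
  have h2 : fderiv ℝ (fun y => u (refl0 N y)) x =
      (fderiv ℝ u (refl0 N x)).comp ((refl0 N).toContinuousLinearEquiv : Sp N →L[ℝ] Sp N) := this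
  rw [h2]
  exact ContinuousLinearMap.opNorm_comp_linearIsometryEquiv _ (refl0 N)

theorem integral_sq_even_odd (hu : ContDiff ℝ 1 u) (hc : HasCompactSupport u) :
    ∫ x, u x ^ 2 =
      2 * (∫ x in halfSp N, evenPart u x ^ 2) + 2 * ∫ x in halfSp N, oddPart u x ^ 2 := by
  rw [integral_eq_halfSp (integrable_sq hu.continuous hc), ← integral_const_mul,
    ← integral_const_mul, ← integral_add]
  · congr 1; funext x; simp only [evenPart, oddPart]; ring
  · exact ((integrable_sq (contDiff_evenPart hu).continuous
      (hasCompactSupport_evenPart hc)).const_mul 2).integrableOn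
  · exact ((integrable_sq (contDiff_oddPart hu).continuous
      (hasCompactSupport_oddPart hc)).const_mul 2).integrableOn

theorem integral_norm_fderiv_sq_even_odd (hu : ContDiff ℝ 1 u) (hc : HasCompactSupport u) :
    ∫ x, ‖fderiv ℝ u x‖ ^ 2 = 2 * (∫ x in halfSp N, ‖fderiv ℝ (evenPart u) x‖ ^ 2) +
      2 * ∫ x in halfSp N, ‖fderiv ℝ (oddPart u) x‖ ^ 2 := by
  rw [integral_eq_halfSp (integrable_norm_fderiv_sq hu hc), ← integral_const_mul,
    ← integral_const_mul, ← integral_add]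
  · congr 1; funext x
    have hd : DifferentiableAt ℝ u x := (hu.differentiable (by norm_num)) x
    have hd' : DifferentiableAt ℝ (fun y => u (refl0 N y)) x :=
      ((contDiff_comp_refl0 hu).differentiable (by norm_num)) x
    have he : fderiv ℝ (evenPart u) x =
        (2⁻¹ : ℝ) • (fderiv ℝ u x + fderiv ℝ (fun y => u (refl0 N y)) x) := by
      refine HasFDerivAt.fderiv ?_
      have := (hd.hasFDerivAt.add hd'.hasFDerivAt).const_smul (2⁻¹ : ℝ)
      have hfun : evenPart u = (2⁻¹ : ℝ) • (u + fun y => u (refl0 N y)) := by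
        funext y; simp [evenPart]; ring
      rwa [hfun]
    have ho : fderiv ℝ (oddPart u) x =
        (2⁻¹ : ℝ) • (fderiv ℝ u x - fderiv ℝ (fun y => u (refl0 N y)) x) := by
      refine HasFDerivAt.fderiv ?_
      have := (hd.hasFDerivAt.sub hd'.hasFDerivAt).const_smul (2⁻¹ : ℝ)
      have hfun : oddPart u = (2⁻¹ : ℝ) • (u - fun y => u (refl0 N y)) := by
        funext y; simp [oddPart]; ring
      rwa [hfun]
    have := norm_sq_parallelogram (fderiv ℝ u x) (fderiv ℝ (fun y => u (refl0 N y)) x)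
    rw [he, ho, ← norm_fderiv_comp_refl0]
    linarith
  · exact ((integrable_norm_fderiv_sq (contDiff_evenPart hu)
      (hasCompactSupport_evenPart hc)).const_mul 2).integrableOn
  · exact ((integrable_norm_fderiv_sq (contDiff_oddPart hu)
      (hasCompactSupport_oddPart hc)).const_mul 2).integrableOn

end

/-- Two unit balls centred at `±d e₁`. -/
def pairBalls (N : ℕ) [NeZero N] (d : ℝ) : Set (Sp N) :=
  ball (EuclideanSpace.single 0 d) 1 ∪ ball (EuclideanSpace.single 0 (-d)) 1

theorem refl0_mem_pairBalls {N : ℕ} [NeZero N] {d : ℝ} {x : Sp N} (h : refl0 N x ∈ pairBalls N d) :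
    x ∈ pairBalls N d := by
  have key : ∀ a : ℝ, dist (refl0 N x) (EuclideanSpace.single 0 a) =
      dist x (EuclideanSpace.single 0 (-a)) := by
    intro a
    rw [← (refl0 N).dist_map x, refl0_single, neg_neg]
  rcases h with h | h
  · right; rw [mem_ball, key] at h; exact h
  · left; rw [mem_ball, key, neg_neg] at h; exact h

theorem norm_sub_single_sq {N : ℕ} [NeZero N] (x : Sp N) (d : ℝ) :
    ‖x - EuclideanSpace.single 0 d‖ ^ 2 = ‖x‖ ^ 2 - 2 * d * x 0 + d ^ 2 := by
  rw [norm_sub_sq_real]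
  simp [EuclideanSpace.inner_single_right]
  ring

theorem mem_ball_of_mem_pairBalls {N : ℕ} [NeZero N] {d : ℝ} (hd : 0 ≤ d) {x : Sp N} (hx : 0 ≤ x 0)
    (h : x ∈ pairBalls N d) : ‖x - EuclideanSpace.single 0 d‖ < 1 := by
  rcases h with h | h
  · rwa [mem_ball_iff_norm] at h
  · rw [mem_ball_iff_norm] at h
    refine lt_of_le_of_lt ?_ h
    refine le_of_sq_le_sq ?_ (norm_nonneg _)
    rw [norm_sub_single_sq, norm_sub_single_sq]
    nlinarith [mul_nonneg hd hx]

section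
variable {N : ℕ} [NeZero N] {u : Sp N → ℝ} {d : ℝ}

theorem tsupport_evenPart_subset_pairBalls (h : tsupport u ⊆ pairBalls N d) :
    tsupport (evenPart u) ⊆ pairBalls N d :=
  tsupport_evenPart_subset.trans (union_subset h fun _ hx => refl0_mem_pairBalls (h hx))

theorem tsupport_oddPart_subset_pairBalls (h : tsupport u ⊆ pairBalls N d) :
    tsupport (oddPart u) ⊆ pairBalls N d :=
  tsupport_oddPart_subset.trans (union_subset h fun _ hx => refl0_mem_pairBalls (h hx))

theorem oddPart_of_zero {x : Sp N} (h : x 0 = 0) : oddPart u x = 0 := by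
  simp [oddPart, refl0_of_zero h]

end

/-- `s₀` is the first zero of the radial profile. -/
structure IsFirstZero (N : ℕ) (s₀ : ℝ) : Prop where
  pos : 0 < s₀
  eq_zero : radialFun N s₀ = 0
  fun_pos : ∀ s, 0 ≤ s → s < s₀ → 0 < radialFun N s
  deriv_neg : ∀ s, 0 ≤ s → s ≤ s₀ → deriv (radialFun N) s < 0

section
variable {N : ℕ} [NeZero N] {s₀ : ℝ} {u : Sp N → ℝ} {d : ℝ}

theorem one_le_dim : 1 ≤ N := Nat.one_le_iff_ne_zero.2 (NeZero.ne N)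

theorem IsFirstZero.antitoneOn (hs : IsFirstZero N s₀) :
    AntitoneOn (radialFun N) (Icc 0 s₀) := by
  have hF := contDiff_radialFun (one_le_dim (N := N)) (n := 1)
  refine antitoneOn_of_deriv_nonpos (convex_Icc _ _) hF.continuous.continuousOn
    (hF.differentiable (by norm_num)).differentiableOn fun x hx => ?_
  rw [interior_Icc] at hx
  exact (hs.deriv_neg x hx.1.le hx.2.le).le

/-- Any function in the half-space ball vanishing on the hyperplane satisfies the sharp
inequality. -/
theorem halfSp_poincare (hs : IsFirstZero N s₀) (hd : 0 ≤ d) (hu : ContDiff ℝ 1 u)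
    (hc : HasCompactSupport u) (hsupp : tsupport u ⊆ pairBalls N d)
    (h0 : ∀ x ∈ tsupport u, x 0 = 0 → u x = 0) :
    s₀ * (∫ x in halfSp N, u x ^ 2) ≤ ∫ x in halfSp N, ‖fderiv ℝ u x‖ ^ 2 := by
  have hF := contDiff_radialFun (one_le_dim (N := N)) (n := 2)
  have hb := barta_halfSp (Λ := s₀)
    (w := fun y => radialFun N (s₀ * ‖y - EuclideanSpace.single 0 d‖ ^ 2)) hu hc
    (fun x _ _ => (hF.comp (contDiff_dist_sq s₀ _)).contDiffAt)
    (fun x hx hx0 => by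
      have h1 := mem_ball_of_mem_pairBalls hd hx0 (hsupp hx)
      have h2 : ‖x - EuclideanSpace.single 0 d‖ ^ 2 < 1 := by
        nlinarith [norm_nonneg (x - EuclideanSpace.single 0 d)]
      have := hs.pos
      exact hs.fun_pos _ (by positivity) (by nlinarith))
    (fun x _ _ => (laplacian_radialFun one_le_dim s₀ _ x).le)
    (fun x hx hx0 => Or.inl (h0 x hx hx0))
  have hq : 0 ≤ ∫ x in halfSp N, ∑ i, (pd i u x - u x * (pd i (fun y => radialFun N
      (s₀ * ‖y - EuclideanSpace.single 0 d‖ ^ 2)) x /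
        radialFun N (s₀ * ‖x - EuclideanSpace.single 0 d‖ ^ 2))) ^ 2 :=
    integral_nonneg fun x => Finset.sum_nonneg fun i _ => sq_nonneg _
  linarith [hb.2]

/-- Disjoint balls: the sharp inequality for all test functions. -/
theorem poincare_pairBalls (hs : IsFirstZero N s₀) (hd : 1 ≤ d)
    (hu : u ∈ testFun N (pairBalls N d)) :
    s₀ * (∫ x, u x ^ 2) ≤ ∫ x, ‖fderiv ℝ u x‖ ^ 2 := by
  have h1 : ContDiff ℝ 1 u := contDiff_of_mem_testFun hu (n := 1)
  have hc := hu.2.1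
  have h0 : ∀ x ∈ pairBalls N d, x 0 ≠ 0 := by
    intro x hx hx0
    have h := mem_ball_of_mem_pairBalls (by linarith) hx0.ge hx
    have h2 : ‖x - EuclideanSpace.single 0 d‖ ^ 2 < 1 := by
      nlinarith [norm_nonneg (x - EuclideanSpace.single 0 d)]
    rw [norm_sub_single_sq, hx0] at h2
    nlinarith [sq_nonneg ‖x‖]
  rw [integral_sq_even_odd h1 hc, integral_norm_fderiv_sq_even_odd h1 hc]
  have he := halfSp_poincare hs (by linarith) (contDiff_evenPart h1) (hasCompactSupport_evenPart hc)
    (tsupport_evenPart_subset_pairBalls hu.2.2)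
    fun x hx hx0 => absurd hx0 (h0 x (tsupport_evenPart_subset_pairBalls hu.2.2 hx))
  have ho := halfSp_poincare hs (by linarith) (contDiff_oddPart h1) (hasCompactSupport_oddPart hc)
    (tsupport_oddPart_subset_pairBalls hu.2.2) fun x _ hx0 => oddPart_of_zero hx0
  linarith

end

theorem pd_add {N : ℕ} {u v : Sp N → ℝ} {x : Sp N} (hu : DifferentiableAt ℝ u x)
    (hv : DifferentiableAt ℝ v x) (i : Fin N) :
    pd i (fun y => u y + v y) x = pd i u x + pd i v x := by
  simp only [pd]; rw [fderiv_fun_add hu hv]; rfl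

theorem laplacian_add {N : ℕ} {u v : Sp N → ℝ} {x : Sp N} (hu : ContDiffAt ℝ 2 u x)
    (hv : ContDiffAt ℝ 2 v x) :
    ∑ i, pd i (pd i (fun y => u y + v y)) x =
      ∑ i, pd i (pd i u) x + ∑ i, pd i (pd i v) x := by
  rw [← Finset.sum_add_distrib]
  refine Finset.sum_congr rfl fun i _ => ?_
  have h : pd i (fun y => u y + v y) =ᶠ[nhds x] fun y => pd i u y + pd i v y := by
    filter_upwards [hu.eventually (by norm_num), hv.eventually (by norm_num)] with y h1 h2
    exact pd_add (h1.differentiableAt (by norm_num)) (h2.differentiableAt (by norm_num)) i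
  have : pd i (pd i (fun y => u y + v y)) x = pd i (fun y => pd i u y + pd i v y) x := by
    rw [pd, h.fderiv_eq]; rfl
  rw [this, pd_add ((contDiffAt_pd hu (m := 1) (by norm_num) i).differentiableAt (by norm_num))
    ((contDiffAt_pd hv (m := 1) (by norm_num) i).differentiableAt (by norm_num))]

theorem deriv_const_mul_sub_log (A L : ℝ) :
    deriv (fun r : ℝ => A * (L - Real.log r)) = fun r => A * -r⁻¹ := by
  funext r
  rw [deriv_const_mul_field, deriv_const_sub, Real.deriv_log]

theorem deriv_deriv_const_mul_sub_log (A L r : ℝ) :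
    deriv (deriv (fun r : ℝ => A * (L - Real.log r))) r = A * (r ^ 2)⁻¹ := by
  rw [deriv_const_mul_sub_log, deriv_const_mul_field]
  simp

set_option maxHeartbeats 1000000 in
theorem exists_supersolution {N : ℕ} [NeZero N] (hN : 2 ≤ N) {s₀ κ θ : ℝ} (hs : IsFirstZero N s₀)
    (hκ0 : 0 < κ) (hκ : κ < s₀) (hθ : 0 < θ) :
    ∃ t₀ > 0, t₀ ≤ 1 / 2 ∧ ∀ t, 0 < t → t < t₀ → ∃ w : Sp N → ℝ, ∀ x, 0 ≤ x 0 →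
      ‖x - EuclideanSpace.single 0 (1 - t ^ 2)‖ ≤ 1 →
      ContDiffAt ℝ 2 w x ∧
      radialFun N (κ * ‖x - EuclideanSpace.single 0 (1 - t ^ 2)‖ ^ 2) ≤ w x ∧
      w x ≤ (1 + θ) * radialFun N (κ * ‖x - EuclideanSpace.single 0 (1 - t ^ 2)‖ ^ 2) ∧
      ∑ i, pd i (pd i w) x ≤ -(κ / (1 + θ) * w x) ∧ (x 0 = 0 → pd 0 w x ≤ 0) := by
  have hF : ContDiff ℝ 2 (radialFun N) := contDiff_radialFun one_le_dim (n := 2)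
  have hF' : Continuous (deriv (radialFun N)) := hF.continuous_deriv (by norm_num)
  obtain ⟨M, hM⟩ := isCompact_Icc.exists_bound_of_continuousOn (s := Icc (0 : ℝ) s₀)
      hF'.continuousOn
  have hM0 : 0 ≤ M := (norm_nonneg _).trans (hM 0 ⟨le_rfl, hs.pos.le⟩)
  have hs0 := hs.pos
  set m := radialFun N κ with hm
  have hmpos : 0 < m := hs.fun_pos κ hκ0.le hκ
  set P := 2 * s₀ * M with hP
  have hP0 : 0 ≤ P := by positivity
  have hcont : Continuous fun t : ℝ => 2 * P * (t * Real.log 16 - 2 * (t * Real.log t)) := by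
    have := Real.continuous_mul_log
    fun_prop
  have hev : ∀ᶠ t in nhds (0 : ℝ), 2 * P * (t * Real.log 16 - 2 * (t * Real.log t)) < θ * m := by
    refine hcont.continuousAt.eventually_lt continuousAt_const ?_
    simp; positivity
  obtain ⟨t₁, ht₁, h₁⟩ := Metric.eventually_nhds_iff.1 hev
  refine ⟨min t₁ (1 / 2), by positivity, min_le_right _ _, fun t ht htt => ?_⟩
  have htt1 : t < t₁ := htt.trans_le (min_le_left _ _)
  have htt2 : t < 1 / 2 := htt.trans_le (min_le_right _ _)
  have hsmall := h₁ (y := t) (by rw [Real.dist_eq, sub_zero, abs_of_pos ht]; exact htt1)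
  set c : Sp N := EuclideanSpace.single 0 (1 - t ^ 2) with hc
  set c' : Sp N := EuclideanSpace.single 0 (-t) with hc'
  set A := 2 * P * t with hA
  have hA0 : 0 ≤ A := by positivity
  set g : ℝ → ℝ := fun r => A * (Real.log 16 - Real.log r) with hg
  refine ⟨fun y => radialFun N (κ * ‖y - c‖ ^ 2) + g (1 * ‖y - c'‖ ^ 2), fun x hx hxc => ?_⟩
  have hr : ‖x - c'‖ ^ 2 = ‖x‖ ^ 2 + 2 * t * x 0 + t ^ 2 := by
    rw [hc', norm_sub_single_sq]; ring
  have hrc : ‖x - c‖ ^ 2 = ‖x‖ ^ 2 - 2 * (1 - t ^ 2) * x 0 + (1 - t ^ 2) ^ 2 := by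
    rw [hc, norm_sub_single_sq]
  have hxc2 : ‖x - c‖ ^ 2 ≤ 1 := by nlinarith [norm_nonneg (x - c)]
  have hr1 : t ^ 2 ≤ ‖x - c'‖ ^ 2 := by rw [hr]; nlinarith [mul_nonneg ht.le hx, sq_nonneg ‖x‖]
  have ht2 : 0 < t ^ 2 := by positivity
  have hr0 : 0 < ‖x - c'‖ ^ 2 := ht2.trans_le hr1
  have hnc : ‖c‖ ≤ 1 := by
    rw [hc, PiLp.norm_single, Real.norm_eq_abs, abs_of_nonneg (by nlinarith)]; nlinarith
  have hnc' : ‖c'‖ ≤ 1 := by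
    rw [hc', PiLp.norm_single, Real.norm_eq_abs, abs_neg, abs_of_pos ht]; linarith
  have hr16 : ‖x - c'‖ ^ 2 ≤ 16 := by
    have h1 : ‖x - c'‖ ≤ 4 := by
      calc ‖x - c'‖ = ‖(x - c) + c - c'‖ := by congr 1; abel
        _ ≤ ‖x - c‖ + ‖c‖ + ‖c'‖ := (norm_sub_le _ _).trans (by gcongr; exact norm_add_le _ _)
        _ ≤ 4 := by linarith
    nlinarith [norm_nonneg (x - c')]
  have hgC : ContDiffAt ℝ 2 g (1 * ‖x - c'‖ ^ 2) := by
    refine contDiffAt_const.mul (contDiffAt_const.sub (Real.contDiffAt_log.2 ?_))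
    rw [one_mul]; exact hr0.ne'
  have hφC : ContDiffAt ℝ 2 (fun y => radialFun N (κ * ‖y - c‖ ^ 2)) x :=
    (hF.comp (contDiff_dist_sq κ c)).contDiffAt
  have hGC : ContDiffAt ℝ 2 (fun y => g (1 * ‖y - c'‖ ^ 2)) x :=
    ContDiffAt.comp (g := g) (f := fun y => 1 * ‖y - c'‖ ^ 2) x hgC
      (contDiff_dist_sq 1 c').contDiffAt
  have hκx0 : 0 ≤ κ * ‖x - c‖ ^ 2 := by positivity
  have hκx : κ * ‖x - c‖ ^ 2 ≤ κ := by nlinarith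
  have hφm : m ≤ radialFun N (κ * ‖x - c‖ ^ 2) :=
    hs.antitoneOn ⟨hκx0, hκx.trans hκ.le⟩ ⟨hκ0.le, hκ.le⟩ hκx
  have hG0 : 0 ≤ g (1 * ‖x - c'‖ ^ 2) := by
    simp only [hg, one_mul]
    exact mul_nonneg hA0 (sub_nonneg.2 (Real.log_le_log hr0 hr16))
  have hG1 : g (1 * ‖x - c'‖ ^ 2) ≤ θ * m := by
    refine le_trans ?_ hsmall.le
    simp only [hg, one_mul]
    have : Real.log (t ^ 2) ≤ Real.log (‖x - c'‖ ^ 2) := Real.log_le_log ht2 hr1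
    rw [Real.log_pow] at this
    push_cast at this
    calc A * (Real.log 16 - Real.log (‖x - c'‖ ^ 2)) ≤ A * (Real.log 16 - 2 * Real.log t) := by
          gcongr
      _ = _ := by rw [hA]; ring
  have hw2 : radialFun N (κ * ‖x - c‖ ^ 2) + g (1 * ‖x - c'‖ ^ 2) ≤
      (1 + θ) * radialFun N (κ * ‖x - c‖ ^ 2) := by nlinarith
  refine ⟨hφC.add hGC, by linarith, hw2, ?_, fun hx0 => ?_⟩
  · rw [laplacian_add hφC hGC, laplacian_radialFun one_le_dim, laplacian_radial hgC,
      deriv_deriv_const_mul_sub_log, deriv_const_mul_sub_log]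
    have h1 : 1 * (4 * (1 * ‖x - c'‖ ^ 2) * (A * ((1 * ‖x - c'‖ ^ 2) ^ 2)⁻¹) +
        2 * N * (A * -(1 * ‖x - c'‖ ^ 2)⁻¹)) = -(A * (2 * N - 4) / ‖x - c'‖ ^ 2) := by
      field_simp; ring
    have hN' : (2 : ℝ) ≤ N := by exact_mod_cast hN
    have h2 : 0 ≤ A * (2 * N - 4) / ‖x - c'‖ ^ 2 :=
      div_nonneg (mul_nonneg hA0 (by linarith)) hr0.le
    have h3 : κ / (1 + θ) * (radialFun N (κ * ‖x - c‖ ^ 2) + g (1 * ‖x - c'‖ ^ 2)) ≤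
        κ * radialFun N (κ * ‖x - c‖ ^ 2) := by
      rw [div_mul_eq_mul_div, div_le_iff₀ (by linarith)]
      nlinarith [mul_le_mul_of_nonneg_left hw2 hκ0.le]
    rw [h1]
    linarith
  · rw [pd_add (hφC.differentiableAt (by norm_num)) (hGC.differentiableAt (by norm_num)),
      pd_radial ((hF.differentiable (by norm_num)) _),
      pd_radial (hgC.differentiableAt (by norm_num)),
      deriv_const_mul_sub_log]
    have e1 : c 0 = 1 - t ^ 2 := by simp [hc]
    have e2 : c' 0 = -t := by simp [hc']
    rw [hx0, e1, e2, hr, hx0]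
    rw [hrc, hx0] at hxc2
    have hb := hM (κ * ‖x - c‖ ^ 2) ⟨hκx0, hκx.trans hκ.le⟩
    rw [Real.norm_eq_abs] at hb
    have hb1 := (abs_le.1 hb).1
    have hb2 := (hs.deriv_neg _ hκx0 (hκx.trans hκ.le))
    have q1 : 2 * κ * (0 - (1 - t ^ 2)) * deriv (radialFun N) (κ * ‖x - c‖ ^ 2) ≤ P := by
      have : κ * (1 - t ^ 2) ≤ s₀ * 1 := mul_le_mul hκ.le (by linarith) (by nlinarith) hs0.le
      have h3 : κ * (1 - t ^ 2) * -deriv (radialFun N) (κ * ‖x - c‖ ^ 2) ≤ (s₀ * 1) * M :=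
        mul_le_mul this (by linarith) (by linarith) (by linarith)
      rw [hP]; linarith
    have hD : ‖x‖ ^ 2 + 2 * t * 0 + t ^ 2 ≤ 3 * t ^ 2 := by nlinarith
    have hD0 : 0 < ‖x‖ ^ 2 + 2 * t * 0 + t ^ 2 := by positivity
    have q2 : P ≤ 2 * t * A * (‖x‖ ^ 2 + 2 * t * 0 + t ^ 2)⁻¹ := by
      rw [← div_eq_mul_inv, le_div_iff₀ hD0, hA]
      nlinarith [mul_le_mul_of_nonneg_left hD hP0, mul_nonneg hP0 ht2.le]
    have q3 : 2 * 1 * (0 - -t) * (A * -(1 * (‖x‖ ^ 2 + 2 * t * 0 + t ^ 2))⁻¹) =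
      -(2 * t * A * (‖x‖ ^ 2 + 2 * t * 0 + t ^ 2)⁻¹) := by rw [one_mul]; ring
    rw [q3]; linarith

theorem sq_mul_norm_fderiv_div_sq {N : ℕ} {e w : Sp N → ℝ} {x : Sp N}
    (he : DifferentiableAt ℝ e x) (hw : DifferentiableAt ℝ w x) (h0 : w x ≠ 0) :
    w x ^ 2 * ‖fderiv ℝ (fun y => e y * (w y)⁻¹) x‖ ^ 2 =
      ∑ i, (pd i e x - e x * (pd i w x / w x)) ^ 2 := by
  rw [norm_sq_fderiv, Finset.mul_sum]
  refine Finset.sum_congr rfl fun i _ => ?_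
  have hinv : DifferentiableAt ℝ (fun s : ℝ => s⁻¹) (w x) := differentiableAt_inv h0
  rw [pd_mul (v := fun y => (w y)⁻¹) he (hw.inv h0), pd_comp (g := fun s => s⁻¹) hinv hw, deriv_inv]
  field_simp
  ring

/-- The spectral gap constant in the half ball. -/
def gapConst (N : ℕ) (s₀ : ℝ) : ℝ :=
  radialFun N (s₀ / 4) ^ 2 * (volume (ball (0 : Sp N) (1 / 2))).toReal /
    (128 * (2 ^ N * (volume (ball (0 : Sp N) 1)).toReal))

theorem volume_ball_pos {N : ℕ} (c : Sp N) {r : ℝ} (hr : 0 < r) :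
    0 < (volume (ball c r)).toReal :=
  ENNReal.toReal_pos (measure_ball_pos _ _ hr).ne' measure_ball_lt_top.ne

theorem gapConst_pos {N : ℕ} {s₀ : ℝ} (hs : IsFirstZero N s₀) : 0 < gapConst N s₀ := by
  have h1 := volume_ball_pos (0 : Sp N) (r := 1 / 2) (by norm_num)
  have h2 := volume_ball_pos (0 : Sp N) (r := 1) (by norm_num)
  have hs0 := hs.pos
  have h3 := hs.fun_pos (s₀ / 4) (by positivity) (by linarith)
  rw [gapConst]; positivity

set_option maxHeartbeats 1000000 in
theorem halfSp_gap {N : ℕ} [NeZero N] {s₀ κ θ d : ℝ} (hs : IsFirstZero N s₀)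
    (hκ0 : 0 < κ) (hκ : κ < s₀) (hθ1 : θ ≤ 1) (hd : 1 / 2 ≤ d) {w e : Sp N → ℝ}
    (hw : ∀ x, 0 ≤ x 0 → ‖x - EuclideanSpace.single 0 d‖ ≤ 1 →
      ContDiffAt ℝ 2 w x ∧
      radialFun N (κ * ‖x - EuclideanSpace.single 0 d‖ ^ 2) ≤ w x ∧
      w x ≤ (1 + θ) * radialFun N (κ * ‖x - EuclideanSpace.single 0 d‖ ^ 2) ∧
      ∑ i, pd i (pd i w) x ≤ -(κ / (1 + θ) * w x) ∧ (x 0 = 0 → pd 0 w x ≤ 0))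
    (he : ContDiff ℝ 1 e) (hec : HasCompactSupport e) (hsupp : tsupport e ⊆ pairBalls N d) :
    κ / (1 + θ) * (∫ x in halfSp N, e x ^ 2) ≤ (∫ x in halfSp N, ‖fderiv ℝ e x‖ ^ 2) ∧
    ((∫ x in halfSp N ∩ ball (EuclideanSpace.single 0 d) 1, w x * e x) = 0 →
      (κ / (1 + θ) + gapConst N s₀) * (∫ x in halfSp N, e x ^ 2) ≤
        ∫ x in halfSp N, ‖fderiv ℝ e x‖ ^ 2) := by
  have hs0 := hs.pos
  have hF : ContDiff ℝ 2 (radialFun N) := contDiff_radialFun one_le_dim (n := 2)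
  set c : Sp N := EuclideanSpace.single 0 d with hc
  set φ : Sp N → ℝ := fun x => radialFun N (κ * ‖x - c‖ ^ 2) with hφ
  have hκmem : ∀ x : Sp N, ‖x - c‖ ≤ 1 → κ * ‖x - c‖ ^ 2 ∈ Icc 0 κ := by
    intro x hx
    refine ⟨by positivity, ?_⟩
    have : ‖x - c‖ ^ 2 ≤ 1 := by nlinarith [norm_nonneg (x - c)]
    nlinarith
  have hφpos : ∀ x : Sp N, ‖x - c‖ ≤ 1 → 0 < φ x := fun x hx =>
    hs.fun_pos _ (hκmem x hx).1 ((hκmem x hx).2.trans_lt hκ)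
  have hφ1 : ∀ x : Sp N, ‖x - c‖ ≤ 1 → φ x ≤ 1 := fun x hx => by
    rw [← radialFun_zero N]
    exact hs.antitoneOn ⟨le_rfl, hs0.le⟩ ⟨(hκmem x hx).1, (hκmem x hx).2.trans hκ.le⟩ (hκmem x hx).1
  have hwpos : ∀ x : Sp N, 0 ≤ x 0 → ‖x - c‖ ≤ 1 → 0 < w x := fun x hx hxc =>
    (hφpos x hxc).trans_le (hw x hx hxc).2.1
  have hball : ∀ x ∈ tsupport e, 0 ≤ x 0 → ‖x - c‖ < 1 := fun x hx hx0 =>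
    mem_ball_of_mem_pairBalls (by linarith) hx0 (hsupp hx)
  obtain ⟨iq, hB⟩ := barta_halfSp (Λ := κ / (1 + θ)) (w := w) he hec
    (fun x hx hx0 => (hw x hx0 (hball x hx hx0).le).1)
    (fun x hx hx0 => hwpos x hx0 (hball x hx hx0).le)
    (fun x hx hx0 => (hw x hx0.le (hball x hx hx0.le).le).2.2.2.1)
    (fun x hx hx0 => Or.inr ((hw x hx0.ge (hball x hx hx0.ge).le).2.2.2.2 hx0))
  set q : Sp N → ℝ := fun x => ∑ i, (pd i e x - e x * (pd i w x / w x)) ^ 2 with hqd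
  have hq0 : ∀ x, 0 ≤ q x := fun x => Finset.sum_nonneg fun i _ => sq_nonneg _
  have hqI : 0 ≤ ∫ x in halfSp N, q x := integral_nonneg hq0
  refine ⟨by linarith, fun horth => ?_⟩
  set S := halfSp N ∩ ball c 1 with hS
  have hSo : IsOpen S := isOpen_halfSp.inter isOpen_ball
  have hSm : MeasurableSet S := hSo.measurableSet
  have hSsub : S ⊆ halfSp N := inter_subset_left
  have hS1 : ∀ x ∈ S, 0 ≤ x 0 ∧ ‖x - c‖ ≤ 1 := fun x hx =>
    ⟨le_of_lt hx.1, (mem_ball_iff_norm.1 hx.2).le⟩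
  have hhalfconv : Convex ℝ (halfSp N) := by
    have := convex_halfSpace_gt (𝕜 := ℝ) (f := fun x : Sp N => x 0)
      ⟨fun x y => rfl, fun a x => rfl⟩ 0
    exact this
  have hconv : Convex ℝ S := hhalfconv.inter (convex_ball c 1)
  have hSv : volume S ≠ ⊤ := ((measure_mono inter_subset_right).trans_lt measure_ball_lt_top).ne
  have hSvle : (volume S).toReal ≤ (volume (ball (0 : Sp N) 1)).toReal := by
    refine ENNReal.toReal_mono measure_ball_lt_top.ne ?_
    rw [← Measure.addHaar_ball_center volume c]
    exact measure_mono inter_subset_right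
  set K0 : Set (Sp N) := {x | 0 ≤ x 0} ∩ closedBall c 1 with hK0
  have hK0c : IsCompact K0 := (isCompact_closedBall c 1).inter_left
    (isClosed_le continuous_const (by fun_prop))
  have hSK : S ⊆ K0 := fun x hx => ⟨(hS1 x hx).1, mem_closedBall_iff_norm.2 (hS1 x hx).2⟩
  have hwcont : ContinuousOn w K0 := fun x hx =>
    (hw x hx.1 (mem_closedBall_iff_norm.1 hx.2)).1.continuousAt.continuousWithinAt
  have hint : ∀ f : Sp N → ℝ, ContinuousOn f K0 → IntegrableOn f S := fun f hf =>
    (hf.integrableOn_compact hK0c).mono_set hSK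
  have hwne : ∀ x ∈ S, w x ≠ 0 := fun x hx => (hwpos x (hS1 x hx).1 (hS1 x hx).2).ne'
  have ed : ∀ x, DifferentiableAt ℝ e x := he.differentiable (by norm_num)
  have wC : ∀ x ∈ S, ContDiffAt ℝ 2 w x := fun x hx => (hw x (hS1 x hx).1 (hS1 x hx).2).1
  have E1 : ∀ x ∈ S, w x ^ 2 * (e x * (w x)⁻¹) = w x * e x := fun x hx => by
    have := hwne x hx; field_simp
  have E2 : ∀ x ∈ S, w x ^ 2 * (e x * (w x)⁻¹) ^ 2 = e x ^ 2 := fun x hx => by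
    have := hwne x hx; field_simp
  have E3 : ∀ x ∈ S, w x ^ 2 * ‖fderiv ℝ (fun y => e y * (w y)⁻¹) x‖ ^ 2 = q x := fun x hx =>
    sq_mul_norm_fderiv_div_sq (ed x) ((wC x hx).differentiableAt (by norm_num)) (hwne x hx)
  have i0 : IntegrableOn (fun x => w x ^ 2) S := hint _ (hwcont.pow 2)
  have iqS : IntegrableOn q S := iq.mono_set hSsub
  have hWP := weighted_poincare (D := 2) (K := 16) (h := fun y => e y * (w y)⁻¹) hSo hconv hSv
    (fun x hx y hy => by
      have h1 := (hS1 x hx).2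
      have h2 := (hS1 y hy).2
      calc ‖y - x‖ = ‖(y - c) - (x - c)‖ := by congr 1; abel
        _ ≤ ‖y - c‖ + ‖x - c‖ := norm_sub_le _ _
        _ ≤ 2 := by linarith)
    (hwcont.mono hSK)
    (fun x hx => he.contDiffAt.mul (((wC x hx).of_le (by norm_num)).inv (hwne x hx)))
    (by norm_num)
    (fun x hx y hy z hz => by
      have hzS := hconv.segment_subset hx hy hz
      obtain ⟨x0, xc⟩ := hS1 x hx
      obtain ⟨y0, yc⟩ := hS1 y hy
      obtain ⟨z0, zc⟩ := hS1 z hzS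
      have hmax : ‖z - c‖ ≤ max ‖x - c‖ ‖y - c‖ := by
        have := (convexOn_dist c (convex_univ (𝕜 := ℝ) (E := Sp N))).le_max_of_mem_segment
          (mem_univ x) (mem_univ y) hz
        simpa [dist_eq_norm] using this
      have hmin : min (φ x) (φ y) ≤ φ z := by
        have anti : ∀ a : Sp N, ‖a - c‖ ≤ 1 → ‖z - c‖ ≤ ‖a - c‖ → φ a ≤ φ z := fun a ha h =>
          hs.antitoneOn ⟨(hκmem z zc).1, (hκmem z zc).2.trans hκ.le⟩
            ⟨(hκmem a ha).1, (hκmem a ha).2.trans hκ.le⟩ (by gcongr)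
        rcases le_max_iff.1 hmax with h | h
        · exact (min_le_left _ _).trans (anti x xc h)
        · exact (min_le_right _ _).trans (anti y yc h)
      have hprod : φ x * φ y ≤ φ z := by
        refine le_trans ?_ hmin
        refine le_min ?_ ?_
        · nlinarith [hφpos x xc, hφ1 y yc]
        · nlinarith [hφpos y yc, hφ1 x xc]
      have wx : w x ≤ 2 * φ x := (hw x x0 xc).2.2.1.trans (by nlinarith [hφpos x xc])
      have wy : w y ≤ 2 * φ y := (hw y y0 yc).2.2.1.trans (by nlinarith [hφpos y yc])
      have wz : φ z ≤ w z := (hw z z0 zc).2.1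
      have hxy : w x * w y ≤ 4 * w z := by
        calc w x * w y ≤ (2 * φ x) * (2 * φ y) :=
              mul_le_mul wx wy (hwpos y y0 yc).le (by linarith [hφpos x xc])
          _ = 4 * (φ x * φ y) := by ring
          _ ≤ 4 * w z := by linarith
      have := mul_pos (hwpos x x0 xc) (hwpos y y0 yc)
      calc w x ^ 2 * w y ^ 2 = (w x * w y) ^ 2 := by ring
        _ ≤ (4 * w z) ^ 2 := by gcongr
        _ = 16 * w z ^ 2 := by ring)
    i0
    ((hint _ (hwcont.mul he.continuous.continuousOn)).congr_fun (fun x hx => (E1 x hx).symm) hSm)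
    ((hint _ (he.continuous.continuousOn.pow 2)).congr_fun (fun x hx => (E2 x hx).symm) hSm)
    (iqS.congr_fun (fun x hx => (E3 x hx).symm) hSm)
  rw [setIntegral_congr_fun hSm E1, setIntegral_congr_fun hSm E2, setIntegral_congr_fun hSm E3,
    horth] at hWP
  have hqS : ∫ x in S, q x ≤ ∫ x in halfSp N, q x :=
    setIntegral_mono_set iq (Eventually.of_forall hq0) hSsub.eventuallyLE
  have heS : ∫ x in S, e x ^ 2 = ∫ x in halfSp N, e x ^ 2 := by
    refine (setIntegral_eq_of_subset_of_forall_sdiff_eq_zero measurableSet_halfSp hSsub ?_).symm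
    intro x hx
    have : x ∉ tsupport e := fun h => hx.2 ⟨hx.1, mem_ball_iff_norm.2 (hball x h (le_of_lt hx.1))⟩
    rw [image_eq_zero_of_notMem_tsupport this]; norm_num
  have hWlow : radialFun N (s₀ / 4) ^ 2 * (volume (ball (0 : Sp N) (1 / 2))).toReal ≤
      ∫ x in S, w x ^ 2 := by
    have hsub : ball c (1 / 2) ⊆ S := by
      intro x hx
      rw [mem_ball_iff_norm] at hx
      refine ⟨?_, by rw [mem_ball_iff_norm]; linarith⟩
      have h1 : |(x - c) 0| ≤ ‖x - c‖ := PiLp.norm_apply_le (x - c) 0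
      have h2 : (x - c) 0 = x 0 - d := by simp [hc]
      rw [h2] at h1
      have := (abs_le.1 h1).1
      change 0 < x 0
      linarith
    have h3 : ∫ x in ball c (1 / 2), w x ^ 2 ≤ ∫ x in S, w x ^ 2 :=
      setIntegral_mono_set i0 (Eventually.of_forall fun x => sq_nonneg _) hsub.eventuallyLE
    refine le_trans ?_ h3
    rw [← Measure.addHaar_ball_center volume c]
    have h4 : ∫ x in ball c (1 / 2), radialFun N (s₀ / 4) ^ 2 ≤ ∫ x in ball c (1 / 2), w x ^ 2 := by
      refine setIntegral_mono_on (integrableOn_const measure_ball_lt_top.ne) (i0.mono_set hsub)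
        measurableSet_ball fun x hx => ?_
      have hx' := hS1 x (hsub hx)
      rw [mem_ball_iff_norm] at hx
      have hpos := hs.fun_pos (s₀ / 4) (by positivity) (by linarith)
      have hle : radialFun N (s₀ / 4) ≤ φ x := by
        refine hs.antitoneOn ⟨(hκmem x hx'.2).1, (hκmem x hx'.2).2.trans hκ.le⟩
          ⟨by positivity, by linarith⟩ ?_
        have : ‖x - c‖ ^ 2 ≤ 1 / 4 := by nlinarith [norm_nonneg (x - c)]
        calc κ * ‖x - c‖ ^ 2 ≤ s₀ * (1 / 4) := by gcongr
          _ = s₀ / 4 := by ring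
      have := hle.trans (hw x hx'.1 hx'.2).2.1
      gcongr
    rw [setIntegral_const, smul_eq_mul] at h4
    rw [mul_comm]; exact h4
  have hE0 : 0 ≤ ∫ x in halfSp N, e x ^ 2 := integral_nonneg fun x => sq_nonneg _
  rw [heS] at hWP
  have hω := volume_ball_pos (0 : Sp N) (r := 1) (by norm_num)
  have hfin : gapConst N s₀ * (∫ x in halfSp N, e x ^ 2) ≤ ∫ x in halfSp N, q x := by
    rw [gapConst, div_mul_eq_mul_div, div_le_iff₀ (by positivity)]
    have hqS0 : 0 ≤ ∫ x in S, q x := integral_nonneg hq0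
    calc _ ≤ (∫ x in S, w x ^ 2) * ∫ x in halfSp N, e x ^ 2 := by gcongr
      _ ≤ 2 * (16 * 2 ^ 2) * (2 ^ N * (volume S).toReal) * ∫ x in S, q x := by linarith
      _ ≤ 2 * (16 * 2 ^ 2) * (2 ^ N * (volume (ball (0 : Sp N) 1)).toReal) *
          ∫ x in halfSp N, q x := by gcongr
      _ = _ := by ring
  rw [add_mul]
  linarith

theorem volume_box_le {N : ℕ} [NeZero N] {a r : ℝ} (ha : 0 ≤ a) (hr : 0 ≤ r) :
    volume {x : Sp N | |x 0| ≤ a ∧ ∀ i, |x i| ≤ r} ≤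
      ENNReal.ofReal (2 * a * (2 * r) ^ (N - 1)) := by
  set b : Fin N → ℝ := fun i => if i = 0 then a else r with hb
  have hsub : {x : Sp N | |x 0| ≤ a ∧ ∀ i, |x i| ≤ r} ⊆
      (WithLp.ofLp : Sp N → (Fin N → ℝ)) ⁻¹' Icc (fun i => -b i) b := by
    rintro x ⟨h0, h⟩
    constructor <;> intro i <;> by_cases hi : i = 0
    · subst hi; simpa [hb] using (abs_le.1 h0).1
    · simpa [hb, hi] using (abs_le.1 (h i)).1
    · subst hi; simpa [hb] using (abs_le.1 h0).2
    · simpa [hb, hi] using (abs_le.1 (h i)).2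
  refine (measure_mono hsub).trans ?_
  rw [(PiLp.volume_preserving_ofLp (Fin N)).measure_preimage measurableSet_Icc.nullMeasurableSet,
    Real.volume_Icc_pi, ← ENNReal.ofReal_prod_of_nonneg,
      ← Finset.mul_prod_erase _ _ (Finset.mem_univ 0)]
  · have : ∏ i ∈ Finset.univ.erase (0 : Fin N), (b i - -b i) = (2 * r) ^ (N - 1) := by
      rw [Finset.prod_congr rfl (g := fun _ => 2 * r), Finset.prod_const,
        Finset.card_erase_of_mem (Finset.mem_univ _), Finset.card_univ, Fintype.card_fin]
      intro i hi
      simp only [hb, if_neg (Finset.ne_of_mem_erase hi)]; ring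
    rw [this]
    refine ENNReal.ofReal_le_ofReal (le_of_eq ?_)
    simp only [hb, if_pos]; ring
  · intro i _
    have : 0 ≤ b i := by simp only [hb]; split_ifs <;> assumption
    linarith

theorem volume_shell_le {N : ℕ} [NeZero N] (c : Sp N) {η : ℝ} (h0 : 0 ≤ η) (h1 : η < 1) :
    volume (ball c 1 \ ball c (1 - η)) ≤
      ENNReal.ofReal (N * η * (volume (ball (0 : Sp N) 1)).toReal) := by
  rw [measure_sdiff (ball_subset_ball (by linarith)) measurableSet_ball.nullMeasurableSet
    measure_ball_lt_top.ne, Measure.addHaar_ball_center volume c 1,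
    Measure.addHaar_ball volume c (by linarith)]
  set ω := (volume (ball (0 : Sp N) 1)) with hω
  have hωt : ω ≠ ⊤ := measure_ball_lt_top.ne
  nth_rewrite 1 [← ENNReal.ofReal_toReal hωt]
  nth_rewrite 2 [← ENNReal.ofReal_toReal hωt]
  have hp : 0 ≤ (1 - η) ^ Module.finrank ℝ (Sp N) := pow_nonneg (by linarith) _
  rw [← ENNReal.ofReal_mul hp, ← ENNReal.ofReal_sub _ (by positivity)]
  refine ENNReal.ofReal_le_ofReal ?_
  rw [finrank_euclideanSpace_fin]
  have hB := one_add_mul_le_pow (a := -η) (by linarith) N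
  have : 0 ≤ ω.toReal := ENNReal.toReal_nonneg
  rw [← sub_eq_add_neg] at hB
  nlinarith [mul_le_mul_of_nonneg_right hB this]

theorem pd_smul_const {N : ℕ} (a : ℝ) {u : Sp N → ℝ} {x : Sp N} (i : Fin N)
    (hu : DifferentiableAt ℝ u x) : pd i (fun y => a * u y) x = a * pd i u x := by
  simp only [pd]; rw [fderiv_const_mul hu]; rfl

/-- Ground state substitution. -/
theorem ground_state {N : ℕ} {φ h : Sp N → ℝ} {Λ : ℝ} (hφ : ContDiff ℝ 2 φ) (hh : ContDiff ℝ 1 h)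
    (hc : HasCompactSupport h) (hΔ : ∀ x, ∑ i, pd i (pd i φ) x = -(Λ * φ x)) :
    ∫ x, ‖fderiv ℝ (fun y => φ y * h y) x‖ ^ 2 =
      Λ * (∫ x, (φ x * h x) ^ 2) + ∫ x, φ x ^ 2 * ‖fderiv ℝ h x‖ ^ 2 := by
  have hφ1 : ContDiff ℝ 1 φ := hφ.of_le (by norm_num)
  have hpd : ∀ i, ContDiff ℝ 1 (pd i φ) := fun i => contDiff_iff_contDiffAt.2 fun x =>
    contDiffAt_pd hφ.contDiffAt (by norm_num) i
  have hV : ∀ i, ContDiff ℝ 1 (fun y => h y * (h y * (φ y * pd i φ y))) := fun i =>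
    hh.mul (hh.mul (hφ1.mul (hpd i)))
  have hVc : ∀ i, HasCompactSupport (fun y => h y * (h y * (φ y * pd i φ y))) := fun i =>
    hc.mul_right
  have key : ∀ x, ‖fderiv ℝ (fun y => φ y * h y) x‖ ^ 2 = Λ * (φ x * h x) ^ 2 +
      φ x ^ 2 * ‖fderiv ℝ h x‖ ^ 2 + ∑ i, pd i (fun y => h y * (h y * (φ y * pd i φ y))) x := by
    intro x
    have dφ := (hφ1.differentiable (by norm_num)) x
    have dh := (hh.differentiable (by norm_num)) x
    have dp := fun i => ((hpd i).differentiable (by norm_num)) x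
    rw [norm_sq_fderiv, norm_sq_fderiv]
    have e1 : ∀ i, pd i (fun y => h y * (h y * (φ y * pd i φ y))) x =
        h x ^ 2 * (pd i φ x) ^ 2 + 2 * h x * φ x * pd i h x * pd i φ x +
          h x ^ 2 * φ x * pd i (pd i φ) x := by
      intro i
      rw [pd_mul (v := fun y => h y * (φ y * pd i φ y)) dh (dh.mul (dφ.mul (dp i))),
        pd_mul (v := fun y => φ y * pd i φ y) dh (dφ.mul (dp i)), pd_mul dφ (dp i)]
      ring
    have e2 : h x ^ 2 * φ x * ∑ i, pd i (pd i φ) x = -(Λ * (φ x * h x) ^ 2) := by rw [hΔ]; ring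
    simp only [e1, pd_mul dφ dh]
    have e3 : ∑ i, (φ x * pd i h x + pd i φ x * h x) ^ 2 = φ x ^ 2 * (∑ i, (pd i h x) ^ 2) +
        ∑ i, (h x ^ 2 * (pd i φ x) ^ 2 + 2 * h x * φ x * pd i h x * pd i φ x) := by
      rw [Finset.mul_sum, ← Finset.sum_add_distrib]
      exact Finset.sum_congr rfl fun i _ => by ring
    rw [e3, Finset.sum_add_distrib (g := fun i => h x ^ 2 * φ x * pd i (pd i φ) x),
        ← Finset.mul_sum, e2]
    ring
  have i1 : Integrable (fun x => Λ * (φ x * h x) ^ 2) :=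
    (integrable_sq (hφ1.mul hh).continuous hc.mul_left).const_mul Λ
  have i2 : Integrable (fun x => φ x ^ 2 * ‖fderiv ℝ h x‖ ^ 2) := by
    refine Continuous.integrable_of_hasCompactSupport ?_ ?_
    · exact (hφ.continuous.pow 2).mul ((hh.continuous_fderiv (by norm_num)).norm.pow 2)
    · refine HasCompactSupport.mul_left ?_
      exact (hc.fderiv (𝕜 := ℝ)).comp_left (g := fun T => ‖T‖ ^ 2) (by simp)
  have i3 : ∀ i, Integrable (fun x => pd i (fun y => h y * (h y * (φ y * pd i φ y))) x) := fun i =>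
    (continuous_pd (hV i) i).integrable_of_hasCompactSupport (hasCompactSupport_pd (hVc i) i)
  simp only [key]
  rw [integral_add (f := fun x => Λ * (φ x * h x) ^ 2 + φ x ^ 2 * ‖fderiv ℝ h x‖ ^ 2) (i1.add i2)
    (integrable_finsetSum _ fun i _ => i3 i),
    integral_add i1 i2, integral_finsetSum _ fun i _ => i3 i, integral_const_mul,
    Finset.sum_eq_zero fun i _ => integral_pd_eq_zero (hV i) (hVc i) i, add_zero]

/-- A radial cutoff near the unit sphere, as a function of the squared distance. -/
def shellCut (δ r : ℝ) : ℝ := Real.smoothTransition (δ⁻¹ * (1 - r) - 1)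

theorem contDiff_shellCut (δ : ℝ) {n : ℕ∞} : ContDiff ℝ n (shellCut δ) := by
  unfold shellCut
  exact Real.smoothTransition.contDiff.comp (by fun_prop)

theorem deriv_shellCut (δ r : ℝ) :
    deriv (shellCut δ) r = deriv Real.smoothTransition (δ⁻¹ * (1 - r) - 1) * -δ⁻¹ := by
  have h1 : HasDerivAt (fun r : ℝ => δ⁻¹ * (1 - r) - 1) (-δ⁻¹) r := by
    have := (((hasDerivAt_id r).const_sub 1).const_mul δ⁻¹).sub_const 1
    exact this.congr_deriv (by simp)
  have h2 : DifferentiableAt ℝ Real.smoothTransition (δ⁻¹ * (1 - r) - 1) :=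
    (Real.smoothTransition.contDiff (n := 1)).differentiable (by norm_num) _
  exact (h2.hasDerivAt.comp r h1).deriv

/-- The cutoff factor of the trial function. -/
def bulkCut {N : ℕ} [NeZero N] (t δ : ℝ) (c : Sp N) (x : Sp N) : ℝ :=
  axialCut (t ^ 2)⁻¹ 1 x * shellCut δ (1 * ‖x - c‖ ^ 2)

/-- The truncated ground state of the unit ball centred at `c`. -/
def trialFun {N : ℕ} [NeZero N] (s₀ t δ : ℝ) (c : Sp N) (x : Sp N) : ℝ :=
  radialFun N (s₀ * ‖x - c‖ ^ 2) * bulkCut t δ c x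

section
variable {N : ℕ} [NeZero N] {s₀ t δ : ℝ} {c : Sp N}

theorem contDiff_bulkCut {n : ℕ∞} : ContDiff ℝ n (bulkCut t δ c) :=
  (contDiff_axialCut _ _).mul ((contDiff_shellCut δ).comp (contDiff_dist_sq 1 c))

theorem contDiff_trialFun {n : ℕ∞} : ContDiff ℝ n (trialFun s₀ t δ c) :=
  ((contDiff_radialFun one_le_dim).comp (contDiff_dist_sq s₀ c)).mul contDiff_bulkCut

theorem bulkCut_nonneg (x : Sp N) : 0 ≤ bulkCut t δ c x :=
  mul_nonneg (Real.smoothTransition.nonneg _) (Real.smoothTransition.nonneg _)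

theorem bulkCut_le_one (x : Sp N) : bulkCut t δ c x ≤ 1 :=
  mul_le_one₀ (Real.smoothTransition.le_one _) (Real.smoothTransition.nonneg _)
    (Real.smoothTransition.le_one _)

theorem tsupport_bulkCut (ht : 0 < t) (hδ : 0 < δ) :
    tsupport (bulkCut t δ c) ⊆ {x | t ^ 2 ≤ x 0} ∩ {x | ‖x - c‖ ^ 2 ≤ 1 - δ} := by
  have hcl : IsClosed ({x : Sp N | t ^ 2 ≤ x 0} ∩ {x | ‖x - c‖ ^ 2 ≤ 1 - δ}) :=
    (isClosed_le continuous_const (by fun_prop)).inter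
      (isClosed_le (by fun_prop) continuous_const)
  refine closure_minimal (fun x hx => ?_) hcl
  by_contra h
  refine hx ?_
  have ht2 : 0 < t ^ 2 := by positivity
  rw [mem_inter_iff, not_and_or] at h
  rcases h with h | h
  · have h' : x 0 < t ^ 2 := not_le.1 h
    have : axialCut (t ^ 2)⁻¹ 1 x = 0 := by
      refine Real.smoothTransition.zero_of_nonpos ?_
      have : (t ^ 2)⁻¹ * x 0 ≤ 1 := by rw [inv_mul_le_iff₀ ht2]; linarith
      linarith
    simp [bulkCut, this]
  · have h' : 1 - δ < ‖x - c‖ ^ 2 := not_le.1 h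
    have : shellCut δ (1 * ‖x - c‖ ^ 2) = 0 := by
      refine Real.smoothTransition.zero_of_nonpos ?_
      have : δ⁻¹ * (1 - 1 * ‖x - c‖ ^ 2) ≤ 1 := by rw [inv_mul_le_iff₀ hδ]; linarith
      linarith
    rw [bulkCut, this, mul_zero]

theorem bulkCut_eq_one (ht : 0 < t) (hδ : 0 < δ) {x : Sp N} (h1 : 2 * t ^ 2 ≤ x 0)
    (h2 : ‖x - c‖ ^ 2 ≤ 1 - 2 * δ) : bulkCut t δ c x = 1 := by
  have ht2 : 0 < t ^ 2 := by positivity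
  have e1 : axialCut (t ^ 2)⁻¹ 1 x = 1 := by
    refine Real.smoothTransition.one_of_one_le ?_
    have : 2 ≤ (t ^ 2)⁻¹ * x 0 := by rw [le_inv_mul_iff₀ ht2]; linarith
    linarith
  have e2 : shellCut δ (1 * ‖x - c‖ ^ 2) = 1 := by
    refine Real.smoothTransition.one_of_one_le ?_
    have : 2 ≤ δ⁻¹ * (1 - 1 * ‖x - c‖ ^ 2) := by rw [le_inv_mul_iff₀ hδ]; linarith
    linarith
  rw [bulkCut, e1, e2, one_mul]

theorem hasCompactSupport_bulkCut (ht : 0 < t) (hδ : 0 < δ) :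
    HasCompactSupport (bulkCut t δ c) := by
  refine (isCompact_closedBall c 1).of_isClosed_subset (isClosed_tsupport _) fun x hx => ?_
  have := (tsupport_bulkCut ht hδ hx).2
  have h2 : ‖x - c‖ ^ 2 ≤ 1 - δ := this
  rw [mem_closedBall_iff_norm]
  nlinarith [norm_nonneg (x - c)]

theorem tsupport_trialFun (ht : 0 < t) (hδ : 0 < δ) :
    tsupport (trialFun s₀ t δ c) ⊆ {x | t ^ 2 ≤ x 0} ∩ {x | ‖x - c‖ ^ 2 ≤ 1 - δ} :=
  (tsupport_mul_subset_right).trans (tsupport_bulkCut ht hδ)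

theorem hasCompactSupport_trialFun (ht : 0 < t) (hδ : 0 < δ) :
    HasCompactSupport (trialFun s₀ t δ c) := (hasCompactSupport_bulkCut ht hδ).mul_left

theorem trialFun_eq_zero (ht : 0 < t) (hδ : 0 < δ) {x : Sp N}
    (h : x 0 < t ^ 2 ∨ 1 - δ < ‖x - c‖ ^ 2) :
    trialFun s₀ t δ c x = 0 := by
  refine image_eq_zero_of_notMem_tsupport fun hx => ?_
  obtain ⟨h1, h2⟩ := tsupport_trialFun ht hδ hx
  rcases h with h | h
  · exact absurd h1 (not_le.2 h)
  · exact absurd h2 (not_le.2 h)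

theorem radial_mem_Icc (hs : IsFirstZero N s₀) {r : ℝ} (h0 : 0 ≤ r) (h1 : r ≤ 1) :
    0 ≤ radialFun N (s₀ * r) ∧ radialFun N (s₀ * r) ≤ 1 := by
  have hs0 := hs.pos
  have hm : s₀ * r ∈ Icc 0 s₀ := ⟨by positivity, by nlinarith⟩
  constructor
  · rw [← hs.eq_zero]; exact hs.antitoneOn hm ⟨hs0.le, le_rfl⟩ hm.2
  · rw [← radialFun_zero N]; exact hs.antitoneOn ⟨le_rfl, hs0.le⟩ hm hm.1

theorem trialFun_mem_Icc (hs : IsFirstZero N s₀) (ht : 0 < t) (hδ : 0 < δ) (x : Sp N) :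
    0 ≤ trialFun s₀ t δ c x ∧ trialFun s₀ t δ c x ≤ 1 := by
  by_cases h : 1 - δ < ‖x - c‖ ^ 2
  · rw [trialFun_eq_zero ht hδ (Or.inr h)]; norm_num
  · obtain ⟨h1, h2⟩ := radial_mem_Icc hs (sq_nonneg ‖x - c‖) (by linarith)
    exact ⟨mul_nonneg h1 (bulkCut_nonneg x), mul_le_one₀ h2 (bulkCut_nonneg x) (bulkCut_le_one x)⟩

theorem exists_radial_lipschitz (hs : IsFirstZero N s₀) :
    ∃ L, 0 ≤ L ∧ ∀ r, 0 ≤ r → r ≤ 1 → radialFun N (s₀ * r) ≤ L * (1 - r) := by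
  have hF : ContDiff ℝ 2 (radialFun N) := contDiff_radialFun one_le_dim (n := 2)
  have hs0 := hs.pos
  obtain ⟨M, hM⟩ := isCompact_Icc.exists_bound_of_continuousOn (s := Icc (0 : ℝ) s₀)
    (hF.continuous_deriv (by norm_num)).continuousOn
  have hM0 : 0 ≤ M := (norm_nonneg _).trans (hM 0 ⟨le_rfl, hs0.le⟩)
  refine ⟨M * s₀, by positivity, fun r h0 h1 => ?_⟩
  have := (convex_Icc (0 : ℝ) s₀).norm_image_sub_le_of_norm_deriv_le (f := radialFun N)
    (fun x _ => (hF.differentiable (by norm_num)) x) hM ⟨hs0.le, le_rfl⟩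
    (y := s₀ * r) ⟨by positivity, by nlinarith⟩
  rw [hs.eq_zero, sub_zero, Real.norm_eq_abs, Real.norm_eq_abs,
    abs_of_nonpos (a := s₀ * r - s₀) (by nlinarith)] at this
  calc _ ≤ _ := (le_abs_self _).trans this
    _ = _ := by ring

theorem neck_bounds {d : ℝ} (ht : t ≤ 1 / 4) (ht0 : 0 < t) (hd1 : 1 - t ^ 2 ≤ d) (hd4 : d ≤ 4)
    {x : Sp N} (hx : x 0 ≤ 2 * t ^ 2) (hr : ‖x - EuclideanSpace.single 0 d‖ ^ 2 ≤ 1) :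
    1 - ‖x - EuclideanSpace.single 0 d‖ ^ 2 ≤ 18 * t ^ 2 ∧ ‖x‖ ^ 2 ≤ 18 * t ^ 2 := by
  have ht2 : t ^ 2 ≤ 1 / 16 := by nlinarith
  have hd0 : 0 ≤ d := by linarith
  have h1 : 1 - d ^ 2 ≤ 2 * t ^ 2 := by nlinarith [sq_nonneg (t ^ 2)]
  have h2 : 2 * d * x 0 ≤ 16 * t ^ 2 := by nlinarith [mul_le_mul_of_nonneg_left hx hd0]
  rw [norm_sub_single_sq] at hr ⊢
  constructor <;> nlinarith [sq_nonneg ‖x‖]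

set_option maxHeartbeats 1000000 in
theorem exists_energy_bound (hs : IsFirstZero N s₀) : ∃ C, 0 ≤ C ∧ ∀ t δ d : ℝ, 0 < t → t ≤ 1 / 4 →
    0 < δ → δ ≤ 1 / 8 → 1 - t ^ 2 ≤ d → d ≤ 4 →
    ∫ x, ‖fderiv ℝ (trialFun (N := N) s₀ t δ (EuclideanSpace.single 0 d)) x‖ ^ 2 ≤
      s₀ * (∫ x, trialFun (N := N) s₀ t δ (EuclideanSpace.single 0 d) x ^ 2) +
        C * (t ^ (N + 1) + δ) := by
  obtain ⟨L, hL0, hL⟩ := exists_radial_lipschitz hs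
  obtain ⟨M, hM0, hM⟩ := bounded_deriv_smoothTransition
  set ω := (volume (ball (0 : Sp N) 1)).toReal with hω
  have hω0 : 0 ≤ ω := ENNReal.toReal_nonneg
  set C1 := 2 * (18 * L * M) ^ 2 + 2 * (4 * L * M) ^ 2 with hC1
  refine ⟨C1 * (4 * 10 ^ (N - 1) + N * 2 * ω), by positivity, fun t δ d ht ht4 hδ hδ8 hd1 hd4 => ?_⟩
  set c : Sp N := EuclideanSpace.single 0 d with hc
  have hF : ContDiff ℝ 2 (radialFun N) := contDiff_radialFun one_le_dim (n := 2)
  have hh : ContDiff ℝ 1 (bulkCut t δ c) := contDiff_bulkCut (n := 1)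
  have hgs := ground_state (φ := fun x => radialFun N (s₀ * ‖x - c‖ ^ 2)) (h := bulkCut t δ c)
      (Λ := s₀)
    (hF.comp (contDiff_dist_sq s₀ c)) hh (hasCompactSupport_bulkCut ht hδ)
    (fun x => laplacian_radialFun one_le_dim s₀ c x)
  have hgs' : ∫ x, ‖fderiv ℝ (trialFun (N := N) s₀ t δ c) x‖ ^ 2 =
      s₀ * (∫ x, trialFun (N := N) s₀ t δ c x ^ 2) +
      ∫ x, radialFun N (s₀ * ‖x - c‖ ^ 2) ^ 2 * ‖fderiv ℝ (bulkCut t δ c) x‖ ^ 2 := hgs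
  rw [hgs']
  refine add_le_add le_rfl ?_
  have ht2 : 0 < t ^ 2 := by positivity
  set A : Set (Sp N) := {x | |x 0| ≤ 2 * t ^ 2 ∧ ∀ i, |x i| ≤ 5 * t} with hA
  set Sh : Set (Sp N) := ball c 1 \ ball c (1 - 2 * δ) with hSh
  set k : Sp N → ℝ := fun x => radialFun N (s₀ * ‖x - c‖ ^ 2) ^ 2 * ‖fderiv ℝ (bulkCut t δ c) x‖ ^ 2
    with hk
  have hpdξ : ∀ x : Sp N, ∑ i, (pd i (axialCut (t ^ 2)⁻¹ 1) x) ^ 2 =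
      (deriv Real.smoothTransition ((t ^ 2)⁻¹ * x 0 - 1) * (t ^ 2)⁻¹) ^ 2 := by
    intro x
    rw [Finset.sum_eq_single 0]
    · rw [pd_axialCut, if_pos rfl]
    · intro i _ hi; rw [pd_axialCut, if_neg hi]; ring
    · intro h; exact absurd (Finset.mem_univ _) h
  have hpdχ : ∀ x : Sp N, ∑ i, (pd i (fun y => shellCut δ (1 * ‖y - c‖ ^ 2)) x) ^ 2 =
      4 * ‖x - c‖ ^ 2 * (deriv Real.smoothTransition (δ⁻¹ * (1 - ‖x - c‖ ^ 2) - 1) * δ⁻¹) ^ 2 := by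
    intro x
    have : ∀ i, pd i (fun y => shellCut δ (1 * ‖y - c‖ ^ 2)) x =
        2 * (deriv Real.smoothTransition (δ⁻¹ * (1 - ‖x - c‖ ^ 2) - 1) * -δ⁻¹) * (x - c) i := by
      intro i
      rw [pd_radial (((contDiff_shellCut δ (n := 1)).differentiable (by norm_num)) _),
          deriv_shellCut,
        one_mul, PiLp.sub_apply]
      ring
    simp only [this, mul_pow]
    rw [← Finset.mul_sum, ← EuclideanSpace.real_norm_sq_eq]
    ring
  have hgrad : ∀ x : Sp N, ‖fderiv ℝ (bulkCut t δ c) x‖ ^ 2 ≤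
      2 * (deriv Real.smoothTransition ((t ^ 2)⁻¹ * x 0 - 1) * (t ^ 2)⁻¹) ^ 2 +
      2 * (4 * ‖x - c‖ ^ 2 *
        (deriv Real.smoothTransition (δ⁻¹ * (1 - ‖x - c‖ ^ 2) - 1) * δ⁻¹) ^ 2) := by
    intro x
    rw [norm_sq_fderiv, ← hpdξ, ← hpdχ, Finset.mul_sum, Finset.mul_sum, ← Finset.sum_add_distrib]
    refine Finset.sum_le_sum fun i _ => ?_
    have e : pd i (bulkCut t δ c) x = axialCut (t ^ 2)⁻¹ 1 x *
        pd i (fun y => shellCut δ (1 * ‖y - c‖ ^ 2)) x +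
        pd i (axialCut (t ^ 2)⁻¹ 1) x * shellCut δ (1 * ‖x - c‖ ^ 2) :=
      pd_mul (((contDiff_axialCut _ _ (n := 1)).differentiable (by norm_num)) x)
        ((((contDiff_shellCut δ (n := 1)).comp (contDiff_dist_sq 1 c)).differentiable
          (by norm_num)) x) i
    rw [e]
    set a := axialCut (t ^ 2)⁻¹ 1 x
    set b := shellCut δ (1 * ‖x - c‖ ^ 2)
    have a0 : 0 ≤ a := Real.smoothTransition.nonneg _
    have a1 : a ≤ 1 := Real.smoothTransition.le_one _
    have b0 : 0 ≤ b := Real.smoothTransition.nonneg _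
    have b1 : b ≤ 1 := Real.smoothTransition.le_one _
    set p := pd i (fun y => shellCut δ (1 * ‖y - c‖ ^ 2)) x
    set q := pd i (axialCut (t ^ 2)⁻¹ 1) x
    have h1 : (a * p) ^ 2 ≤ p ^ 2 := by
      rw [mul_pow]; exact mul_le_of_le_one_left (sq_nonneg _) (by nlinarith)
    have h2 : (q * b) ^ 2 ≤ q ^ 2 := by
      rw [mul_pow]; exact mul_le_of_le_one_right (sq_nonneg _) (by nlinarith)
    nlinarith [sq_nonneg (a * p - q * b)]
  have hout : ∀ x, x ∉ tsupport (bulkCut t δ c) → k x = 0 := by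
    intro x hx
    simp only [hk, norm_sq_fderiv, pd_eq_zero_of_notMem hx]
    simp
  have hpt : ∀ x, k x ≤ C1 ∧ (x ∉ A ∪ Sh → k x = 0) := by
    intro x
    by_cases hx : x ∈ tsupport (bulkCut t δ c)
    swap
    · exact ⟨by rw [hout x hx]; positivity, fun _ => hout x hx⟩
    obtain ⟨hx0, hxr⟩ := tsupport_bulkCut ht hδ hx
    have hx0' : t ^ 2 ≤ x 0 := hx0
    have hxr' : ‖x - c‖ ^ 2 ≤ 1 - δ := hxr
    have hr1 : ‖x - c‖ ^ 2 ≤ 1 := by linarith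
    have hφ := hL _ (sq_nonneg ‖x - c‖) hr1
    have hφ0 := (radial_mem_Icc hs (sq_nonneg ‖x - c‖) hr1).1
    set φ := radialFun N (s₀ * ‖x - c‖ ^ 2) with hφd
    set D1 := deriv Real.smoothTransition ((t ^ 2)⁻¹ * x 0 - 1) with hD1
    set D2 := deriv Real.smoothTransition (δ⁻¹ * (1 - ‖x - c‖ ^ 2) - 1) with hD2
    have z1 : 2 * t ^ 2 < x 0 → D1 = 0 := fun h => by
      refine deriv_smoothTransition_eq_zero (Or.inr ?_)
      have : 2 ≤ (t ^ 2)⁻¹ * x 0 := by rw [le_inv_mul_iff₀ ht2]; linarith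
      linarith
    have z2 : ‖x - c‖ ^ 2 < 1 - 2 * δ → D2 = 0 := fun h => by
      refine deriv_smoothTransition_eq_zero (Or.inr ?_)
      have : 2 ≤ δ⁻¹ * (1 - ‖x - c‖ ^ 2) := by rw [le_inv_mul_iff₀ hδ]; linarith
      linarith
    have hkx : k x ≤ 2 * (φ * (D1 * (t ^ 2)⁻¹)) ^ 2 + 2 * (2 * ‖x - c‖ * (φ * (D2 * δ⁻¹))) ^ 2 := by
      calc k x ≤ φ ^ 2 * (2 * (D1 * (t ^ 2)⁻¹) ^ 2 + 2 * (4 * ‖x - c‖ ^ 2 * (D2 * δ⁻¹) ^ 2)) :=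
            mul_le_mul_of_nonneg_left (hgrad x) (sq_nonneg _)
        _ = _ := by ring
    have b1 : (φ * (D1 * (t ^ 2)⁻¹)) ^ 2 ≤ (18 * L * M) ^ 2 := by
      rw [← sq_abs]
      gcongr
      by_cases h : 2 * t ^ 2 < x 0
      · rw [z1 h]; simp; positivity
      · have := (neck_bounds ht4 ht hd1 hd4 (not_lt.1 h) hr1).1
        rw [abs_mul, abs_mul, abs_of_nonneg hφ0, abs_of_pos (inv_pos.2 ht2)]
        calc φ * (|D1| * (t ^ 2)⁻¹) ≤ (L * (18 * t ^ 2)) * (M * (t ^ 2)⁻¹) := by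
              gcongr
              · exact hφ.trans (by gcongr)
              · exact hM _
          _ = 18 * L * M := by field_simp
    have b2 : (2 * ‖x - c‖ * (φ * (D2 * δ⁻¹))) ^ 2 ≤ (4 * L * M) ^ 2 := by
      rw [← sq_abs]
      gcongr
      by_cases h : ‖x - c‖ ^ 2 < 1 - 2 * δ
      · rw [z2 h]; simp; positivity
      · rw [not_lt] at h
        have hn1 : ‖x - c‖ ≤ 1 := by nlinarith [norm_nonneg (x - c)]
        rw [abs_mul, abs_mul, abs_mul, abs_mul, abs_of_nonneg hφ0, abs_of_pos (inv_pos.2 hδ),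
            abs_norm,
          abs_of_pos (by norm_num : (0 : ℝ) < 2)]
        calc 2 * ‖x - c‖ * (φ * (|D2| * δ⁻¹)) ≤ 2 * 1 * ((L * (2 * δ)) * (M * δ⁻¹)) := by
              gcongr
              · exact hφ.trans (by gcongr; linarith)
              · exact hM _
          _ = 4 * L * M := by field_simp; ring
    refine ⟨by linarith, fun hxA => ?_⟩
    rw [mem_union, not_or] at hxA
    have w1 : 2 * t ^ 2 < x 0 := by
      by_contra h
      rw [not_lt] at h
      refine hxA.1 ⟨by rw [abs_of_pos (by linarith)]; exact h, fun i => ?_⟩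
      have := (neck_bounds ht4 ht hd1 hd4 h hr1).2
      have hi : |x i| ≤ ‖x‖ := PiLp.norm_apply_le x i
      nlinarith [norm_nonneg x]
    have w2 : ‖x - c‖ ^ 2 < 1 - 2 * δ := by
      by_contra h
      rw [not_lt] at h
      refine hxA.2 ⟨mem_ball_iff_norm.2 (by nlinarith [norm_nonneg (x - c)]), fun hb => ?_⟩
      rw [mem_ball_iff_norm] at hb
      nlinarith [norm_nonneg (x - c)]
    rw [z1 w1, z2 w2] at hkx
    have : 0 ≤ k x := by simp only [hk]; positivity
    simp at hkx
    linarith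
  have hk0 : ∀ x, 0 ≤ k x := fun x => by simp only [hk]; positivity
  have hvA := volume_box_le (N := N) (a := 2 * t ^ 2) (r := 5 * t) (by positivity) (by positivity)
  have hvS := volume_shell_le c (η := 2 * δ) (by positivity) (by linarith)
  have hvU : volume (A ∪ Sh) ≤ ENNReal.ofReal (2 * (2 * t ^ 2) * (2 * (5 * t)) ^ (N - 1) +
      N * (2 * δ) * ω) := by
    rw [ENNReal.ofReal_add (by positivity) (by positivity)]
    exact (measure_union_le _ _).trans (add_le_add hvA hvS)
  have hfin := hvU.trans_lt ENNReal.ofReal_lt_top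
  rw [← setIntegral_eq_integral_of_forall_compl_eq_zero (s := A ∪ Sh) fun x hx => (hpt x).2 hx]
  have h1 := norm_setIntegral_le_of_norm_le_const (μ := volume) (s := A ∪ Sh) (f := k) (C := C1)
      hfin
    fun x _ => by rw [Real.norm_eq_abs, abs_of_nonneg (hk0 x)]; exact (hpt x).1
  refine (le_abs_self _).trans (h1.trans ?_)
  have h2 : (volume (A ∪ Sh)).toReal ≤
      2 * (2 * t ^ 2) * (2 * (5 * t)) ^ (N - 1) + N * (2 * δ) * ω :=
    ENNReal.toReal_le_of_le_ofReal (by positivity) hvU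
  have h3 : 2 * (2 * t ^ 2) * (2 * (5 * t)) ^ (N - 1) = 4 * 10 ^ (N - 1) * t ^ (N + 1) := by
    obtain ⟨n, hn⟩ : ∃ n, N = n + 1 := ⟨N - 1, by have := one_le_dim (N := N); omega⟩
    rw [hn, Nat.add_sub_cancel, show 2 * (5 * t) = 10 * t by ring, mul_pow]; ring
  rw [h3] at h2
  have hC10 : 0 ≤ C1 := by positivity
  refine (mul_le_mul_of_nonneg_left h2 hC10).trans ?_
  rw [mul_assoc C1]
  refine mul_le_mul_of_nonneg_left ?_ hC10
  have p1 : 0 ≤ 4 * (10 : ℝ) ^ (N - 1) * δ := by positivity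
  have p2 : 0 ≤ N * 2 * ω * t ^ (N + 1) := by positivity
  nlinarith

theorem le_integral_trialFun_sq (hs : IsFirstZero N s₀) {d : ℝ} (ht : 0 < t) (ht4 : t ≤ 1 / 4)
    (hδ : 0 < δ) (hδ8 : δ ≤ 1 / 8) (hd1 : 1 - t ^ 2 ≤ d) :
    radialFun N (s₀ / 4) ^ 2 * (volume (ball (0 : Sp N) (1 / 2))).toReal ≤
      ∫ x, trialFun (N := N) s₀ t δ (EuclideanSpace.single 0 d) x ^ 2 := by
  set c : Sp N := EuclideanSpace.single 0 d with hc
  have hs0 := hs.pos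
  have hi : Integrable (fun x => trialFun (N := N) s₀ t δ c x ^ 2) :=
    integrable_sq (contDiff_trialFun (n := 0)).continuous (hasCompactSupport_trialFun ht hδ)
  refine le_trans ?_ (setIntegral_le_integral (s := ball c (1 / 2)) hi
    (Eventually.of_forall fun x => sq_nonneg _))
  rw [← Measure.addHaar_ball_center volume c]
  have h4 : ∫ x in ball c (1 / 2), radialFun N (s₀ / 4) ^ 2 ≤
      ∫ x in ball c (1 / 2), trialFun (N := N) s₀ t δ c x ^ 2 := by
    refine setIntegral_mono_on (integrableOn_const measure_ball_lt_top.ne) hi.integrableOn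
      measurableSet_ball fun x hx => ?_
    rw [mem_ball_iff_norm] at hx
    have hr : ‖x - c‖ ^ 2 ≤ 1 / 4 := by nlinarith [norm_nonneg (x - c)]
    have h1 : |(x - c) 0| ≤ ‖x - c‖ := PiLp.norm_apply_le (x - c) 0
    have h2 : (x - c) 0 = x 0 - d := by simp [hc]
    rw [h2] at h1
    have h3 := (abs_le.1 h1).1
    have hb : bulkCut t δ c x = 1 := bulkCut_eq_one ht hδ (by nlinarith) (by linarith)
    have hpos := hs.fun_pos (s₀ / 4) (by positivity) (by linarith)
    rw [trialFun, hb, mul_one]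
    have hle : radialFun N (s₀ / 4) ≤ radialFun N (s₀ * ‖x - c‖ ^ 2) :=
      hs.antitoneOn ⟨by positivity, by nlinarith⟩ ⟨by positivity, by linarith⟩ (by nlinarith)
    gcongr
  rw [setIntegral_const, smul_eq_mul] at h4
  rw [mul_comm]; exact h4

end

section
variable {N : ℕ} [NeZero N] {s₀ t δ d : ℝ}

theorem trialFun_mem_testFun (ht : 0 < t) (hδ : 0 < δ) :
    trialFun s₀ t δ (EuclideanSpace.single 0 d) ∈ testFun N (pairBalls N d) := by
  refine ⟨contDiff_trialFun, hasCompactSupport_trialFun ht hδ, fun x hx => Or.inl ?_⟩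
  have h : ‖x - EuclideanSpace.single 0 d‖ ^ 2 ≤ 1 - δ := (tsupport_trialFun ht hδ hx).2
  rw [mem_ball_iff_norm]
  nlinarith [norm_nonneg (x - EuclideanSpace.single 0 d)]

theorem comp_refl0_mem_testFun {u : Sp N → ℝ} (hu : u ∈ testFun N (pairBalls N d)) :
    (fun x => u (refl0 N x)) ∈ testFun N (pairBalls N d) := by
  refine ⟨hu.1.comp (refl0 N).contDiff, hasCompactSupport_comp_refl0 hu.2.1, ?_⟩
  rw [tsupport_comp_refl0]
  exact fun x hx => refl0_mem_pairBalls (hu.2.2 hx)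

theorem integral_comp_refl0 (g : Sp N → ℝ) : ∫ x, g (refl0 N x) = ∫ x, g x :=
  (refl0 N).measurePreserving.integral_comp (refl0 N).toHomeomorph.measurableEmbedding g

theorem disjoint_tsupport_trialFun (ht : 0 < t) (hδ : 0 < δ) {c : Sp N} :
    Disjoint (tsupport (trialFun s₀ t δ c)) (tsupport fun x => trialFun s₀ t δ c (refl0 N x)) := by
  rw [tsupport_comp_refl0, Set.disjoint_left]
  intro x hx hx'
  have h1 : t ^ 2 ≤ x 0 := (tsupport_trialFun ht hδ hx).1
  have h2 : t ^ 2 ≤ refl0 N x 0 := (tsupport_trialFun ht hδ hx').1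
  rw [refl0_zero] at h2
  nlinarith [pow_pos ht 2]

theorem radialFun_quarter_pos {N : ℕ} {s₀ : ℝ} (hs : IsFirstZero N s₀) :
    0 < radialFun N (s₀ / 4) :=
  hs.fun_pos _ (by linarith [hs.pos]) (by linarith [hs.pos])

theorem trialFun_ne_zero (hs : IsFirstZero N s₀) (ht : 0 < t) (ht4 : t ≤ 1 / 4) (hδ : 0 < δ)
    (hδ8 : δ ≤ 1 / 8) (hd1 : 1 - t ^ 2 ≤ d) :
    trialFun (N := N) s₀ t δ (EuclideanSpace.single 0 d) ≠ 0 := by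
  intro h
  have h1 := le_integral_trialFun_sq hs ht ht4 hδ hδ8 hd1
  have h2 := radialFun_quarter_pos hs
  have h3 : 0 < (volume (ball (0 : Sp N) (1 / 2))).toReal := volume_ball_pos 0 (by norm_num)
  rw [h] at h1
  have : 0 < radialFun N (s₀ / 4) ^ 2 * (volume (ball (0 : Sp N) (1 / 2))).toReal := by positivity
  simp at h1
  simp at this
  linarith

theorem comp_refl0_ne_zero {u : Sp N → ℝ} (hu : u ≠ 0) : (fun x => u (refl0 N x)) ≠ 0 := by
  intro h
  refine hu (funext fun x => ?_)
  have := congrFun h (refl0 N x)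
  simpa [refl0_refl0] using this

theorem cutWidth_pos (N : ℕ) (ht : 0 < t) : 0 < t ^ (N + 1) / 8 := by positivity

theorem cutWidth_le (N : ℕ) (ht : 0 < t) (ht4 : t ≤ 1 / 4) : t ^ (N + 1) / 8 ≤ 1 / 8 := by
  have : t ^ (N + 1) ≤ 1 := pow_le_one₀ ht.le (by linarith)
  linarith

theorem exists_trial_rayleigh (hs : IsFirstZero N s₀) : ∃ C, 0 ≤ C ∧ ∀ t d : ℝ, 0 < t → t ≤ 1 / 4 →
    1 - t ^ 2 ≤ d → d ≤ 4 →
    ∫ x, ‖fderiv ℝ (trialFun (N := N) s₀ t (t ^ (N + 1) / 8) (EuclideanSpace.single 0 d)) x‖ ^ 2 ≤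
      (s₀ + C * t ^ (N + 1)) *
        ∫ x, trialFun (N := N) s₀ t (t ^ (N + 1) / 8) (EuclideanSpace.single 0 d) x ^ 2 := by
  obtain ⟨C, hC0, hC⟩ := exists_energy_bound hs
  have h2 := radialFun_quarter_pos hs
  have h3 : 0 < (volume (ball (0 : Sp N) (1 / 2))).toReal := volume_ball_pos 0 (by norm_num)
  set m := radialFun N (s₀ / 4) ^ 2 * (volume (ball (0 : Sp N) (1 / 2))).toReal with hm
  have hm0 : 0 < m := by positivity
  refine ⟨2 * C / m, by positivity, fun t d ht ht4 hd1 hd4 => ?_⟩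
  have hp := cutWidth_pos N ht
  have hp8 := cutWidth_le N ht ht4
  have h4 := hC t _ d ht ht4 hp hp8 hd1 hd4
  have h5 := le_integral_trialFun_sq hs ht ht4 hp hp8 hd1
  rw [← hm] at h5
  set I := ∫ x, trialFun (N := N) s₀ t (t ^ (N + 1) / 8) (EuclideanSpace.single 0 d) x ^ 2
  have h6 : C * (t ^ (N + 1) + t ^ (N + 1) / 8) ≤ 2 * C / m * t ^ (N + 1) * I := by
    calc C * (t ^ (N + 1) + t ^ (N + 1) / 8) ≤ 2 * C * t ^ (N + 1) := by
          have : 0 ≤ C * t ^ (N + 1) := by positivity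
          linarith
      _ = 2 * C / m * t ^ (N + 1) * m := by field_simp
      _ ≤ _ := mul_le_mul_of_nonneg_left h5 (by positivity)
  linarith

/-- The second eigenvalue of two slightly overlapping balls exceeds that of a ball by at most
`O(t ^ (N + 1))`. -/
theorem exists_dirichletEV_le (hs : IsFirstZero N s₀) : ∃ C, 0 ≤ C ∧ ∀ t d : ℝ, 0 < t → t ≤ 1 / 4 →
    1 - t ^ 2 ≤ d → d ≤ 4 → dirichletEV N 1 (pairBalls N d) ≤ s₀ + C * t ^ (N + 1) ∧
      dirichletEV N 2 (pairBalls N d) ≤ s₀ + C * t ^ (N + 1) := by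
  obtain ⟨C, hC0, hC⟩ := exists_trial_rayleigh hs
  refine ⟨C, hC0, fun t d ht ht4 hd1 hd4 => ?_⟩
  have hp := cutWidth_pos N ht
  have hp8 := cutWidth_le N ht ht4
  have h := hC t d ht ht4 hd1 hd4
  have hm := trialFun_mem_testFun (N := N) (s₀ := s₀) (d := d) ht hp
  have h0 := trialFun_ne_zero hs ht ht4 hp hp8 hd1
  refine ⟨dirichletEV_one_le hm h0 h, dirichletEV_two_le hm h0 (comp_refl0_mem_testFun hm)
    (comp_refl0_ne_zero h0) (disjoint_tsupport_trialFun ht hp) h ?_⟩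
  simp_rw [norm_fderiv_comp_refl0]
  rw [integral_comp_refl0 fun x => ‖fderiv ℝ
      (trialFun (N := N) s₀ t (t ^ (N + 1) / 8) (EuclideanSpace.single 0 d)) x‖ ^ 2,
    integral_comp_refl0 fun x =>
      trialFun (N := N) s₀ t (t ^ (N + 1) / 8) (EuclideanSpace.single 0 d) x ^ 2]
  exact h

theorem dirichletEV_pairBalls (hs : IsFirstZero N s₀) (hd : 1 ≤ d) (hd4 : d ≤ 4) :
    dirichletEV N 1 (pairBalls N d) = s₀ ∧ dirichletEV N 2 (pairBalls N d) = s₀ := by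
  obtain ⟨C, hC0, hC⟩ := exists_dirichletEV_le hs
  have hlim : Tendsto (fun t : ℝ => s₀ + C * t ^ (N + 1)) (nhdsWithin 0 (Ioi 0)) (nhds s₀) := by
    have : Tendsto (fun t : ℝ => s₀ + C * t ^ (N + 1)) (nhds 0) (nhds (s₀ + C * 0 ^ (N + 1))) :=
      Continuous.tendsto (by fun_prop) 0
    simp only [ne_eq, Nat.add_eq_zero_iff, one_ne_zero, and_false, not_false_eq_true, zero_pow,
      mul_zero, add_zero] at this
    exact this.mono_left nhdsWithin_le_nhds
  have hev : ∀ᶠ t : ℝ in nhdsWithin 0 (Ioi 0),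
      dirichletEV N 1 (pairBalls N d) ≤ s₀ + C * t ^ (N + 1) ∧
      dirichletEV N 2 (pairBalls N d) ≤ s₀ + C * t ^ (N + 1) := by
    filter_upwards [Ioo_mem_nhdsGT (show (0 : ℝ) < 1 / 4 by norm_num)] with t ht
    exact hC t d ht.1 ht.2.le (by nlinarith [sq_nonneg t]) hd4
  have hp : (0 : ℝ) < 1 / 8 := by norm_num
  have hq : (0 : ℝ) < 1 / 4 := by norm_num
  have hm := trialFun_mem_testFun (N := N) (s₀ := s₀) (d := d) hq hp
  have h0 := trialFun_ne_zero (N := N) (d := d) hs hq le_rfl hp le_rfl (by linarith)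
  constructor
  · refine le_antisymm (ge_of_tendsto hlim (hev.mono fun t h => h.1)) ?_
    exact le_dirichletEV_one hm h0 fun u hu => poincare_pairBalls hs hd hu
  · refine le_antisymm (ge_of_tendsto hlim (hev.mono fun t h => h.2)) ?_
    exact le_dirichletEV_two hm h0 (comp_refl0_mem_testFun hm)
      (comp_refl0_ne_zero h0) (disjoint_tsupport_trialFun hq hp) (fun _ => 0) (by simp) (by simp)
      fun u hu _ => poincare_pairBalls hs hd hu

/-- A one-parameter lower bound for both eigenvalues of slightly overlapping balls. -/
theorem eventually_le_dirichletEV (hN : 2 ≤ N) (hs : IsFirstZero N s₀) {κ θ : ℝ} (hκ0 : 0 < κ)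
    (hκ : κ < s₀) (hθ : 0 < θ) (hθ1 : θ ≤ 1) :
    ∀ᶠ t : ℝ in nhdsWithin 0 (Ioi 0),
      κ / (1 + θ) ≤ dirichletEV N 1 (pairBalls N (1 - t ^ 2)) ∧
      min s₀ (κ / (1 + θ) + gapConst N s₀) ≤ dirichletEV N 2 (pairBalls N (1 - t ^ 2)) := by
  obtain ⟨t₀, ht₀, -, hw⟩ := exists_supersolution hN hs hκ0 hκ hθ
  filter_upwards [Ioo_mem_nhdsGT ht₀, Ioo_mem_nhdsGT (show (0 : ℝ) < 1 / 4 by norm_num)]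
    with t htt ht4'
  have ht := htt.1
  have ht4 := ht4'.2.le
  obtain ⟨w, hw⟩ := hw t htt.1 htt.2
  set d := 1 - t ^ 2 with hd
  have hd2 : 1 / 2 ≤ d := by nlinarith
  have hp : (0 : ℝ) < 1 / 8 := by norm_num
  have hm := trialFun_mem_testFun (N := N) (s₀ := s₀) (d := d) ht hp
  have h0 := trialFun_ne_zero (N := N) (d := d) hs ht ht4 hp le_rfl le_rfl
  have hκs : κ / (1 + θ) ≤ s₀ := (div_le_self hκ0.le (by linarith)).trans hκ.le
  have hgap := fun (u : Sp N → ℝ) (hu : u ∈ testFun N (pairBalls N d)) =>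
    halfSp_gap hs hκ0 hκ hθ1 hd2 hw (contDiff_evenPart (contDiff_of_mem_testFun hu (n := 1)))
      (hasCompactSupport_evenPart hu.2.1) (tsupport_evenPart_subset_pairBalls hu.2.2)
  have hodd := fun (u : Sp N → ℝ) (hu : u ∈ testFun N (pairBalls N d)) =>
    halfSp_poincare hs (by linarith : 0 ≤ d) (contDiff_oddPart
      (contDiff_of_mem_testFun hu (n := 1)))
      (hasCompactSupport_oddPart hu.2.1) (tsupport_oddPart_subset_pairBalls hu.2.2)
      (fun x _ hx0 => oddPart_of_zero hx0)
  have hnn : ∀ v : Sp N → ℝ, 0 ≤ ∫ x in halfSp N, v x ^ 2 :=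
    fun v => integral_nonneg fun x => sq_nonneg _
  constructor
  · refine le_dirichletEV_one hm h0 fun u hu => ?_
    have h1 : ContDiff ℝ 1 u := contDiff_of_mem_testFun hu (n := 1)
    rw [integral_sq_even_odd h1 hu.2.1, integral_norm_fderiv_sq_even_odd h1 hu.2.1]
    have := (hgap u hu).1
    have := hodd u hu
    nlinarith [hnn (oddPart u), mul_le_mul_of_nonneg_right hκs (hnn (oddPart u))]
  · set S := halfSp N ∩ ball (EuclideanSpace.single 0 d : Sp N) 1 with hS
    have hint : ∀ u ∈ testFun N (pairBalls N d), IntegrableOn (fun x => w x * evenPart u x) S := by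
      intro u hu
      have hcu := (contDiff_evenPart (contDiff_of_mem_testFun hu (n := 1))).continuous
      have hK : IsCompact ({x : Sp N | 0 ≤ x 0} ∩ closedBall (EuclideanSpace.single 0 d) 1) :=
        (isCompact_closedBall _ _).inter_left (isClosed_le continuous_const (by fun_prop))
      refine IntegrableOn.mono_set (ContinuousOn.integrableOn_compact hK ?_)
        (inter_subset_inter (fun x (hx : 0 < x 0) => hx.le) ball_subset_closedBall)
      refine ContinuousOn.mul (fun x hx => ?_) hcu.continuousOn
      exact (hw x hx.1 (mem_closedBall_iff_norm.1 hx.2)).1.continuousAt.continuousWithinAt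
    refine le_dirichletEV_two hm h0 (comp_refl0_mem_testFun hm)
      (comp_refl0_ne_zero h0) (disjoint_tsupport_trialFun ht hp)
      (fun u => ∫ x in S, w x * evenPart u x) ?_ ?_ ?_
    · intro u hu v hv
      rw [← integral_add (hint u hu) (hint v hv)]
      refine integral_congr_ae (ae_of_all _ fun x => ?_)
      simp only [evenPart, Pi.add_apply]; ring
    · intro a u hu
      rw [← integral_const_mul]
      refine integral_congr_ae (ae_of_all _ fun x => ?_)
      simp only [evenPart, Pi.smul_apply, smul_eq_mul]; ring
    · intro u hu hl
      have h1 : ContDiff ℝ 1 u := contDiff_of_mem_testFun hu (n := 1)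
      rw [integral_sq_even_odd h1 hu.2.1, integral_norm_fderiv_sq_even_odd h1 hu.2.1]
      have h2 := (hgap u hu).2 hl
      have h3 := hodd u hu
      have h4 := mul_le_mul_of_nonneg_right (min_le_left s₀ (κ / (1 + θ) + gapConst N s₀))
        (hnn (oddPart u))
      have h5 := mul_le_mul_of_nonneg_right (min_le_right s₀ (κ / (1 + θ) + gapConst N s₀))
        (hnn (evenPart u))
      linarith

theorem eventually_sub_le_dirichletEV_one (hN : 2 ≤ N) (hs : IsFirstZero N s₀) {η : ℝ}
    (hη : 0 < η) :
    ∀ᶠ t : ℝ in nhdsWithin 0 (Ioi 0),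
      s₀ - η ≤ dirichletEV N 1 (pairBalls N (1 - t ^ 2)) ∧
      min s₀ (s₀ - η + gapConst N s₀) ≤ dirichletEV N 2 (pairBalls N (1 - t ^ 2)) := by
  have hs0 := hs.pos
  set a := min (η / 2) (s₀ / 2) with ha
  have ha0 : 0 < a := by positivity
  have ha1 : a ≤ η / 2 := min_le_left _ _
  have ha2 : a ≤ s₀ / 2 := min_le_right _ _
  set θ := min (a / s₀) 1 with hθ
  have hθ0 : 0 < θ := by positivity
  have hθ1 : θ * s₀ ≤ a := by
    calc θ * s₀ ≤ a / s₀ * s₀ := mul_le_mul_of_nonneg_right (min_le_left _ _) hs0.le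
      _ = a := by field_simp
  filter_upwards [eventually_le_dirichletEV hN hs (κ := s₀ - a) (by linarith) (by linarith) hθ0
    (min_le_right _ _)] with t ht
  have : s₀ - η ≤ (s₀ - a) / (1 + θ) := by
    rw [le_div_iff₀ (by linarith)]
    nlinarith [mul_pos hη hθ0]
  exact ⟨this.trans ht.1, (min_le_min_left _ (by linarith)).trans ht.2⟩

theorem eventually_le_dirichletEV_two (hN : 2 ≤ N) (hs : IsFirstZero N s₀) :
    ∀ᶠ t : ℝ in nhdsWithin 0 (Ioi 0), s₀ ≤ dirichletEV N 2 (pairBalls N (1 - t ^ 2)) := by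
  filter_upwards [eventually_sub_le_dirichletEV_one hN hs (gapConst_pos hs)] with t ht
  simpa using ht.2

end

section
variable {N : ℕ} {f b : Sp N → ℝ}

/-- Green's identity for compactly supported functions, in polarized form. -/
theorem integral_norm_fderiv_add_mul_sq (hf : ContDiff ℝ 1 f) (hfc : HasCompactSupport f)
    (hb : ContDiff ℝ 2 b) (hbc : HasCompactSupport b) (τ : ℝ) :
    ∫ x, ‖fderiv ℝ (fun y => f y + τ * b y) x‖ ^ 2 = (∫ x, ‖fderiv ℝ f x‖ ^ 2) +
      τ ^ 2 * (∫ x, ‖fderiv ℝ b x‖ ^ 2) - 2 * τ * ∫ x, f x * ∑ i, pd i (pd i b) x := by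
  have hb1 : ContDiff ℝ 1 b := hb.of_le (by norm_num)
  have hpb : ∀ i, ContDiff ℝ 1 (pd i b) := fun i => contDiff_iff_contDiffAt.2 fun x =>
    contDiffAt_pd hb.contDiffAt (by norm_num) i
  have hdf : Differentiable ℝ f := hf.differentiable (by norm_num)
  have hdb : Differentiable ℝ b := hb1.differentiable (by norm_num)
  have hpt : ∀ x, ‖fderiv ℝ (fun y => f y + τ * b y) x‖ ^ 2 = ‖fderiv ℝ f x‖ ^ 2 +
      τ ^ 2 * ‖fderiv ℝ b x‖ ^ 2 + (2 * τ * (∑ i, pd i (fun y => f y * pd i b y) x) -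
        2 * τ * (f x * ∑ i, pd i (pd i b) x)) := by
    intro x
    simp only [norm_sq_fderiv, Finset.mul_sum, ← Finset.sum_add_distrib, ← Finset.sum_sub_distrib]
    refine Finset.sum_congr rfl fun i _ => ?_
    rw [pd_add (v := fun y => τ * b y) (hdf x) ((hdb x).const_mul τ), pd_smul_const τ i (hdb x),
      pd_mul (hdf x) ((hpb i).differentiable (by norm_num) x)]
    ring
  simp only [hpt]
  have i1 := integrable_norm_fderiv_sq hf hfc
  have i2 := (integrable_norm_fderiv_sq hb1 hbc).const_mul (τ ^ 2)
  have hfp : ∀ i, ContDiff ℝ 1 (fun y => f y * pd i b y) := fun i => hf.mul (hpb i)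
  have hfpc : ∀ i, HasCompactSupport (fun y => f y * pd i b y) := fun i => hfc.mul_right
  have i3 : ∀ i, Integrable (pd i (fun y => f y * pd i b y)) := fun i =>
    (continuous_pd (hfp i) i).integrable_of_hasCompactSupport (hasCompactSupport_pd (hfpc i) i)
  have i3' : Integrable (fun x => 2 * τ * ∑ i, pd i (fun y => f y * pd i b y) x) :=
    (integrable_finsetSum _ fun i _ => i3 i).const_mul _
  have i4 : Integrable (fun x => 2 * τ * (f x * ∑ i, pd i (pd i b) x)) := by
    refine Integrable.const_mul (Continuous.integrable_of_hasCompactSupport ?_ hfc.mul_right) _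
    exact hf.continuous.mul (continuous_finsetSum _ fun i _ => continuous_pd (hpb i) i)
  rw [integral_add (f := fun x => ‖fderiv ℝ f x‖ ^ 2 + τ ^ 2 * ‖fderiv ℝ b x‖ ^ 2)
    (g := fun x => 2 * τ * (∑ i, pd i (fun y => f y * pd i b y) x) -
      2 * τ * (f x * ∑ i, pd i (pd i b) x)) (i1.add i2)
    (i3'.sub i4), integral_add i1 i2, integral_sub i3' i4, integral_const_mul, integral_const_mul,
    integral_const_mul, integral_finsetSum _ fun i _ => i3 i]
  rw [Finset.sum_eq_zero fun i _ => integral_pd_eq_zero (hfp i) (hfpc i) i]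
  ring

end

section
variable {N : ℕ}

/-- A radial bump function on the unit ball. -/
def unitBump (N : ℕ) (x : Sp N) : ℝ := expNegInvGlue (1 - 1 * ‖x - 0‖ ^ 2)

theorem contDiff_unitBump {n : ℕ∞} : ContDiff ℝ n (unitBump N) :=
  expNegInvGlue.contDiff.comp (contDiff_const.sub (contDiff_dist_sq 1 0))

theorem unitBump_nonneg (x : Sp N) : 0 ≤ unitBump N x := expNegInvGlue.nonneg _

theorem tsupport_unitBump : tsupport (unitBump N) ⊆ closedBall 0 1 := by
  refine closure_minimal (fun x hx => ?_) isClosed_closedBall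
  by_contra h
  refine hx (expNegInvGlue.zero_of_nonpos ?_)
  rw [mem_closedBall_iff_norm, not_le] at h
  nlinarith

theorem hasCompactSupport_unitBump : HasCompactSupport (unitBump N) :=
  (isCompact_closedBall _ _).of_isClosed_subset (isClosed_tsupport _) tsupport_unitBump

end

theorem hasDerivAt_expNegInvGlue_of_pos {x : ℝ} (hx : 0 < x) :
    HasDerivAt expNegInvGlue (Real.exp (-x⁻¹) * (x ^ 2)⁻¹) x := by
  have h : HasDerivAt (fun x : ℝ => Real.exp (-x⁻¹)) (Real.exp (-x⁻¹) * (x ^ 2)⁻¹) x := by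
    have := ((hasDerivAt_inv hx.ne').neg).exp
    exact this.congr_deriv (by simp)
  refine h.congr_of_eventuallyEq ?_
  filter_upwards [lt_mem_nhds hx] with y hy
  rw [expNegInvGlue, if_neg (not_le.2 hy)]

section
variable {N : ℕ} [NeZero N]

theorem unitBump_refl0 (x : Sp N) : unitBump N (refl0 N x) = unitBump N x := by
  simp [unitBump]

theorem pd_zero_unitBump_of_lt {x : Sp N} (hx0 : 0 < x 0) (hx : ‖x‖ < 1) :
    pd 0 (unitBump N) x < 0 := by
  have h1 : 0 < 1 - 1 * ‖x - 0‖ ^ 2 := by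
    rw [sub_zero]; nlinarith [norm_nonneg x]
  have h2 : HasDerivAt (fun s : ℝ => expNegInvGlue (1 - s)) (Real.exp (-(1 - 1 * ‖x - 0‖ ^ 2)⁻¹) *
      ((1 - 1 * ‖x - 0‖ ^ 2) ^ 2)⁻¹ * -1) (1 * ‖x - 0‖ ^ 2) :=
    (hasDerivAt_expNegInvGlue_of_pos h1).comp (1 * ‖x - 0‖ ^ 2)
      ((hasDerivAt_id _).const_sub (1 : ℝ))
  have h3 := pd_radial (c := (0 : Sp N)) (x := x) (k := 1) h2.differentiableAt 0
  have h4 : pd 0 (unitBump N) x = _ := h3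
  rw [h4, h2.deriv]
  have : 0 < Real.exp (-(1 - 1 * ‖x - 0‖ ^ 2)⁻¹) * ((1 - 1 * ‖x - 0‖ ^ 2) ^ 2)⁻¹ := by positivity
  simp only [PiLp.zero_apply, sub_zero] at this ⊢
  nlinarith [mul_pos hx0 this]

theorem pd_zero_unitBump_nonpos {x : Sp N} (hx0 : 0 < x 0) : pd 0 (unitBump N) x ≤ 0 := by
  rcases lt_trichotomy ‖x‖ 1 with h | h | h
  · exact (pd_zero_unitBump_of_lt hx0 h).le
  · have h3 := pd_radial (c := (0 : Sp N)) (x := x) (k := 1)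
      (g := fun s : ℝ => expNegInvGlue (1 - s))
      ((expNegInvGlue.contDiff (n := 1)).comp (by fun_prop : ContDiff ℝ 1 fun s : ℝ => 1 - s)
        |>.differentiable (by norm_num) _) 0
    have h4 : pd 0 (unitBump N) x = _ := h3
    rw [h4]
    have h5 : deriv (fun s : ℝ => expNegInvGlue (1 - s)) (1 * ‖x - 0‖ ^ 2) = 0 := by
      refine IsLocalMin.deriv_eq_zero (Eventually.of_forall fun y => ?_)
      rw [sub_zero, h]
      simpa using expNegInvGlue.nonneg _
    rw [h5, mul_zero]
  · rw [pd_eq_zero_of_notMem fun hx => ?_]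
    have := tsupport_unitBump hx
    rw [mem_closedBall_iff_norm, sub_zero] at this
    linarith

/-- The flux of the bump through the hyperplane. -/
def bumpFlux (N : ℕ) [NeZero N] : ℝ := -∫ x in halfSp N, pd 0 (unitBump N) x

theorem bumpFlux_pos : 0 < bumpFlux N := by
  have hi : Integrable (pd 0 (unitBump N)) :=
    (continuous_pd (contDiff_unitBump (n := 1)) 0).integrable_of_hasCompactSupport
      (hasCompactSupport_pd hasCompactSupport_unitBump 0)
  rw [bumpFlux, ← integral_neg, setIntegral_pos_iff_support_of_nonneg_ae
    (f := fun x => -pd 0 (unitBump N) x) ?_ hi.neg.integrableOn]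
  · have hsub : halfSp N ∩ ball 0 1 ⊆
        Function.support (fun x => -pd 0 (unitBump N) x) ∩ halfSp N := by
      intro x hx
      have := pd_zero_unitBump_of_lt hx.1 (by simpa using hx.2)
      exact ⟨by simpa using this.ne, hx.1⟩
    refine lt_of_lt_of_le (IsOpen.measure_pos _ (isOpen_halfSp.inter isOpen_ball) ?_)
      (measure_mono hsub)
    refine ⟨EuclideanSpace.single 0 (1 / 2), ?_, ?_⟩
    · show (0 : ℝ) < EuclideanSpace.single (0 : Fin N) (1 / 2 : ℝ) 0
      simp
    · rw [mem_ball_iff_norm, sub_zero, PiLp.norm_single]; norm_num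
  · filter_upwards [ae_restrict_mem measurableSet_halfSp] with x hx
    exact neg_nonneg.2 (pd_zero_unitBump_nonpos hx)

/-- Green's identity in the half-space with the linear function `x 0`. -/
theorem setIntegral_coord_mul_laplacian {b : Sp N → ℝ} (hb : ContDiff ℝ 2 b)
    (hbc : HasCompactSupport b) :
    ∫ x in halfSp N, x 0 * ∑ i, pd i (pd i b) x = -∫ x in halfSp N, pd 0 b x := by
  have hpb : ∀ i, ContDiff ℝ 1 (pd i b) := fun i => contDiff_iff_contDiffAt.2 fun x =>
    contDiffAt_pd hb.contDiffAt (by norm_num) i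
  have hco : ContDiff ℝ 1 (fun x : Sp N => x 0) := by fun_prop
  have hψ : ∀ i, ContDiff ℝ 1 (fun x => x 0 * pd i b x) := fun i => hco.mul (hpb i)
  have hψc : ∀ i, HasCompactSupport (fun x => x 0 * pd i b x) := fun i =>
    (hasCompactSupport_pd hbc i).mul_left
  have hneg : ∀ (i : Fin N) x, pd i (fun x => -1 * (x 0 * pd i b x)) x =
      -1 * pd i (fun x => x 0 * pd i b x) x := fun i x =>
    pd_smul_const (-1) i ((hψ i).differentiable (by norm_num) x)
  have hz : ∀ i, IntegrableOn (pd i (fun x => x 0 * pd i b x)) (halfSp N) ∧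
      ∫ x in halfSp N, pd i (fun x => x 0 * pd i b x) x = 0 := by
    intro i
    have h1 := setIntegral_pd_nonneg (fun x _ => (hψ i).contDiffAt) (hψc i) i
      (fun _ x hx => by simp [hx])
    have h2 := setIntegral_pd_nonneg (ψ := fun x => -1 * (x 0 * pd i b x))
      (fun x _ => (contDiff_const.mul (hψ i)).contDiffAt) (hψc i).mul_left i
      (fun _ x hx => by simp [hx])
    refine ⟨h1.1, le_antisymm ?_ h1.2⟩
    have h3 := h2.2
    simp only [hneg, integral_const_mul] at h3
    linarith
  have i0 : Integrable (pd 0 b) :=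
    (continuous_pd (hb.of_le (by norm_num)) 0).integrable_of_hasCompactSupport
      (hasCompactSupport_pd hbc 0)
  have hpt : ∀ x : Sp N, x 0 * ∑ i, pd i (pd i b) x =
      (∑ i, pd i (fun x => x 0 * pd i b x) x) - pd 0 b x := by
    intro x
    have : ∀ i, pd i (fun x => x 0 * pd i b x) x =
        x 0 * pd i (pd i b) x + (if i = 0 then 1 else 0) * pd i b x := fun i => by
      rw [pd_mul (hco.differentiable (by norm_num) x) ((hpb i).differentiable (by norm_num) x),
        pd_coord]
    simp [this, Finset.sum_add_distrib, Finset.mul_sum]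
  simp only [hpt]
  rw [integral_sub (integrable_finsetSum _ fun i _ => (hz i).1) i0.integrableOn,
    integral_finsetSum _ fun i _ => (hz i).1, Finset.sum_eq_zero fun i _ => (hz i).2, zero_sub]

end

theorem pd_comp_smul {N : ℕ} (i : Fin N) (u : Sp N → ℝ) (s : ℝ) (x : Sp N) :
    pd i (fun y => u (s • y)) x = s * pd i u (s • x) := by
  simp only [pd]
  rw [fderiv_comp_smul]; rfl

/-- The bump rescaled to the ball of radius `t`, with gradient of order one. -/
def neckBump (N : ℕ) (t : ℝ) (x : Sp N) : ℝ := t * unitBump N (t⁻¹ • x)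

section
variable {N : ℕ} {t : ℝ}

theorem contDiff_neckBump {n : ℕ∞} : ContDiff ℝ n (neckBump N t) :=
  contDiff_const.mul (contDiff_unitBump.comp (contDiff_const_smul _))

theorem neckBump_nonneg (ht : 0 < t) (x : Sp N) : 0 ≤ neckBump N t x :=
  mul_nonneg ht.le (unitBump_nonneg _)

theorem tsupport_neckBump (ht : 0 < t) : tsupport (neckBump N t) ⊆ closedBall 0 t := by
  refine closure_minimal (fun x hx => ?_) isClosed_closedBall
  have h1 : t⁻¹ • x ∈ tsupport (unitBump N) := by
    refine subset_tsupport _ fun h => hx ?_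
    simp only [neckBump, h, mul_zero]
  have h2 := tsupport_unitBump h1
  rw [mem_closedBall_iff_norm, sub_zero, norm_smul, Real.norm_eq_abs, abs_of_pos (by positivity),
    inv_mul_le_iff₀ ht, mul_one] at h2
  rwa [mem_closedBall_iff_norm, sub_zero]

theorem hasCompactSupport_neckBump (ht : 0 < t) : HasCompactSupport (neckBump N t) :=
  (isCompact_closedBall _ _).of_isClosed_subset (isClosed_tsupport _) (tsupport_neckBump ht)

theorem pd_neckBump (ht : 0 < t) (i : Fin N) (x : Sp N) :
    pd i (neckBump N t) x = pd i (unitBump N) (t⁻¹ • x) := by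
  have hd : Differentiable ℝ (fun y : Sp N => unitBump N (t⁻¹ • y)) :=
    ((contDiff_unitBump (n := 1)).comp (contDiff_const_smul _)).differentiable (by norm_num)
  have : pd i (neckBump N t) x = _ := pd_smul_const t i (hd x)
  rw [this, pd_comp_smul, ← mul_assoc, mul_inv_cancel₀ ht.ne', one_mul]

theorem pd_pd_neckBump (ht : 0 < t) (i : Fin N) (x : Sp N) :
    pd i (pd i (neckBump N t)) x = t⁻¹ * pd i (pd i (unitBump N)) (t⁻¹ • x) := by
  rw [show pd i (neckBump N t) = fun y => pd i (unitBump N) (t⁻¹ • y) from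
    funext fun y => pd_neckBump ht i y, pd_comp_smul]

theorem integral_norm_fderiv_neckBump_sq (ht : 0 < t) :
    ∫ x, ‖fderiv ℝ (neckBump N t) x‖ ^ 2 = t ^ N * ∫ x, ‖fderiv ℝ (unitBump N) x‖ ^ 2 := by
  have : ∀ x, ‖fderiv ℝ (neckBump N t) x‖ ^ 2 = ‖fderiv ℝ (unitBump N) (t⁻¹ • x)‖ ^ 2 := fun x => by
    simp only [norm_sq_fderiv, pd_neckBump ht]
  simp only [this]
  rw [Measure.integral_comp_smul volume (fun y => ‖fderiv ℝ (unitBump N) y‖ ^ 2)]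
  rw [finrank_euclideanSpace_fin, inv_pow, inv_inv, abs_of_pos (by positivity), smul_eq_mul]

theorem integral_neckBump_sq (ht : 0 < t) :
    ∫ x, neckBump N t x ^ 2 = t ^ 2 * t ^ N * ∫ x, unitBump N x ^ 2 := by
  simp only [neckBump, mul_pow, integral_const_mul]
  rw [Measure.integral_comp_smul volume (fun y => unitBump N y ^ 2)]
  rw [finrank_euclideanSpace_fin, inv_pow, inv_inv, abs_of_pos (by positivity), smul_eq_mul,
      mul_assoc]

theorem exists_laplacian_neckBump_bound (N : ℕ) : ∃ M, 0 ≤ M ∧ ∀ t, 0 < t → ∀ x,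
    |∑ i, pd i (pd i (neckBump N t)) x| ≤ M * t⁻¹ := by
  have hpb : ∀ i, ContDiff ℝ 1 (pd i (unitBump N)) := fun i => contDiff_iff_contDiffAt.2 fun x =>
    contDiffAt_pd (contDiff_unitBump (n := 2)).contDiffAt (by norm_num) i
  have hc : Continuous (fun x => ∑ i, pd i (pd i (unitBump N)) x) :=
    continuous_finsetSum _ fun i _ => continuous_pd (hpb i) i
  obtain ⟨M, hM⟩ := (isCompact_closedBall (0 : Sp N) 1).exists_bound_of_continuousOn hc.continuousOn
  have hM0 : 0 ≤ M := (norm_nonneg _).trans (hM 0 (by simp))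
  refine ⟨M, hM0, fun t ht x => ?_⟩
  simp only [pd_pd_neckBump ht, ← Finset.mul_sum]
  rw [abs_mul, abs_of_pos (inv_pos.2 ht), mul_comm]
  refine mul_le_mul_of_nonneg_right ?_ (inv_pos.2 ht).le
  by_cases h : t⁻¹ • x ∈ closedBall (0 : Sp N) 1
  · exact hM _ h
  · rw [Finset.sum_eq_zero, abs_zero]
    · exact hM0
    · intro i _
      refine pd_eq_zero_of_notMem (fun h' => h (tsupport_unitBump ?_)) i
      refine closure_minimal (fun y hy => ?_) (isClosed_tsupport _) h'
      by_contra hn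
      exact hy (pd_eq_zero_of_notMem hn i)

end

section
variable {N : ℕ} [NeZero N] {t s₀ : ℝ}

theorem neckBump_refl0 (x : Sp N) : neckBump N t (refl0 N x) = neckBump N t x := by
  rw [neckBump, ← map_smul, unitBump_refl0]; rfl

theorem setIntegral_pd_neckBump (ht : 0 < t) :
    ∫ x in halfSp N, pd 0 (neckBump N t) x = -(t ^ N * bumpFlux N) := by
  have hH : t⁻¹ • halfSp N = halfSp N := by
    ext x
    rw [mem_smul_set_iff_inv_smul_mem₀ (inv_pos.2 ht).ne', inv_inv]
    show 0 < t * x 0 ↔ 0 < x 0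
    exact mul_pos_iff_of_pos_left ht
  simp only [pd_neckBump ht]
  rw [Measure.setIntegral_comp_smul_of_pos volume (pd 0 (unitBump N)) _ (inv_pos.2 ht), hH,
    finrank_euclideanSpace_fin, inv_pow, inv_inv, smul_eq_mul, bumpFlux]
  ring

/-- Second-order expansion of the radial ground state at the boundary. -/
theorem exists_radial_expansion (hs : IsFirstZero N s₀) : ∃ M, 0 ≤ M ∧ ∀ y, 0 ≤ y → y ≤ 1 →
    |radialFun N (s₀ * (1 - y)) + s₀ * deriv (radialFun N) s₀ * y| ≤ M * y ^ 2 := by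
  have hF : ContDiff ℝ 2 (radialFun N) := contDiff_radialFun one_le_dim (n := 2)
  have hF1 : Differentiable ℝ (radialFun N) := hF.differentiable (by norm_num)
  have hF' : ContDiff ℝ 1 (deriv (radialFun N)) := hF.deriv'
  have hs0 := hs.pos
  obtain ⟨M, hM⟩ := isCompact_Icc.exists_bound_of_continuousOn (s := Icc (0 : ℝ) s₀)
    (hF'.continuous_deriv (by norm_num)).continuousOn
  have hM0 : 0 ≤ M := (norm_nonneg _).trans (hM 0 ⟨le_rfl, hs0.le⟩)
  refine ⟨M * s₀ ^ 2, by positivity, fun y h0 h1 => ?_⟩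
  set s := s₀ * (1 - y) with hsdef
  have hs1 : 0 ≤ s := mul_nonneg hs0.le (by linarith)
  have hs2 : s ≤ s₀ := by nlinarith
  have hlip : ∀ r ∈ Icc s s₀, ‖deriv (radialFun N) r - deriv (radialFun N) s₀‖ ≤ M * (s₀ - s) := by
    intro r hr
    have := (convex_Icc (0 : ℝ) s₀).norm_image_sub_le_of_norm_deriv_le (f := deriv (radialFun N))
      (fun x _ => hF'.differentiable (by norm_num) x) hM (x := s₀) (y := r)
      ⟨hs0.le, le_rfl⟩ ⟨hs1.trans hr.1, hr.2⟩
    refine this.trans (mul_le_mul_of_nonneg_left ?_ hM0)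
    rw [Real.norm_eq_abs, abs_sub_comm, abs_of_nonneg (by linarith [hr.2])]
    linarith [hr.1]
  have hd : ∀ r, HasDerivAt (fun r => radialFun N r - deriv (radialFun N) s₀ * r)
      (deriv (radialFun N) r - deriv (radialFun N) s₀) r := fun r => by
    have := (hF1 r).hasDerivAt.sub ((hasDerivAt_id r).const_mul (deriv (radialFun N) s₀))
    exact this.congr_deriv (by simp)
  have h := (convex_Icc s s₀).norm_image_sub_le_of_norm_deriv_le
    (f := fun r => radialFun N r - deriv (radialFun N) s₀ * r)
    (fun x _ => (hd x).differentiableAt) (fun x hx => by rw [(hd x).deriv]; exact hlip x hx)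
    (x := s₀) (y := s) ⟨hs2, le_rfl⟩ ⟨le_rfl, hs2⟩
  rw [hs.eq_zero] at h
  have e1 : s₀ - s = s₀ * y := by rw [hsdef]; ring
  have e2 : ‖s - s₀‖ = s₀ * y := by
    rw [Real.norm_eq_abs, abs_sub_comm, e1, abs_of_nonneg (by positivity)]
  rw [e2, e1, Real.norm_eq_abs] at h
  refine le_trans (le_of_eq ?_) (h.trans (le_of_eq ?_))
  · congr 1; rw [hsdef]; ring
  · ring

set_option maxHeartbeats 800000 in
/-- Near the neck the trial function is linear up to an error of order `t ^ 2`. -/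
theorem exists_trialFun_expansion (hs : IsFirstZero N s₀) : ∃ C, 0 ≤ C ∧ ∀ (t δ : ℝ) (x : Sp N),
    0 < t → t ≤ 1 / 4 → 0 < δ → δ ≤ t ^ 2 → ‖x‖ ≤ t → 0 ≤ x 0 →
    |trialFun s₀ t δ (EuclideanSpace.single 0 (1 - t ^ 2)) x -
      -(2 * s₀ * deriv (radialFun N) s₀) * x 0| ≤ C * t ^ 2 := by
  obtain ⟨M, hM0, hM⟩ := exists_radial_expansion hs
  obtain ⟨L, hL0, hL⟩ := exists_radial_lipschitz hs
  have hs0 := hs.pos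
  set F' := deriv (radialFun N) s₀ with hF'
  have hF'0 : F' < 0 := hs.deriv_neg s₀ hs0.le le_rfl
  set p := -(s₀ * F') with hp
  have hp0 : 0 < p := by nlinarith
  refine ⟨16 * M + 6 * L + 4 * p, by positivity, fun t δ x ht ht4 hδ hδt hx hx0 => ?_⟩
  set c : Sp N := EuclideanSpace.single 0 (1 - t ^ 2) with hc
  have hx0t : x 0 ≤ t := (le_abs_self _).trans ((PiLp.norm_apply_le x 0).trans hx)
  have hr : ‖x - c‖ ^ 2 = ‖x‖ ^ 2 - 2 * (1 - t ^ 2) * x 0 + (1 - t ^ 2) ^ 2 :=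
    norm_sub_single_sq x _
  have hxsq : ‖x‖ ^ 2 ≤ t ^ 2 := pow_le_pow_left₀ (norm_nonneg _) hx 2
  obtain ⟨y, hy⟩ : ∃ y, y = 1 - ‖x - c‖ ^ 2 := ⟨_, rfl⟩
  have ht2 : 0 < t ^ 2 := by positivity
  have htt : t ^ 2 ≤ 1 / 16 := by nlinarith
  have hm : t ^ 2 * x 0 ≤ t ^ 2 * (1 / 4) := mul_le_mul_of_nonneg_left (by linarith) ht2.le
  have hm0 : 0 ≤ t ^ 2 * x 0 := by positivity
  have hq : t ^ 2 * t ^ 2 ≤ t ^ 2 * (1 / 16) := mul_le_mul_of_nonneg_left htt ht2.le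
  have hy1 : y - 2 * x 0 ≤ 2 * t ^ 2 := by nlinarith [sq_nonneg ‖x‖]
  have hy2 : -(2 * t ^ 2) ≤ y - 2 * x 0 := by nlinarith
  have hre : ‖x - c‖ ^ 2 = 1 - y := by linarith
  have hpe : -(2 * s₀ * F') = 2 * p := by rw [hp]; ring
  rw [hpe]
  have hMt : 0 ≤ M * t ^ 2 := by positivity
  have hLt : 0 ≤ L * t ^ 2 := by positivity
  have hpt : 0 ≤ p * t ^ 2 := by positivity
  by_cases hA : 2 * t ^ 2 ≤ x 0 ∧ ‖x - c‖ ^ 2 ≤ 1 - 2 * δ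
  · have hf : trialFun s₀ t δ c x = radialFun N (s₀ * (1 - y)) := by
      rw [trialFun, bulkCut_eq_one ht hδ hA.1 hA.2, mul_one, hre]
    rw [hf]
    have hy0 : 0 ≤ y := by linarith [hA.2]
    have hy3 : y ≤ 4 * t := by nlinarith
    have h := abs_le.1 (hM y hy0 (by linarith))
    have h4 : M * y ^ 2 ≤ M * (16 * t ^ 2) := mul_le_mul_of_nonneg_left
      (by have := pow_le_pow_left₀ hy0 hy3 2; linarith) hM0
    have h5 : p * (y - 2 * x 0) ≤ p * (2 * t ^ 2) := mul_le_mul_of_nonneg_left hy1 hp0.le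
    have h6 : p * -(2 * t ^ 2) ≤ p * (y - 2 * x 0) := mul_le_mul_of_nonneg_left hy2 hp0.le
    have h7 : s₀ * F' * y = -(p * y) := by rw [hp]; ring
    rw [h7] at h
    obtain ⟨h8, h9⟩ := h
    rw [abs_le]; constructor <;> linarith
  · have hx2 : x 0 ≤ 2 * t ^ 2 := by
      rw [not_and_or, not_le, not_le] at hA
      rcases hA with h | h <;> linarith
    have h1 : 0 ≤ trialFun s₀ t δ c x := (trialFun_mem_Icc hs ht hδ x).1
    have h2 : trialFun s₀ t δ c x ≤ L * (6 * t ^ 2) := by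
      by_cases hb : 1 - δ < ‖x - c‖ ^ 2
      · rw [trialFun_eq_zero ht hδ (Or.inr hb)]; positivity
      · have hr1 : ‖x - c‖ ^ 2 ≤ 1 := by linarith
        calc trialFun s₀ t δ c x ≤ radialFun N (s₀ * ‖x - c‖ ^ 2) :=
              mul_le_of_le_one_right (radial_mem_Icc hs (sq_nonneg _) hr1).1 (bulkCut_le_one x)
          _ ≤ L * (1 - ‖x - c‖ ^ 2) := hL _ (sq_nonneg _) hr1
          _ ≤ _ := mul_le_mul_of_nonneg_left (by linarith) hL0
    have h3 : p * x 0 ≤ p * (2 * t ^ 2) := mul_le_mul_of_nonneg_left hx2 hp0.le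
    have h4 : 0 ≤ p * x 0 := by positivity
    rw [abs_le]; constructor <;> linarith
end

section
variable {N : ℕ} [NeZero N] {s₀ : ℝ}

theorem exists_le_integral_trialFun_mul_laplacian (hs : IsFirstZero N s₀) : ∃ C, 0 ≤ C ∧
    ∀ t δ : ℝ, 0 < t → t ≤ 1 / 4 → 0 < δ → δ ≤ t ^ 2 →
    -(2 * s₀ * deriv (radialFun N) s₀) * (t ^ N * bumpFlux N) - C * t ^ (N + 1) ≤
      ∫ x, trialFun s₀ t δ (EuclideanSpace.single 0 (1 - t ^ 2)) x *
        ∑ i, pd i (pd i (neckBump N t)) x := by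
  obtain ⟨C, hC0, hC⟩ := exists_trialFun_expansion hs
  obtain ⟨M, hM0, hM⟩ := exists_laplacian_neckBump_bound N
  set ω := (volume (ball (0 : Sp N) 1)).toReal with hω
  have hω0 : 0 ≤ ω := ENNReal.toReal_nonneg
  refine ⟨C * M * ω, by positivity, fun t δ ht ht4 hδ hδt => ?_⟩
  set f := trialFun s₀ t δ (EuclideanSpace.single 0 (1 - t ^ 2) : Sp N) with hf
  set D : Sp N → ℝ := fun x => ∑ i, pd i (pd i (neckBump N t)) x with hD
  set a := -(2 * s₀ * deriv (radialFun N) s₀) with ha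
  have hpb : ∀ i, ContDiff ℝ 1 (pd i (neckBump N t)) := fun i => contDiff_iff_contDiffAt.2 fun x =>
    contDiffAt_pd (contDiff_neckBump (n := 2)).contDiffAt (by norm_num) i
  have hDc : Continuous D := continuous_finsetSum _ fun i _ => continuous_pd (hpb i) i
  have hD0 : ∀ x, x ∉ closedBall (0 : Sp N) t → D x = 0 := fun x hx => by
    refine Finset.sum_eq_zero fun i _ => pd_eq_zero_of_notMem (fun h' => hx ?_) i
    refine tsupport_neckBump ht (closure_minimal (fun y hy => ?_) (isClosed_tsupport _) h')
    by_contra hn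
    exact hy (pd_eq_zero_of_notMem hn i)
  have hDs : HasCompactSupport D := HasCompactSupport.intro (isCompact_closedBall 0 t) hD0
  have hfc : Continuous f := (contDiff_trialFun (n := 0)).continuous
  have i1 : Integrable (fun x => f x * D x) :=
    (hfc.mul hDc).integrable_of_hasCompactSupport hDs.mul_left
  have i2 : Integrable (fun x : Sp N => x 0 * D x) :=
    ((by fun_prop : Continuous fun x : Sp N => x 0).mul hDc).integrable_of_hasCompactSupport
      hDs.mul_left
  have e1 : ∫ x, f x * D x = ∫ x in halfSp N, f x * D x := by
    refine (setIntegral_eq_integral_of_forall_compl_eq_zero fun x hx => ?_).symm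
    have hx' : x 0 ≤ 0 := not_lt.1 hx
    rw [hf, trialFun_eq_zero ht hδ (Or.inl (hx'.trans_lt (by positivity))), zero_mul]
  have e2 : ∫ x in halfSp N, x 0 * D x = t ^ N * bumpFlux N := by
    rw [hD, setIntegral_coord_mul_laplacian (contDiff_neckBump (n := 2))
      (hasCompactSupport_neckBump ht), setIntegral_pd_neckBump ht, neg_neg]
  have e3 : ∫ x in halfSp N, f x * D x = a * (t ^ N * bumpFlux N) +
      ∫ x in halfSp N, (f x - a * x 0) * D x := by
    rw [← e2, ← integral_const_mul, ← integral_add (i2.integrableOn.const_mul a)]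
    · refine integral_congr_ae (ae_of_all _ fun x => ?_); ring
    · have := (i1.sub (i2.const_mul a)).integrableOn (s := halfSp N)
      refine this.congr (ae_of_all _ fun x => ?_)
      simp only [Pi.sub_apply]; ring
  have e4 : ∫ x in halfSp N, (f x - a * x 0) * D x =
      ∫ x in halfSp N ∩ closedBall 0 t, (f x - a * x 0) * D x :=
    (setIntegral_eq_of_subset_of_forall_sdiff_eq_zero measurableSet_halfSp inter_subset_left
      fun x hx => by rw [hD0 x fun h => hx.2 ⟨hx.1, h⟩, mul_zero])
  have hvol : (volume (closedBall (0 : Sp N) t)).toReal = t ^ N * ω := by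
    rw [Measure.addHaar_closedBall _ _ ht.le, ENNReal.toReal_mul,
      ENNReal.toReal_ofReal (by positivity), finrank_euclideanSpace_fin]
  have e5 : ‖∫ x in halfSp N ∩ closedBall 0 t, (f x - a * x 0) * D x‖ ≤
      C * t ^ 2 * (M * t⁻¹) * (volume (halfSp N ∩ closedBall (0 : Sp N) t)).toReal := by
    refine norm_setIntegral_le_of_norm_le_const ?_ fun x hx => ?_
    · exact (measure_mono inter_subset_right).trans_lt measure_closedBall_lt_top
    · rw [norm_mul]
      have hx2 : ‖x‖ ≤ t := by simpa using hx.2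
      exact mul_le_mul (hC t δ x ht ht4 hδ hδt hx2 (le_of_lt hx.1)) (hM t ht x) (norm_nonneg _)
        (by positivity)
  have e6 : (volume (halfSp N ∩ closedBall (0 : Sp N) t)).toReal ≤ t ^ N * ω := by
    rw [← hvol]
    exact ENNReal.toReal_mono measure_closedBall_lt_top.ne (measure_mono inter_subset_right)
  have e7 : C * t ^ 2 * (M * t⁻¹) * (volume (halfSp N ∩ closedBall (0 : Sp N) t)).toReal ≤
      C * M * ω * t ^ (N + 1) := by
    refine (mul_le_mul_of_nonneg_left e6 (by positivity)).trans (le_of_eq ?_)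
    field_simp
    ring
  have e8 := (abs_le.1 (e5.trans e7)).1
  rw [e1, e3, e4]
  linarith

/-- Symmetrizing a function supported on one side of the hyperplane. -/
theorem integral_symmetrize {f b : Sp N → ℝ} (hf : ContDiff ℝ 1 f) (hfc : HasCompactSupport f)
    (hb : ContDiff ℝ 1 b) (hbc : HasCompactSupport b) (hbe : ∀ x, b (refl0 N x) = b x)
    (hd : Disjoint (tsupport f) (tsupport fun x => f (refl0 N x))) (τ : ℝ) :
    (∫ x, ‖fderiv ℝ (fun y => f y + f (refl0 N y) + τ * b y) x‖ ^ 2 =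
      2 * (∫ x, ‖fderiv ℝ (fun y => f y + τ * b y) x‖ ^ 2) - τ ^ 2 * ∫ x, ‖fderiv ℝ b x‖ ^ 2) ∧
    ∫ x, (f x + f (refl0 N x) + τ * b x) ^ 2 =
      2 * (∫ x, (f x + τ * b x) ^ 2) - τ ^ 2 * ∫ x, b x ^ 2 := by
  set v : Sp N → ℝ := fun y => f y + τ * b y with hv
  have hv1 : ContDiff ℝ 1 v := hf.add (contDiff_const.mul hb)
  have hvc : HasCompactSupport v := hfc.add hbc.mul_left
  have hg : ContDiff ℝ 1 fun y => f (refl0 N y) := hf.comp (refl0 N).contDiff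
  have hvr : (fun y => v (refl0 N y)) = fun y => f (refl0 N y) + τ * b y := by
    funext y; simp only [hv, hbe]
  have hdf : Differentiable ℝ f := hf.differentiable (by norm_num)
  have hdg : Differentiable ℝ fun y => f (refl0 N y) := hg.differentiable (by norm_num)
  have hdb : Differentiable ℝ b := hb.differentiable (by norm_num)
  have hdτ : Differentiable ℝ fun y => τ * b y := hdb.const_mul τ
  constructor
  · have hpt : ∀ x, ‖fderiv ℝ (fun y => f y + f (refl0 N y) + τ * b y) x‖ ^ 2 =
        ‖fderiv ℝ v x‖ ^ 2 + ‖fderiv ℝ v (refl0 N x)‖ ^ 2 - τ ^ 2 * ‖fderiv ℝ b x‖ ^ 2 := by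
      intro x
      rw [← norm_fderiv_comp_refl0 (u := v), hvr]
      simp only [norm_sq_fderiv, Finset.mul_sum, ← Finset.sum_add_distrib,
        ← Finset.sum_sub_distrib]
      refine Finset.sum_congr rfl fun i _ => ?_
      have h0 : pd i f x * pd i (fun y => f (refl0 N y)) x = 0 := by
        by_cases hx : x ∈ tsupport f
        · rw [pd_eq_zero_of_notMem (Set.disjoint_left.1 hd hx), mul_zero]
        · rw [pd_eq_zero_of_notMem hx, zero_mul]
      rw [pd_add (u := fun y => f y + f (refl0 N y)) (v := fun y => τ * b y)
        ((hdf x).add (hdg x)) (hdτ x), pd_add (v := fun y => f (refl0 N y)) (hdf x) (hdg x), hv,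
        pd_add (v := fun y => τ * b y) (hdf x) (hdτ x),
        pd_add (u := fun y => f (refl0 N y)) (v := fun y => τ * b y) (hdg x) (hdτ x),
        pd_smul_const τ i (hdb x)]
      linear_combination 2 * h0
    have j1 := integrable_norm_fderiv_sq hv1 hvc
    have j2 : Integrable fun x => ‖fderiv ℝ v (refl0 N x)‖ ^ 2 :=
      (refl0 N).measurePreserving.integrable_comp_of_integrable j1
    have j3 := (integrable_norm_fderiv_sq hb hbc).const_mul (τ ^ 2)
    simp only [hpt]
    rw [integral_sub (f := fun x => ‖fderiv ℝ v x‖ ^ 2 + ‖fderiv ℝ v (refl0 N x)‖ ^ 2)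
        (j1.add j2) j3,
      integral_add j1 j2, integral_const_mul, integral_comp_refl0 fun x => ‖fderiv ℝ v x‖ ^ 2]
    ring
  · have hpt : ∀ x, (f x + f (refl0 N x) + τ * b x) ^ 2 =
        v x ^ 2 + v (refl0 N x) ^ 2 - τ ^ 2 * b x ^ 2 := by
      intro x
      have h0 : f x * f (refl0 N x) = 0 := by
        by_cases hx : x ∈ tsupport f
        · rw [image_eq_zero_of_notMem_tsupport (f := fun x => f (refl0 N x))
            (Set.disjoint_left.1 hd hx), mul_zero]
        · rw [image_eq_zero_of_notMem_tsupport hx, zero_mul]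
      simp only [hv, hbe]
      linear_combination 2 * h0
    have j1 := integrable_sq hv1.continuous hvc
    have j2 : Integrable fun x => v (refl0 N x) ^ 2 :=
      (refl0 N).measurePreserving.integrable_comp_of_integrable j1
    have j3 := (integrable_sq hb.continuous hbc).const_mul (τ ^ 2)
    simp only [hpt]
    rw [integral_sub (f := fun x => v x ^ 2 + v (refl0 N x) ^ 2) (j1.add j2) j3,
      integral_add j1 j2, integral_const_mul, integral_comp_refl0 fun x => v x ^ 2]
    ring

theorem integral_trialFun_sq_le (hs : IsFirstZero N s₀) {t δ : ℝ} (ht : 0 < t) (hδ : 0 < δ)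
    (c : Sp N) : ∫ x, trialFun s₀ t δ c x ^ 2 ≤ (volume (ball (0 : Sp N) 1)).toReal := by
  have h0 : ∀ x, x ∉ ball c 1 → trialFun s₀ t δ c x ^ 2 = 0 := fun x hx => by
    rw [mem_ball_iff_norm, not_lt] at hx
    rw [trialFun_eq_zero ht hδ (Or.inr (by nlinarith)), zero_pow two_ne_zero]
  rw [← setIntegral_eq_integral_of_forall_compl_eq_zero h0]
  have hi : Integrable (fun x => trialFun s₀ t δ c x ^ 2) :=
    integrable_sq (contDiff_trialFun (n := 0)).continuous (hasCompactSupport_trialFun ht hδ)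
  calc ∫ x in ball c 1, trialFun s₀ t δ c x ^ 2 ≤ ∫ _ in ball c 1, (1 : ℝ) := by
        refine setIntegral_mono hi.integrableOn (integrableOn_const measure_ball_lt_top.ne)
          fun x => ?_
        exact pow_le_one₀ (trialFun_mem_Icc hs ht hδ x).1 (trialFun_mem_Icc hs ht hδ x).2
    _ = _ := by
        rw [setIntegral_const, smul_eq_mul, mul_one, Measure.real,
          Measure.addHaar_ball_center]

theorem closedBall_subset_pairBalls {t : ℝ} (ht : 0 < t) (ht1 : t < 1) :
    closedBall (0 : Sp N) t ⊆ pairBalls N (1 - t ^ 2) := by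
  intro x hx
  rw [mem_closedBall_iff_norm, sub_zero] at hx
  have hxsq : ‖x‖ ^ 2 ≤ t ^ 2 := pow_le_pow_left₀ (norm_nonneg _) hx 2
  have ht2 : 0 < t ^ 2 := by positivity
  have ht21 : t ^ 2 < 1 := by nlinarith
  have hb : ∀ z : ℝ, z ^ 2 < 1 → z < 1 := fun z hz => by nlinarith
  rcases le_total 0 (x 0) with h | h
  · left
    rw [mem_ball_iff_norm]
    refine hb _ ?_
    rw [norm_sub_single_sq]
    nlinarith [mul_nonneg (by linarith : 0 ≤ 1 - t ^ 2) h]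
  · right
    rw [mem_ball_iff_norm]
    refine hb _ ?_
    rw [norm_sub_single_sq]
    nlinarith [mul_nonneg (by linarith : 0 ≤ 1 - t ^ 2) (neg_nonneg.2 h)]

end

set_option maxHeartbeats 1000000 in
/-- The first eigenvalue of two overlapping balls drops by at least a multiple of `t ^ N`. -/
theorem exists_dirichletEV_one_le_sub {N : ℕ} [NeZero N] {s₀ : ℝ} (hs : IsFirstZero N s₀) :
    ∃ c > 0, ∀ᶠ t : ℝ in nhdsWithin 0 (Ioi 0),
      dirichletEV N 1 (pairBalls N (1 - t ^ 2)) ≤ s₀ - c * t ^ N := by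
  obtain ⟨C₁, hC₁0, hC₁⟩ := exists_energy_bound hs
  obtain ⟨C₂, hC₂0, hC₂⟩ := exists_le_integral_trialFun_mul_laplacian hs
  have hs0 := hs.pos
  have hF' := hs.deriv_neg s₀ hs0.le le_rfl
  set a := -(2 * s₀ * deriv (radialFun N) s₀) with ha
  have ha0 : 0 < a := by nlinarith
  set J := bumpFlux N with hJ
  have hJ0 : 0 < J := bumpFlux_pos
  set K := ∫ x, ‖fderiv ℝ (unitBump N) x‖ ^ 2 with hK
  have hK0 : 0 ≤ K := integral_nonneg fun x => sq_nonneg _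
  set B := ∫ x, unitBump N x ^ 2 with hB
  have hB0 : 0 ≤ B := integral_nonneg fun x => sq_nonneg _
  set ω := (volume (ball (0 : Sp N) 1)).toReal with hω
  have hω0 : 0 ≤ ω := ENNReal.toReal_nonneg
  set τ := a * J / (K + 1) with hτ
  have hτ0 : 0 < τ := by positivity
  have hτK : τ * K ≤ a * J := by
    rw [hτ, div_mul_eq_mul_div, div_le_iff₀ (by linarith)]
    nlinarith [mul_pos ha0 hJ0]
  set C₃ := 3 * C₁ + 4 * τ * C₂ with hC₃
  have hC₃0 : 0 ≤ C₃ := by positivity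
  set A := 4 * ω + 4 * τ ^ 2 * B with hA
  have hA0 : 0 ≤ A := by positivity
  set m := τ * (a * J) with hm
  have hm0 : 0 < m := by positivity
  refine ⟨m / (A + 1), by positivity, ?_⟩
  filter_upwards [Ioo_mem_nhdsGT (show (0 : ℝ) < 1 / 4 by norm_num),
    Ioo_mem_nhdsGT (show 0 < m / (C₃ + 1) by positivity)] with t ht₁ ht₂
  have ht := ht₁.1
  have ht4 : t ≤ 1 / 4 := ht₁.2.le
  have hC₃t : C₃ * t ≤ m := by
    have := ht₂.2.le
    rw [le_div_iff₀ (by linarith)] at this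
    nlinarith
  have htN : 0 < t ^ N := pow_pos ht N
  have hδ := cutWidth_pos N ht
  have hδ8 := cutWidth_le N ht ht4
  have hδt : t ^ (N + 1) / 8 ≤ t ^ 2 := by
    have h1 : t ^ (N + 1) ≤ t ^ 2 :=
      pow_le_pow_of_le_one ht.le (by linarith) (by have := one_le_dim (N := N); omega)
    have : 0 < t ^ (N + 1) := by positivity
    linarith
  have hE := hC₁ t _ (1 - t ^ 2) ht ht4 hδ hδ8 le_rfl (by nlinarith)
  have hL := hC₂ t _ ht ht4 hδ hδt
  have hI := integral_trialFun_sq_le hs ht hδ (EuclideanSpace.single 0 (1 - t ^ 2) : Sp N)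
  have hmf := trialFun_mem_testFun (N := N) (s₀ := s₀) (d := 1 - t ^ 2) ht hδ
  have hmg := comp_refl0_mem_testFun hmf
  have hdis := disjoint_tsupport_trialFun (s₀ := s₀) ht hδ
    (c := (EuclideanSpace.single 0 (1 - t ^ 2) : Sp N))
  have hfnn := fun x => (trialFun_mem_Icc (c := (EuclideanSpace.single 0 (1 - t ^ 2) : Sp N))
    hs ht hδ x).1
  set f := trialFun s₀ t (t ^ (N + 1) / 8) (EuclideanSpace.single 0 (1 - t ^ 2) : Sp N) with hf
  set b := neckBump N t with hb
  have hmb : b ∈ testFun N (pairBalls N (1 - t ^ 2)) :=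
    ⟨contDiff_neckBump, hasCompactSupport_neckBump ht,
      (tsupport_neckBump ht).trans (closedBall_subset_pairBalls ht (by linarith))⟩
  have hmu : (fun x => f x + f (refl0 N x) + τ * b x) ∈ testFun N (pairBalls N (1 - t ^ 2)) :=
    add_mem_testFun (add_mem_testFun hmf hmg) (smul_mem_testFun hmb τ)
  have hf1 : ContDiff ℝ 1 f := contDiff_of_mem_testFun hmf (n := 1)
  have hb1 : ContDiff ℝ 1 b := contDiff_of_mem_testFun hmb (n := 1)
  obtain ⟨hG, hS⟩ := integral_symmetrize hf1 hmf.2.1 hb1 hmb.2.1 neckBump_refl0 hdis τ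
  rw [integral_norm_fderiv_add_mul_sq hf1 hmf.2.1 (contDiff_of_mem_testFun hmb (n := 2)) hmb.2.1,
    hb, integral_norm_fderiv_neckBump_sq ht, ← hK, ← hb] at hG
  have i1 := integrable_sq hf1.continuous hmf.2.1
  have i2 := integrable_sq hb1.continuous hmb.2.1
  have i3 : Integrable fun x => (f x + τ * b x) ^ 2 :=
    integrable_sq (hf1.continuous.add (continuous_const.mul hb1.continuous))
      (hmf.2.1.add hmb.2.1.mul_left)
  have hlow : (∫ x, f x ^ 2) + τ ^ 2 * (∫ x, b x ^ 2) ≤ ∫ x, (f x + τ * b x) ^ 2 := by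
    rw [← integral_const_mul, ← integral_add i1 (i2.const_mul _)]
    refine integral_mono (i1.add (i2.const_mul _)) i3 fun x => ?_
    have : 0 ≤ τ * (f x * b x) := mul_nonneg hτ0.le (mul_nonneg (hfnn x) (neckBump_nonneg ht x))
    show f x ^ 2 + τ ^ 2 * b x ^ 2 ≤ (f x + τ * b x) ^ 2
    linarith only [this]
  have hupp : ∫ x, (f x + τ * b x) ^ 2 ≤ 2 * (∫ x, f x ^ 2) + 2 * τ ^ 2 * (∫ x, b x ^ 2) := by
    rw [← integral_const_mul, ← integral_const_mul,
      ← integral_add (i1.const_mul _) (i2.const_mul _)]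
    refine integral_mono i3 ((i1.const_mul _).add (i2.const_mul _)) fun x => ?_
    show (f x + τ * b x) ^ 2 ≤ 2 * f x ^ 2 + 2 * τ ^ 2 * b x ^ 2
    linarith only [sq_nonneg (f x - τ * b x)]
  have hIb0 : 0 ≤ ∫ x, b x ^ 2 := integral_nonneg fun x => sq_nonneg _
  have hIb : ∫ x, b x ^ 2 ≤ B := by
    rw [hb, integral_neckBump_sq ht]
    refine mul_le_of_le_one_left hB0 ?_
    exact mul_le_one₀ (pow_le_one₀ ht.le (by linarith)) htN.le (pow_le_one₀ ht.le (by linarith))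
  have hτ2 : 0 ≤ τ ^ 2 * ∫ x, b x ^ 2 := by positivity
  have hτB : τ ^ 2 * (∫ x, b x ^ 2) ≤ τ ^ 2 * B := mul_le_mul_of_nonneg_left hIb (sq_nonneg τ)
  have hU : ∫ x, (f x + f (refl0 N x) + τ * b x) ^ 2 ≤ A := by
    rw [hS, hA]; linarith
  have hlow' := mul_le_mul_of_nonneg_left hlow hs0.le
  have hτ2' := mul_nonneg hs0.le hτ2
  have hL' := mul_le_mul_of_nonneg_left hL (show 0 ≤ 4 * τ by positivity)
  have hτK' : τ * (τ * K) * t ^ N ≤ m * t ^ N :=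
    mul_le_mul_of_nonneg_right (mul_le_mul_of_nonneg_left hτK hτ0.le) htN.le
  have hC₃t' : C₃ * t * t ^ N ≤ m * t ^ N := mul_le_mul_of_nonneg_right hC₃t htN.le
  have hC₁t : 0 ≤ C₁ * t ^ (N + 1) := by positivity
  have hkey : ∫ x, ‖fderiv ℝ (fun x => f x + f (refl0 N x) + τ * b x) x‖ ^ 2 ≤
      s₀ * (∫ x, (f x + f (refl0 N x) + τ * b x) ^ 2) - m * t ^ N := by
    rw [hG, hS]
    have e1 : C₃ * t * t ^ N = 3 * (C₁ * t ^ (N + 1)) + 4 * τ * (C₂ * t ^ (N + 1)) := by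
      rw [hC₃, pow_succ]; ring
    have e2 : 4 * τ * (a * (t ^ N * J) - C₂ * t ^ (N + 1)) =
        4 * (m * t ^ N) - 4 * τ * (C₂ * t ^ (N + 1)) := by rw [hm]; ring
    have hmt : 0 < m * t ^ N := by positivity
    rw [e2] at hL'
    rw [e1] at hC₃t'
    linarith
  have hmt : 0 < m * t ^ N := by positivity
  refine dirichletEV_one_le hmu ?_ ?_
  · intro h0
    rw [h0] at hkey
    have : ∀ x, (f x + f (refl0 N x) + τ * b x) = 0 := congrFun h0
    simp only [this] at hkey
    have h1 : 0 ≤ ∫ x, ‖fderiv ℝ (0 : Sp N → ℝ) x‖ ^ 2 := integral_nonneg fun x => sq_nonneg _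
    simp at hkey
    linarith
  · refine hkey.trans ?_
    have h1 : m / (A + 1) * t ^ N * (∫ x, (f x + f (refl0 N x) + τ * b x) ^ 2) ≤ m * t ^ N := by
      refine (mul_le_mul_of_nonneg_left (hU.trans (by linarith : A ≤ A + 1)) (by positivity)).trans
        (le_of_eq ?_)
      field_simp
    linarith

section
variable {N : ℕ} [NeZero N]

theorem volume_inter_balls_le {t : ℝ} (ht : 0 < t) :
    (volume (ball (EuclideanSpace.single 0 (1 - t ^ 2) : Sp N) 1 ∩
      ball (EuclideanSpace.single 0 (-(1 - t ^ 2))) 1)).toReal ≤ 2 * 4 ^ (N - 1) * t ^ (N + 1) := by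
  have hsub : ball (EuclideanSpace.single 0 (1 - t ^ 2) : Sp N) 1 ∩
      ball (EuclideanSpace.single 0 (-(1 - t ^ 2))) 1 ⊆
      {x : Sp N | |x 0| ≤ t ^ 2 ∧ ∀ i, |x i| ≤ 2 * t} := by
    rintro x ⟨h1, h2⟩
    rw [mem_ball_iff_norm] at h1 h2
    have h3 := (PiLp.norm_apply_le (x - EuclideanSpace.single 0 (1 - t ^ 2)) 0).trans_lt h1
    have h4 := (PiLp.norm_apply_le (x - EuclideanSpace.single 0 (-(1 - t ^ 2))) 0).trans_lt h2
    simp only [PiLp.sub_apply, PiLp.single_apply, if_true, Real.norm_eq_abs] at h3 h4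
    rw [abs_lt] at h3 h4
    have h5 : ‖x - EuclideanSpace.single 0 (1 - t ^ 2)‖ ^ 2 < 1 :=
      pow_lt_one₀ (norm_nonneg _) h1 two_ne_zero
    have h6 : ‖x - EuclideanSpace.single 0 (-(1 - t ^ 2))‖ ^ 2 < 1 :=
      pow_lt_one₀ (norm_nonneg _) h2 two_ne_zero
    rw [norm_sub_single_sq] at h5 h6
    have h7 : ‖x‖ ^ 2 ≤ (2 * t) ^ 2 := by nlinarith [sq_nonneg (t ^ 2)]
    have h8 : ‖x‖ ≤ 2 * t :=
      (pow_le_pow_iff_left₀ (norm_nonneg x) (by linarith) two_ne_zero).1 h7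
    exact ⟨abs_le.2 ⟨by linarith, by linarith⟩, fun i => (PiLp.norm_apply_le x i).trans h8⟩
  have h := (measure_mono hsub).trans (volume_box_le (sq_nonneg t) (by linarith : (0 : ℝ) ≤ 2 * t))
  refine (ENNReal.toReal_le_of_le_ofReal (by positivity) h).trans (le_of_eq ?_)
  obtain ⟨n, hn⟩ := Nat.exists_eq_succ_of_ne_zero (NeZero.ne N)
  subst hn
  simp only [Nat.succ_eq_add_one, Nat.add_sub_cancel]
  rw [show 2 * (2 * t) = 4 * t by ring, mul_pow]; ring

theorem isOpen_pairBalls (d : ℝ) : IsOpen (pairBalls N d) := isOpen_ball.union isOpen_ball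

theorem volume_pairBalls_ne_top (d : ℝ) : volume (pairBalls N d) ≠ ⊤ :=
  ((measure_union_le _ _).trans_lt
    (ENNReal.add_lt_top.2 ⟨measure_ball_lt_top, measure_ball_lt_top⟩)).ne

/-- The `N`-th root of the volume ratio between two balls and the unit ball. -/
def volRatio (N : ℕ) [NeZero N] (d : ℝ) : ℝ :=
  ((volume (pairBalls N d)).toReal / (volume (ball (0 : Sp N) 1)).toReal) ^ (N : ℝ)⁻¹

theorem volRatio_pos (d : ℝ) : 0 < volRatio N d := by
  refine Real.rpow_pos_of_pos (div_pos ?_ (volume_ball_pos 0 one_pos)) _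
  refine (volume_ball_pos (EuclideanSpace.single (0 : Fin N) d) one_pos).trans_le ?_
  exact ENNReal.toReal_mono (volume_pairBalls_ne_top d) (measure_mono subset_union_left)

theorem volRatio_pow (d : ℝ) : volRatio N d ^ N =
    (volume (pairBalls N d)).toReal / (volume (ball (0 : Sp N) 1)).toReal :=
  Real.rpow_inv_natCast_pow (div_nonneg ENNReal.toReal_nonneg ENNReal.toReal_nonneg) (NeZero.ne N)

theorem volume_smul_pairBalls (d : ℝ) :
    volume ((volRatio N d)⁻¹ • pairBalls N d) = volume (ball (0 : Sp N) 1) := by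
  have h0 := volRatio_pos (N := N) d
  have hω : 0 < (volume (ball (0 : Sp N) 1)).toReal := volume_ball_pos 0 one_pos
  have hp := volRatio_pow (N := N) d
  have hV : (volume (pairBalls N d)).toReal =
      volRatio N d ^ N * (volume (ball (0 : Sp N) 1)).toReal := by rw [hp]; field_simp
  rw [Measure.addHaar_smul, finrank_euclideanSpace_fin, abs_of_pos (by positivity),
    ← ENNReal.ofReal_toReal (volume_pairBalls_ne_top d), hV,
    ← ENNReal.ofReal_mul (by positivity), ← mul_assoc, inv_pow, inv_mul_cancel₀ (by positivity),
    one_mul, ENNReal.ofReal_toReal measure_ball_lt_top.ne]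

theorem volRatio_pow_bounds : ∃ C, 0 ≤ C ∧ ∀ t : ℝ, 0 < t → t < 1 →
    2 * (1 - C * t ^ (N + 1)) ≤ volRatio N (1 - t ^ 2) ^ N ∧ volRatio N (1 - t ^ 2) ^ N ≤ 2 := by
  have hω : 0 < (volume (ball (0 : Sp N) 1)).toReal := volume_ball_pos 0 one_pos
  set ω := (volume (ball (0 : Sp N) 1)).toReal with hωd
  refine ⟨4 ^ (N - 1) / ω, by positivity, fun t ht ht1 => ?_⟩
  have h1 := volume_inter_balls_le (N := N) ht
  have h2 := measure_union_add_inter (μ := volume)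
    (ball (EuclideanSpace.single 0 (1 - t ^ 2) : Sp N) 1)
    (measurableSet_ball (x := (EuclideanSpace.single 0 (-(1 - t ^ 2)) : Sp N)) (ε := 1))
  rw [Measure.addHaar_ball_center volume (EuclideanSpace.single 0 (1 - t ^ 2) : Sp N) 1,
    Measure.addHaar_ball_center volume (EuclideanSpace.single 0 (-(1 - t ^ 2)) : Sp N) 1] at h2
  have h3 := congrArg ENNReal.toReal h2
  rw [ENNReal.toReal_add (show volume (_ ∪ _) ≠ ⊤ from volume_pairBalls_ne_top (N := N) (1 - t ^ 2))
    ((measure_mono inter_subset_left).trans_lt measure_ball_lt_top).ne,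
    ENNReal.toReal_add measure_ball_lt_top.ne measure_ball_lt_top.ne, ← hωd] at h3
  have h4 : (volume (pairBalls N (1 - t ^ 2))).toReal +
      (volume (ball (EuclideanSpace.single 0 (1 - t ^ 2) : Sp N) 1 ∩
      ball (EuclideanSpace.single 0 (-(1 - t ^ 2))) 1)).toReal = ω + ω := h3
  rw [volRatio_pow, ← hωd]
  have h5 : 0 ≤ (volume (ball (EuclideanSpace.single 0 (1 - t ^ 2) : Sp N) 1 ∩
      ball (EuclideanSpace.single 0 (-(1 - t ^ 2))) 1)).toReal := ENNReal.toReal_nonneg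
  constructor
  · rw [le_div_iff₀ hω]
    have : 2 * (1 - 4 ^ (N - 1) / ω * t ^ (N + 1)) * ω = 2 * ω - 2 * 4 ^ (N - 1) * t ^ (N + 1) := by
      field_simp
    linarith
  · rw [div_le_iff₀ hω]; linarith

/-- The radius of each of the two balls in `twoBalls`. -/
def halfRadius (N : ℕ) : ℝ := (2 : ℝ) ^ (-(1 : ℝ) / N)

theorem halfRadius_pos {N : ℕ} : 0 < halfRadius N := Real.rpow_pos_of_pos two_pos _

theorem halfRadius_pow : halfRadius N ^ N = 1 / 2 := by
  have : (N : ℝ) ≠ 0 := Nat.cast_ne_zero.2 (NeZero.ne N)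
  rw [halfRadius, ← Real.rpow_natCast, ← Real.rpow_mul two_pos.le, div_mul_cancel₀ _ this,
    Real.rpow_neg_one]
  norm_num

theorem halfRadius_le_one : halfRadius N ≤ 1 := by
  rw [← pow_le_one_iff_of_nonneg halfRadius_pos.le (NeZero.ne N), halfRadius_pow]
  norm_num

theorem half_le_halfRadius : 1 / 2 ≤ halfRadius N := by
  rw [← halfRadius_pow (N := N)]
  exact pow_le_of_le_one halfRadius_pos.le halfRadius_le_one (NeZero.ne N)

theorem twoBalls_eq : twoBalls N = halfRadius N • pairBalls N (2 / halfRadius N) := by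
  have h := halfRadius_pos (N := N)
  have hs : ∀ d : ℝ, halfRadius N • (EuclideanSpace.single 0 d : Sp N) =
      EuclideanSpace.single 0 (halfRadius N * d) := fun d => by
    ext i
    simp only [PiLp.smul_apply, PiLp.single_apply, smul_eq_mul]
    split_ifs <;> simp
  rw [pairBalls, smul_set_union, _root_.smul_ball h.ne', _root_.smul_ball h.ne', hs, hs, mul_neg,
    mul_div_cancel₀ _ h.ne', Real.norm_eq_abs, abs_of_pos h, mul_one]
  rfl

theorem dirichletEV_twoBalls {s₀ : ℝ} (hs : IsFirstZero N s₀) :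
    dirichletEV N 1 (twoBalls N) = (halfRadius N)⁻¹ ^ 2 * s₀ ∧
    dirichletEV N 2 (twoBalls N) = (halfRadius N)⁻¹ ^ 2 * s₀ := by
  have h := halfRadius_pos (N := N)
  have h1 : 1 ≤ 2 / halfRadius N := by
    rw [le_div_iff₀ h]; linarith [halfRadius_le_one (N := N)]
  have h4 : 2 / halfRadius N ≤ 4 := by
    rw [div_le_iff₀ h]; linarith [half_le_halfRadius (N := N)]
  obtain ⟨e1, e2⟩ := dirichletEV_pairBalls hs h1 h4
  rw [twoBalls_eq, dirichletEV_smul _ h, dirichletEV_smul _ h, e1, e2]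
  exact ⟨rfl, rfl⟩

/-- Normalizing the volume multiplies eigenvalues by `2 ^ (2 / N)` up to a factor
`1 - O(t ^ (N + 1))`. -/
theorem exists_scaling_factor (hN : 2 ≤ N) : ∃ C, 0 ≤ C ∧ ∀ t : ℝ, 0 < t → t < 1 → ∃ p : ℝ,
    1 - C * t ^ (N + 1) ≤ p ∧ p ≤ 1 ∧ ∀ k,
      dirichletEV N k ((volRatio N (1 - t ^ 2))⁻¹ • pairBalls N (1 - t ^ 2)) =
        (halfRadius N)⁻¹ ^ 2 * (p * dirichletEV N k (pairBalls N (1 - t ^ 2))) := by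
  obtain ⟨C, hC0, hC⟩ := volRatio_pow_bounds (N := N)
  refine ⟨C, hC0, fun t ht ht1 => ?_⟩
  obtain ⟨h1, h2⟩ := hC t ht ht1
  have hr := volRatio_pos (N := N) (1 - t ^ 2)
  have hρ := halfRadius_pos (N := N)
  set r := volRatio N (1 - t ^ 2)
  have hy0 : 0 ≤ r * halfRadius N := by positivity
  have hyN : (r * halfRadius N) ^ N = r ^ N / 2 := by rw [mul_pow, halfRadius_pow]; ring
  have hy1 : r * halfRadius N ≤ 1 := by
    rw [← pow_le_one_iff_of_nonneg hy0 (NeZero.ne N), hyN]; linarith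
  refine ⟨(r * halfRadius N) ^ 2, ?_, pow_le_one₀ hy0 hy1, fun k => ?_⟩
  · have := pow_le_pow_of_le_one hy0 hy1 hN
    rw [hyN] at this
    linarith
  · rw [dirichletEV_smul _ (inv_pos.2 hr), inv_inv]
    field_simp

end

/-- There is a family `{Ω̃_ε}` of open sets of measure `ω_N` with
`λ₁(Ω̃_ε) < λ₁(Θ)`, `λ₁(Ω̃_ε) → λ₁(Θ)` and
`(λ₂(Ω̃_ε) - λ₂(Θ))/(λ₁(Θ) - λ₁(Ω̃_ε)) → 0` as `ε → 0⁺`: the lower boundary of the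
attainable set reaches `P = (λ₁(Θ), λ₂(Θ))` with horizontal tangent. -/
theorem stmt_14 (N : ℕ) [NeZero N] (hN : 2 ≤ N) :
    ∃ ε₀ > (0 : ℝ), ∃ Ωf : ℝ → Set (EuclideanSpace ℝ (Fin N)),
      (∀ ε ∈ Ioo (0 : ℝ) ε₀,
        IsOpen (Ωf ε) ∧
        volume (Ωf ε) = volume (ball (0 : EuclideanSpace ℝ (Fin N)) 1) ∧
        dirichletEV N 1 (Ωf ε) < dirichletEV N 1 (twoBalls N)) ∧
      Tendsto (fun ε => dirichletEV N 1 (Ωf ε)) (nhdsWithin 0 (Ioi 0))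
        (nhds (dirichletEV N 1 (twoBalls N))) ∧
      Tendsto (fun ε =>
          (dirichletEV N 2 (Ωf ε) - dirichletEV N 2 (twoBalls N)) /
            (dirichletEV N 1 (twoBalls N) - dirichletEV N 1 (Ωf ε)))
        (nhdsWithin 0 (Ioi 0)) (nhds 0) := by
  obtain ⟨s₀, hs0, hz, hp, hd⟩ := exists_first_zero N
  have hs : IsFirstZero N s₀ := ⟨hs0, hz, hp, hd⟩
  obtain ⟨e1, e2⟩ := dirichletEV_twoBalls hs
  obtain ⟨C, hC0, hC⟩ := exists_scaling_factor hN
  obtain ⟨D, hD0, hD⟩ := exists_dirichletEV_le hs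
  obtain ⟨c, hc0, hc⟩ := exists_dirichletEV_one_le_sub hs
  have hlow := eventually_le_dirichletEV_two hN hs
  have hη := fun η (h : 0 < η) => eventually_sub_le_dirichletEV_one hN hs h
  have hq : 0 < (halfRadius N)⁻¹ ^ 2 := pow_pos (inv_pos.2 halfRadius_pos) 2
  set q := (halfRadius N)⁻¹ ^ 2
  set l₁ := fun t : ℝ => dirichletEV N 1 (pairBalls N (1 - t ^ 2)) with hl₁
  set l₂ := fun t : ℝ => dirichletEV N 2 (pairBalls N (1 - t ^ 2)) with hl₂
  have hsmall : ∀ᶠ t in nhdsWithin (0 : ℝ) (Ioi 0), 0 < t ∧ t ≤ 1 / 4 := by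
    filter_upwards [Ioo_mem_nhdsGT (show (0 : ℝ) < 1 / 4 by norm_num)] with t ht
    exact ⟨ht.1, ht.2.le⟩
  have hpos : ∀ᶠ t in nhdsWithin (0 : ℝ) (Ioi 0), 0 ≤ l₁ t := by
    filter_upwards [hη s₀ hs0] with t ht
    linarith [ht.1]
  choose! p hp1 hp2 hp3 using hC
  have ht0 : Tendsto (fun t : ℝ => t) (nhdsWithin 0 (Ioi 0)) (nhds 0) :=
    tendsto_nhdsWithin_of_tendsto_nhds tendsto_id
  have hp_lim : Tendsto p (nhdsWithin 0 (Ioi 0)) (nhds 1) := by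
    have h : Tendsto (fun t : ℝ => 1 - C * t ^ (N + 1)) (nhdsWithin 0 (Ioi 0)) (nhds 1) := by
      simpa using (tendsto_const_nhds (x := (1 : ℝ))).sub ((ht0.pow (N + 1)).const_mul C)
    refine tendsto_of_tendsto_of_tendsto_of_le_of_le' h tendsto_const_nhds ?_ ?_
    · filter_upwards [hsmall] with t ht using hp1 t ht.1 (by linarith [ht.2])
    · filter_upwards [hsmall] with t ht using hp2 t ht.1 (by linarith [ht.2])
  have hl_lim : Tendsto l₁ (nhdsWithin 0 (Ioi 0)) (nhds s₀) := by
    rw [tendsto_order]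
    refine ⟨fun a ha => ?_, fun a ha => ?_⟩
    · filter_upwards [hη ((s₀ - a) / 2) (by linarith)] with t ht
      have := ht.1
      linarith
    · filter_upwards [hc, hsmall] with t h1 h2
      have : 0 < c * t ^ N := mul_pos hc0 (pow_pos h2.1 N)
      linarith
  have hgap : ∀ᶠ t in nhdsWithin (0 : ℝ) (Ioi 0),
      q * (c * t ^ N) ≤ q * s₀ - q * (p t * l₁ t) := by
    filter_upwards [hsmall, hc, hpos] with t ht h1 h2
    have h3 : p t * l₁ t ≤ l₁ t := mul_le_of_le_one_left h2 (hp2 t ht.1 (by linarith [ht.2]))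
    rw [← mul_sub]
    exact mul_le_mul_of_nonneg_left (by linarith) hq.le
  set Ωf : ℝ → Set (EuclideanSpace ℝ (Fin N)) :=
    fun t => (volRatio N (1 - t ^ 2))⁻¹ • pairBalls N (1 - t ^ 2) with hΩ
  have hE : ∀ᶠ t in nhdsWithin (0 : ℝ) (Ioi 0),
      dirichletEV N 1 (Ωf t) = q * (p t * l₁ t) ∧ dirichletEV N 2 (Ωf t) = q * (p t * l₂ t) := by
    filter_upwards [hsmall] with t ht
    exact ⟨hp3 t ht.1 (by linarith [ht.2]) 1, hp3 t ht.1 (by linarith [ht.2]) 2⟩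
  have hlt : ∀ᶠ t in nhdsWithin (0 : ℝ) (Ioi 0),
      dirichletEV N 1 (Ωf t) < dirichletEV N 1 (twoBalls N) := by
    filter_upwards [hgap, hE, hsmall] with t h1 h2 h3
    rw [h2.1, e1]
    have : 0 < q * (c * t ^ N) := mul_pos hq (mul_pos hc0 (pow_pos h3.1 N))
    linarith
  obtain ⟨ε₀, hε₀, hsub⟩ := mem_nhdsGT_iff_exists_Ioo_subset.1 hlt
  refine ⟨ε₀, hε₀, Ωf, fun ε hε => ⟨?_, volume_smul_pairBalls _, hsub hε⟩, ?_, ?_⟩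
  · exact (isOpen_pairBalls _).smul₀ (inv_ne_zero (volRatio_pos _).ne')
  · rw [e1]
    have h := (hp_lim.mul hl_lim).const_mul q
    rw [one_mul] at h
    exact h.congr' (hE.mono fun t ht => ht.1.symm)
  · have hlim : Tendsto (fun t : ℝ => (C * s₀ + D) / c * t) (nhdsWithin 0 (Ioi 0)) (nhds 0) := by
      simpa using ht0.const_mul ((C * s₀ + D) / c)
    refine squeeze_zero_norm' ?_ hlim
    filter_upwards [hgap, hE, hsmall, hlow, hp_lim.eventually_const_lt one_pos]
      with t h1 h2 h3 h4 hp0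
    obtain ⟨ht, ht4⟩ := h3
    have hT : 0 < t ^ N := pow_pos ht N
    have hT1 : 0 < t ^ (N + 1) := pow_pos ht _
    have hDt : l₂ t ≤ s₀ + D * t ^ (N + 1) :=
      (hD t (1 - t ^ 2) ht ht4 le_rfl (by nlinarith [sq_nonneg t])).2
    have hpl := hp1 t ht (by linarith)
    have hpu := hp2 t ht (by linarith)
    have hnum : |p t * l₂ t - s₀| ≤ (C * s₀ + D) * t ^ (N + 1) := by
      have h5 : p t * l₂ t ≤ l₂ t := mul_le_of_le_one_left (hs0.le.trans h4) hpu
      have h6 : s₀ * (1 - p t) ≤ s₀ * (C * t ^ (N + 1)) :=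
        mul_le_mul_of_nonneg_left (by linarith) hs0.le
      have h7 : 0 ≤ s₀ * (C * t ^ (N + 1)) := by positivity
      have h8 : 0 ≤ D * t ^ (N + 1) := by positivity
      have h9 : p t * s₀ ≤ p t * l₂ t := mul_le_mul_of_nonneg_left h4 hp0.le
      rw [abs_le]
      constructor <;> linarith
    rw [h2.1, h2.2, e1, e2, norm_div, Real.norm_eq_abs, Real.norm_eq_abs, ← mul_sub, abs_mul,
      abs_of_pos hq]
    have hden : q * (c * t ^ N) ≤ |q * s₀ - q * (p t * l₁ t)| := h1.trans (le_abs_self _)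
    calc q * |p t * l₂ t - s₀| / |q * s₀ - q * (p t * l₁ t)|
        ≤ q * ((C * s₀ + D) * t ^ (N + 1)) / (q * (c * t ^ N)) := by
          gcongr
      _ = (C * s₀ + D) / c * t := by
          rw [pow_succ]; field_simp
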